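/- (Lefèvre 3.2.1) Let k be a field. Every homologically unital A∞-algebra is A∞-quasi-isomorphic to a strictly unital A∞-algebra, and every minimal homologically unital A∞-algebra is A∞-isomorphic to a strictly unital A∞-algebra. -/

import Mathlib

/-!
# Statement 14 (Lefèvre 3.2.1)

Every homologically unital A∞-algebra is A∞-quasi-isomorphic to a strictly unital
A∞-algebra, and every *minimal* homologically unital A∞-algebra is A∞-isomorphic to a
strictly unital A∞-algebra.

Conventions: the carrier of an A∞-algebra is the suspension `SA`; an element of `A⁰`
is an element of degree `-1` of `SA`.  With `m₂(x,y) = (-1)^{|x|} b₂(x,y)`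
(`|x| = p + 1` for `x` of degree `p` in `SA`), a strict unit is an element `e` of
degree `-1` (i.e. `e ∈ A⁰`) which is a unit for `m₂` and annihilates `b_n` for `n ≠ 2`;
a homological unit is a cycle `e` whose class is a two-sided unit for the product
induced by `m₂` on `H*A` (i.e. `m₂(e,x) - x` and `m₂(x,e) - x` are boundaries for
every homogeneous cycle `x`).
-/

open Finset Function

namespace Stmt14

variable (k : Type) [Field k]

/-- An `n`-ary operation is `k`-multilinear. -/
def IsMultilinear {M N : Type} [AddCommGroup M] [Module k M] [AddCommGroup N] [Module k N]
    {n : ℕ} (f : (Fin n → M) → N) : Prop :=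
  (∀ (v : Fin n → M) (i : Fin n) (x y : M),
      f (Function.update v i (x + y)) = f (Function.update v i x) + f (Function.update v i y)) ∧
  (∀ (v : Fin n → M) (i : Fin n) (a : k) (x : M),
      f (Function.update v i (a • x)) = a • f (Function.update v i x))

/-- The tuple obtained from `v` by replacing the `j` entries `v_{i+1}, …, v_{i+j}`
by the single entry `x`. -/
def insArg {M : Type} [Zero M] (n i j : ℕ) (v : Fin n → M) (x : M) :
    Fin (i + 1 + (n - i - j)) → M := fun t =>
  if h : (t : ℕ) < i ∧ (t : ℕ) < n then v ⟨t, h.2⟩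
  else if (t : ℕ) = i then x
  else if h2 : (t : ℕ) + j - 1 < n then v ⟨(t : ℕ) + j - 1, h2⟩ else 0

/-- The tuple `(v_{i+1}, …, v_{i+j})`. -/
def shiftArg {M : Type} [Zero M] (n i j : ℕ) (v : Fin n → M) : Fin j → M := fun t =>
  if h : i + (t : ℕ) < n then v ⟨i + t, h⟩ else 0

/-- The Koszul sign exponent `p_1 + ⋯ + p_i`. -/
def partialDeg (n i : ℕ) (p : Fin n → ℤ) : ℤ :=
  ∑ t ∈ Finset.range i, if h : t < n then p ⟨t, h⟩ else 0

/-- `b` is an A∞-algebra structure on the graded space `(M, gr)` (`gr` being the grading of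
the suspension `SA`): multilinear operations of degree `1`, defined for `n ≥ 1`, satisfying
the A∞-relations `∑_{i+j+l=n} b_{i+1+l} ∘ (1^{⊗i} ⊗ b_j ⊗ 1^{⊗l}) = 0` with Koszul signs. -/
def IsAInfinity (M : Type) [AddCommGroup M] [Module k M] (gr : ℤ → Submodule k M)
    (b : ∀ n : ℕ, (Fin n → M) → M) : Prop :=
  b 0 = 0 ∧
  (∀ n, IsMultilinear k (b n)) ∧
  (∀ (n : ℕ) (p : Fin n → ℤ) (v : Fin n → M),
      (∀ t, v t ∈ gr (p t)) → b n v ∈ gr (1 + ∑ t, p t)) ∧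
  (∀ (n : ℕ), 1 ≤ n → ∀ (p : Fin n → ℤ) (v : Fin n → M), (∀ t, v t ∈ gr (p t)) →
      ∑ i ∈ Finset.range n, ∑ j ∈ Finset.Icc 1 (n - i),
        ((-1 : k) ^ partialDeg n i p) •
          b (i + 1 + (n - i - j)) (insArg n i j v (b j (shiftArg n i j v))) = 0)

/-- `f` is a morphism of A∞-algebras from `(M, gr, b)` to `(M', gr', b')`:
a family of multilinear maps `f_n`, `n ≥ 1`, homogeneous of degree `0`, with
`∑_{i+j+l=n} f_{i+1+l} ∘ (1^{⊗i} ⊗ b_j ⊗ 1^{⊗l}) = ∑_{i_1+⋯+i_s=n} b'_s ∘ (f_{i_1} ⊗ ⋯ ⊗ f_{i_s})`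
(Koszul signs; the right-hand sum is over all compositions of `n`). -/
def IsAInfMorphism (M : Type) [AddCommGroup M] [Module k M] (gr : ℤ → Submodule k M)
    (b : ∀ n : ℕ, (Fin n → M) → M)
    (M' : Type) [AddCommGroup M'] [Module k M'] (gr' : ℤ → Submodule k M')
    (b' : ∀ n : ℕ, (Fin n → M') → M')
    (f : ∀ n : ℕ, (Fin n → M) → M') : Prop :=
  f 0 = 0 ∧
  (∀ n, IsMultilinear k (f n)) ∧
  (∀ (n : ℕ) (p : Fin n → ℤ) (v : Fin n → M),
      (∀ t, v t ∈ gr (p t)) → f n v ∈ gr' (∑ t, p t)) ∧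
  (∀ (n : ℕ), 1 ≤ n → ∀ (p : Fin n → ℤ) (v : Fin n → M), (∀ t, v t ∈ gr (p t)) →
      ∑ i ∈ Finset.range n, ∑ j ∈ Finset.Icc 1 (n - i),
        ((-1 : k) ^ partialDeg n i p) •
          f (i + 1 + (n - i - j)) (insArg n i j v (b j (shiftArg n i j v)))
      = ∑ comp : Composition n,
          b' comp.length (fun s => f (comp.blocksFun s) (fun t => v (comp.embedding s t))))

/-- A bundled A∞-algebra over `k` (the grading, which is an internal direct-sum
decomposition, is that of the suspension `SA`). -/
structure AInfAlg where
  M : Type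
  [acg : AddCommGroup M]
  [mod : Module k M]
  gr : ℤ → Submodule k M
  internal : DirectSum.IsInternal gr
  b : ∀ n : ℕ, (Fin n → M) → M
  isAInf : IsAInfinity k M gr b

attribute [instance] AInfAlg.acg AInfAlg.mod

variable {k}

/-- `e` is a strict unit for the A∞-algebra `(M, gr, b)`: it lies in `A⁰` (degree `-1`
of the suspension), is a unit for `m₂` (`m₂(x,y) = (-1)^{|x|} b₂(x,y)`), and for `n ≠ 2`
the operation `b_n` vanishes as soon as one of its arguments equals `e`. -/
def IsStrictUnit (M : Type) [AddCommGroup M] [Module k M] (gr : ℤ → Submodule k M)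
    (b : ∀ n : ℕ, (Fin n → M) → M) (e : M) : Prop :=
  e ∈ gr (-1) ∧
  (∀ x : M, b 2 ![e, x] = x) ∧
  (∀ (p : ℤ) (x : M), x ∈ gr p → ((-1 : k) ^ (p + 1)) • b 2 ![x, e] = x) ∧
  (∀ n : ℕ, n ≠ 2 → ∀ v : Fin n → M, (∃ t, v t = e) → b n v = 0)

/-- The A∞-algebra `A` is homologically unital: there is a cycle `e` of degree `-1`
(i.e. `e ∈ A⁰`) whose class is a unit for the multiplication induced by `m₂` on `H*A`. -/
def IsHomologicallyUnital (A : AInfAlg k) : Prop :=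
  ∃ e : A.M, e ∈ A.gr (-1) ∧ A.b 1 (fun _ => e) = 0 ∧
    (∀ (p : ℤ) (x : A.M), x ∈ A.gr p → A.b 1 (fun _ => x) = 0 →
      (∃ z ∈ A.gr (p - 1), A.b 2 ![e, x] - x = A.b 1 fun _ => z) ∧
      (∃ z ∈ A.gr (p - 1),
        ((-1 : k) ^ (p + 1)) • A.b 2 ![x, e] - x = A.b 1 fun _ => z))

/-! ### Recursion and convolution on tensor algebras -/

local notation "𝕋" => TensorAlgebra k
local notation "τ" => TensorAlgebra.ι k

section Convolution

variable {V V' V'' N N₁ N₂ N₃ : Type} [AddCommGroup V] [Module k V] [AddCommGroup V'] [Module k V']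
  [AddCommGroup V''] [Module k V'']
  [AddCommGroup N] [Module k N] [AddCommGroup N₁] [Module k N₁] [AddCommGroup N₂] [Module k N₂]
  [AddCommGroup N₃] [Module k N₃]

/-- Induction on tensors by prepending letters. -/
theorem tensor_induction {P : 𝕋 V → Prop} (one : P 1) (cons : ∀ x t, P t → P (τ x * t))
    (add : ∀ s t, P s → P t → P (s + t)) (smul : ∀ (a : k) t, P t → P (a • t)) (t : 𝕋 V) : P t := by
  have key : ∀ s, P s → P (t * s) := by
    induction t using TensorAlgebra.induction with
    | algebraMap r =>
      intro s hs
      rw [← Algebra.smul_def]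
      exact smul r s hs
    | ι x => exact fun s hs => cons x s hs
    | mul a b ha hb =>
      intro s hs
      rw [mul_assoc]
      exact ha _ (hb _ hs)
    | add a b ha hb =>
      intro s hs
      rw [add_mul]
      exact add _ _ (ha _ hs) (hb _ hs)
  simpa using key 1 one

theorem tensor_ext_family {I : Type*} {N : I → Type*} [∀ i, AddCommGroup (N i)]
    [∀ i, Module k (N i)]
    (F G : ∀ i, 𝕋 V →ₗ[k] N i) (h1 : ∀ i, F i 1 = G i 1)
    (h : ∀ x t, (∀ i, F i t = G i t) → ∀ i, F i (τ x * t) = G i (τ x * t)) (i : I) :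
    F i = G i := by
  ext1 t
  revert i
  induction t using tensor_induction with
  | one => exact h1
  | cons x t ih => exact h x t ih
  | add s t hs ht => intro i; rw [map_add, map_add, hs, ht]
  | smul a t ht => intro i; rw [map_smul, map_smul, ht]

theorem tensor_ext {F G : 𝕋 V →ₗ[k] N} (h1 : F 1 = G 1)
    (h : ∀ x t, F t = G t → F (τ x * t) = G (τ x * t)) : F = G :=
  tensor_ext_family (I := Unit) (fun _ => F) (fun _ => G) (fun _ => h1)
    (fun x t ht _ => h x t (ht ())) ()

/-- Left recursion on tensors. -/
noncomputable def tensorRec (α : V →ₗ[k] 𝕋 V →ₗ[k] N) (s : V →ₗ[k] N →ₗ[k] N) (n₀ : N) :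
    𝕋 V →ₗ[k] N :=
  LinearMap.snd k (𝕋 V) N ∘ₗ LinearMap.applyₗ ((1 : 𝕋 V), n₀) ∘ₗ
    (TensorAlgebra.lift k (LinearMap.mk₂ k
      (fun x (p : 𝕋 V × N) => (τ x * p.1, α x p.1 + s x p.2))
      (by intros; ext <;> simp [add_mul]; abel)
      (by intros; ext <;> simp)
      (by intros; ext <;> simp [mul_add]; abel)
      (by intros; ext <;> simp))).toLinearMap

theorem tensorRec_one (α : V →ₗ[k] 𝕋 V →ₗ[k] N) (s : V →ₗ[k] N →ₗ[k] N) (n₀ : N) :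
    tensorRec α s n₀ 1 = n₀ := by
  simp [tensorRec]

theorem tensorRec_cons (α : V →ₗ[k] 𝕋 V →ₗ[k] N) (s : V →ₗ[k] N →ₗ[k] N) (n₀ : N) (x : V)
    (t : 𝕋 V) : tensorRec α s n₀ (τ x * t) = α x t + s x (tensorRec α s n₀ t) := by
  have key : ∀ t, (TensorAlgebra.lift k (LinearMap.mk₂ k
      (fun x (p : 𝕋 V × N) => (τ x * p.1, α x p.1 + s x p.2))
      (by intros; ext <;> simp [add_mul]; abel)
      (by intros; ext <;> simp)
      (by intros; ext <;> simp [mul_add]; abel)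
      (by intros; ext <;> simp)) t (1, n₀)).1 = t := by
    intro t
    induction t using tensor_induction with
    | one => simp
    | cons x t ih => simp [ih]
    | add s t hs ht => rw [map_add, LinearMap.add_apply, Prod.fst_add, hs, ht]
    | smul a t ht => rw [map_smul, LinearMap.smul_apply, Prod.smul_fst, ht]
  simp only [tensorRec, LinearMap.comp_apply, AlgHom.toLinearMap_apply, map_mul]
  simp [key]

/-- Deconcatenation. -/
noncomputable def comul : 𝕋 V →ₗ[k] TensorProduct k (𝕋 V) (𝕋 V) :=
  tensorRec ((LinearMap.compRight k (TensorProduct.mk k (𝕋 V) (𝕋 V) 1)) ∘ₗ LinearMap.mul k (𝕋 V) ∘ₗ τ)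
    (LinearMap.rTensorHom (𝕋 V) ∘ₗ LinearMap.mul k (𝕋 V) ∘ₗ τ) (TensorProduct.tmul k 1 1)

theorem comul_one : comul (1 : 𝕋 V) = TensorProduct.tmul k 1 1 := tensorRec_one _ _ _

theorem comul_cons (x : V) (t : 𝕋 V) : comul (τ x * t) =
    TensorProduct.tmul k 1 (τ x * t) + (LinearMap.mulLeft k (τ x)).rTensor (𝕋 V) (comul t) :=
  tensorRec_cons _ _ _ x t

/-- The convolution of two linear maps along a bilinear map. -/
noncomputable def bconv (μ : N₁ →ₗ[k] N₂ →ₗ[k] N₃) :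
    (𝕋 V →ₗ[k] N₁) →ₗ[k] (𝕋 V →ₗ[k] N₂) →ₗ[k] (𝕋 V →ₗ[k] N₃) :=
  LinearMap.mk₂ k (fun c g => TensorProduct.lift (μ.compl₁₂ c g) ∘ₗ comul)
    (fun c c' g => by
      rw [← LinearMap.add_comp]; congr 1; ext; simp)
    (fun a c g => by
      rw [← LinearMap.smul_comp]; congr 1; ext; simp)
    (fun c g g' => by
      rw [← LinearMap.add_comp]; congr 1; ext; simp)
    (fun a c g => by
      rw [← LinearMap.smul_comp]; congr 1; ext; simp)

/-- Precomposition with the multiplication by a letter. -/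
noncomputable def lsh : (𝕋 V →ₗ[k] N) →ₗ[k] V →ₗ[k] (𝕋 V →ₗ[k] N) :=
  LinearMap.mk₂ k (fun c x => c ∘ₗ LinearMap.mulLeft k (τ x))
    (by intros; ext; simp) (by intros; ext; simp) (by intros; ext; simp [add_mul])
    (by intros; ext; simp)

theorem lsh_apply (c : 𝕋 V →ₗ[k] N) (x : V) (t : 𝕋 V) : lsh c x t = c (τ x * t) := rfl

theorem lsh_comp (f : N →ₗ[k] N₁) (c : 𝕋 V →ₗ[k] N) (x : V) :
    lsh (f ∘ₗ c) x = f ∘ₗ lsh c x := rfl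

theorem bconv_one (μ : N₁ →ₗ[k] N₂ →ₗ[k] N₃) (c : 𝕋 V →ₗ[k] N₁) (g : 𝕋 V →ₗ[k] N₂) :
    bconv μ c g 1 = μ (c 1) (g 1) := by
  simp [bconv, comul_one]

theorem bconv_cons (μ : N₁ →ₗ[k] N₂ →ₗ[k] N₃) (c : 𝕋 V →ₗ[k] N₁) (g : 𝕋 V →ₗ[k] N₂)
    (x : V) (t : 𝕋 V) :
    bconv μ c g (τ x * t) = μ (c 1) (g (τ x * t)) + bconv μ (lsh c x) g t := by
  simp only [bconv, LinearMap.mk₂_apply, LinearMap.comp_apply, comul_cons, map_add,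
    TensorProduct.lift.tmul, LinearMap.compl₁₂_apply]
  congr 1
  rw [← LinearMap.comp_apply]
  congr 1
  ext; simp [lsh_apply]

theorem bconv_map {N₁' N₂' N₃' : Type} [AddCommGroup N₁'] [Module k N₁'] [AddCommGroup N₂']
    [Module k N₂'] [AddCommGroup N₃'] [Module k N₃']
    {μ : N₁ →ₗ[k] N₂ →ₗ[k] N₃} {μ' : N₁' →ₗ[k] N₂' →ₗ[k] N₃'} {θ : N₃ →ₗ[k] N₃'}
    {θ₁ : N₁ →ₗ[k] N₁'} {θ₂ : N₂ →ₗ[k] N₂'} (h : ∀ x y, θ (μ x y) = μ' (θ₁ x) (θ₂ y))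
    (c : 𝕋 V →ₗ[k] N₁) (g : 𝕋 V →ₗ[k] N₂) :
    θ ∘ₗ bconv μ c g = bconv μ' (θ₁ ∘ₗ c) (θ₂ ∘ₗ g) := by
  simp only [bconv, LinearMap.mk₂_apply, ← LinearMap.comp_assoc]
  congr 1
  ext; simp [h]

theorem bconv_assoc {N₁₂ N₂₃ N₄ : Type} [AddCommGroup N₁₂] [Module k N₁₂] [AddCommGroup N₂₃]
    [Module k N₂₃] [AddCommGroup N₄] [Module k N₄]
    {μ : N₁ →ₗ[k] N₂ →ₗ[k] N₁₂} {μ' : N₁₂ →ₗ[k] N₃ →ₗ[k] N₄}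
    {ν : N₂ →ₗ[k] N₃ →ₗ[k] N₂₃} {ν' : N₁ →ₗ[k] N₂₃ →ₗ[k] N₄}
    (h : ∀ x y z, μ' (μ x y) z = ν' x (ν y z))
    (a : 𝕋 V →ₗ[k] N₁) (b : 𝕋 V →ₗ[k] N₂) (c : 𝕋 V →ₗ[k] N₃) :
    bconv μ' (bconv μ a b) c = bconv ν' a (bconv ν b c) := by
  revert a
  apply tensor_ext_family
  · intro a
    simp [bconv_one, h]
  · intro x t ih a
    have h1 : lsh (bconv μ a b) x = μ (a 1) ∘ₗ lsh b x + bconv μ (lsh a x) b := by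
      ext s; simp [lsh_apply, bconv_cons]
    have h2 : ν' (a 1) ∘ₗ bconv ν (lsh b x) c = bconv μ' (μ (a 1) ∘ₗ lsh b x) c :=
      bconv_map (θ₂ := LinearMap.id) (fun y z => (h _ y z).symm) _ _
    simp only [bconv_cons, h1, map_add, LinearMap.add_apply, bconv_one, ih, h, ← h2,
      LinearMap.comp_apply, add_assoc]

/-- The convolution of linear maps with values in an algebra. -/
noncomputable abbrev conv {R : Type} [Ring R] [Algebra k R] (c g : 𝕋 V →ₗ[k] R) : 𝕋 V →ₗ[k] R :=
  bconv (LinearMap.mul k R) c g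

theorem conv_assoc {R : Type} [Ring R] [Algebra k R] (a b c : 𝕋 V →ₗ[k] R) :
    conv (conv a b) c = conv a (conv b c) :=
  bconv_assoc (fun x y z => by simp [mul_assoc]) a b c

variable (V) in
/-- The augmentation. -/
noncomputable abbrev aug : 𝕋 V →ₐ[k] k := TensorAlgebra.algebraMapInv

theorem aug_cons (x : V) (t : 𝕋 V) : aug V (τ x * t) = 0 := by
  simp [aug, TensorAlgebra.algebraMapInv]

theorem aug_letter (x : V) : aug V (τ x) = 0 := by
  rw [← mul_one (τ x), aug_cons]

variable (k V) in
/-- The augmentation followed by the unit of an algebra. -/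
noncomputable def uaug (R : Type) [Ring R] [Algebra k R] : 𝕋 V →ₗ[k] R :=
  Algebra.linearMap k R ∘ₗ (aug V).toLinearMap

theorem uaug_apply {R : Type} [Ring R] [Algebra k R] (t : 𝕋 V) :
    uaug k V R t = algebraMap k R (aug V t) := rfl

theorem uaug_one {R : Type} [Ring R] [Algebra k R] : uaug k V R 1 = 1 := by
  simp [uaug_apply]

theorem uaug_cons {R : Type} [Ring R] [Algebra k R] (x : V) (t : 𝕋 V) :
    uaug k V R (τ x * t) = 0 := by
  rw [uaug_apply, aug_cons, map_zero]

theorem lsh_uaug {R : Type} [Ring R] [Algebra k R] (x : V) : lsh (uaug k V R) x = 0 := by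
  ext t; exact uaug_cons x t

theorem uaug_conv {R : Type} [Ring R] [Algebra k R] (g : 𝕋 V →ₗ[k] R) :
    conv (uaug k V R) g = g := by
  apply tensor_ext
  · simp [bconv_one, uaug_one]
  · intro x t _
    simp [bconv_cons, uaug_one, lsh_uaug]

variable (k V) in
/-- The projection to the tensors of positive length. -/
noncomputable def pplus : 𝕋 V →ₗ[k] 𝕋 V := LinearMap.id - uaug k V (𝕋 V)

theorem pplus_one : pplus k V 1 = 0 := by simp [pplus, uaug_one]

theorem pplus_cons (x : V) (t : 𝕋 V) : pplus k V (τ x * t) = τ x * t := by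
  simp [pplus, uaug_cons]

theorem lsh_pplus (c : 𝕋 V →ₗ[k] N) (x : V) : lsh (c ∘ₗ pplus k V) x = lsh c x := by
  ext t; simp [lsh_apply, pplus_cons]

/-- The convolution with the restriction of the left factor to tensors of positive length. -/
noncomputable def pconv {R : Type} [Ring R] [Algebra k R] (c g : 𝕋 V →ₗ[k] R) : 𝕋 V →ₗ[k] R :=
  conv (c ∘ₗ pplus k V) g

theorem pconv_one {R : Type} [Ring R] [Algebra k R] (c g : 𝕋 V →ₗ[k] R) : pconv c g 1 = 0 := by
  simp [pconv, bconv_one, pplus_one]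

theorem pconv_cons {R : Type} [Ring R] [Algebra k R] (c g : 𝕋 V →ₗ[k] R) (x : V) (t : 𝕋 V) :
    pconv c g (τ x * t) = conv (lsh c x) g t := by
  simp [pconv, bconv_cons, pplus_one, lsh_pplus]

theorem bconv_eq (μ : N₁ →ₗ[k] N₂ →ₗ[k] N₃) (c : 𝕋 V →ₗ[k] N₁) (g : 𝕋 V →ₗ[k] N₂) :
    bconv μ c g = μ (c 1) ∘ₗ g + bconv μ (c ∘ₗ pplus k V) g := by
  apply tensor_ext
  · simp [bconv_one, pplus_one]
  · intro x t _
    simp [bconv_cons, lsh_pplus, pplus_one]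

theorem conv_eq {R : Type} [Ring R] [Algebra k R] (c g : 𝕋 V →ₗ[k] R) (t : 𝕋 V) :
    conv c g t = c 1 * g t + pconv c g t :=
  LinearMap.congr_fun (bconv_eq _ c g) t
end Convolution

/-! ### Coalgebra morphisms and coderivations -/

section Coalgebra

variable {V V' V'' N N₁ N₂ N₃ : Type} [AddCommGroup V] [Module k V] [AddCommGroup V'] [Module k V']
  [AddCommGroup V''] [Module k V'']
  [AddCommGroup N] [Module k N] [AddCommGroup N₁] [Module k N₁] [AddCommGroup N₂] [Module k N₂]
  [AddCommGroup N₃] [Module k N₃]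

/-- Linear maps of tensor algebras which respect the unit, the augmentation and the
deconcatenation (in the form of its compatibility with convolutions). -/
structure IsCoalg (q : 𝕋 V →ₗ[k] 𝕋 V') : Prop where
  one : q 1 = 1
  aug : ∀ t, aug V' (q t) = aug V t
  comul : comul ∘ₗ q = TensorProduct.map q q ∘ₗ comul

theorem IsCoalg.bconv {q : 𝕋 V →ₗ[k] 𝕋 V'} (hq : IsCoalg q) (μ : N₁ →ₗ[k] N₂ →ₗ[k] N₃)
    (c : 𝕋 V' →ₗ[k] N₁) (g : 𝕋 V' →ₗ[k] N₂) :
    bconv μ c g ∘ₗ q = bconv μ (c ∘ₗ q) (g ∘ₗ q) := by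
  simp only [Stmt14.bconv, LinearMap.mk₂_apply]
  rw [LinearMap.comp_assoc, hq.comul, ← LinearMap.comp_assoc]
  congr 1
  ext; simp

theorem IsCoalg.pplus {q : 𝕋 V →ₗ[k] 𝕋 V'} (hq : IsCoalg q) :
    pplus k V' ∘ₗ q = q ∘ₗ pplus k V := by
  ext t
  simp [Stmt14.pplus, uaug_apply, hq.aug, Algebra.algebraMap_eq_smul_one, hq.one]

theorem IsCoalg.pconv {R : Type} [Ring R] [Algebra k R] {q : 𝕋 V →ₗ[k] 𝕋 V'} (hq : IsCoalg q)
    (c g : 𝕋 V' →ₗ[k] R) : pconv c g ∘ₗ q = pconv (c ∘ₗ q) (g ∘ₗ q) := by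
  rw [Stmt14.pconv, hq.bconv, LinearMap.comp_assoc, hq.pplus]; rfl

theorem isCoalg_id : IsCoalg (LinearMap.id : 𝕋 V →ₗ[k] 𝕋 V) :=
  ⟨rfl, fun _ => rfl, by simp⟩

theorem IsCoalg.of_bconv {q : 𝕋 V →ₗ[k] 𝕋 V'} (one : q 1 = 1)
    (aug : ∀ t, Stmt14.aug V' (q t) = Stmt14.aug V t)
    (h : ∀ c : 𝕋 V' →ₗ[k] 𝕋 V', ∀ t,
      Stmt14.bconv (TensorProduct.mk k (𝕋 V') (𝕋 V')) c LinearMap.id (q t) =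
        Stmt14.bconv (TensorProduct.mk k (𝕋 V') (𝕋 V')) (c ∘ₗ q) q t) : IsCoalg q := by
  refine ⟨one, aug, ?_⟩
  ext t
  have h1 := h LinearMap.id t
  simp only [Stmt14.bconv, LinearMap.mk₂_apply, LinearMap.comp_apply] at h1
  have e1 : TensorProduct.lift ((TensorProduct.mk k (𝕋 V') (𝕋 V')).compl₁₂ LinearMap.id
      LinearMap.id) = LinearMap.id := by
    ext; simp
  have e2 : TensorProduct.lift ((TensorProduct.mk k (𝕋 V') (𝕋 V')).compl₁₂
      (LinearMap.id ∘ₗ q) q) = TensorProduct.map q q := by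
    ext; simp
  rw [e1, e2] at h1
  exact h1

/-- The algebra morphism generated by a linear map, as a linear map. -/
noncomputable def tmap (q : V →ₗ[k] V') : 𝕋 V →ₗ[k] 𝕋 V' :=
  (TensorAlgebra.lift k (τ ∘ₗ q)).toLinearMap

theorem tmap_one (q : V →ₗ[k] V') : tmap q 1 = 1 := by simp [tmap]

theorem tmap_mul (q : V →ₗ[k] V') (s t : 𝕋 V) : tmap q (s * t) = tmap q s * tmap q t := by
  simp [tmap]

theorem tmap_letter (q : V →ₗ[k] V') (x : V) : tmap q (τ x) = τ (q x) := by simp [tmap]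

theorem tmap_cons (q : V →ₗ[k] V') (x : V) (t : 𝕋 V) : tmap q (τ x * t) = τ (q x) * tmap q t := by
  rw [tmap_mul, tmap_letter]

theorem tmap_comp (q : V' →ₗ[k] V'') (r : V →ₗ[k] V') : tmap q ∘ₗ tmap r = tmap (q ∘ₗ r) := by
  apply tensor_ext
  · simp [tmap_one]
  · intro x t ih
    simp only [LinearMap.comp_apply, tmap_cons] at ih ⊢
    rw [ih]

theorem tmap_id : tmap (LinearMap.id : V →ₗ[k] V) = LinearMap.id := by
  apply tensor_ext
  · simp [tmap_one]
  · intro x t ih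
    simp only [LinearMap.id_apply, tmap_cons] at ih ⊢
    rw [ih]

theorem isCoalg_tmap (q : V →ₗ[k] V') : IsCoalg (tmap q) := by
  refine IsCoalg.of_bconv (tmap_one q) ?_ ?_
  · intro t
    induction t using tensor_induction with
    | one => simp [tmap_one]
    | cons x t ih => simp [tmap_cons, aug_cons]
    | add s t hs ht => simp [hs, ht]
    | smul a t ht => simp [ht]
  · intro c t
    revert c
    induction t using tensor_induction with
    | one => intro c; simp [tmap_one, bconv_one]
    | cons x t ih =>
      intro c
      have e : lsh (c ∘ₗ tmap q) x = lsh c (q x) ∘ₗ tmap q := by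
        ext s; simp [lsh_apply, tmap_cons]
      simp only [tmap_cons, bconv_cons, ih, e, LinearMap.comp_apply, tmap_one, LinearMap.id_apply]
    | add s t hs ht => intro c; simp [hs, ht]
    | smul a t ht => intro c; simp [ht]

theorem conv_map {R R' : Type} [Ring R] [Algebra k R] [Ring R'] [Algebra k R'] (θ : R →ₐ[k] R')
    (c g : 𝕋 V →ₗ[k] R) :
    θ.toLinearMap ∘ₗ conv c g = conv (θ.toLinearMap ∘ₗ c) (θ.toLinearMap ∘ₗ g) :=
  bconv_map (by simp) c g

theorem tmap_conv (q : V' →ₗ[k] V'') (c g : 𝕋 V →ₗ[k] 𝕋 V') :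
    tmap q ∘ₗ conv c g = conv (tmap q ∘ₗ c) (tmap q ∘ₗ g) :=
  conv_map _ c g

theorem tmap_pconv (q : V' →ₗ[k] V'') (c g : 𝕋 V →ₗ[k] 𝕋 V') :
    tmap q ∘ₗ pconv c g = pconv (tmap q ∘ₗ c) (tmap q ∘ₗ g) :=
  conv_map _ _ g

theorem IsCoalg.bconv_conv_step {q : 𝕋 V →ₗ[k] 𝕋 V'} (h1 : q 1 = 1) (μ : N₁ →ₗ[k] N₂ →ₗ[k] N₃)
    (g : 𝕋 V' →ₗ[k] N₂) (x : V) (t : 𝕋 V)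
    (hq : ∀ c : 𝕋 V' →ₗ[k] N₁, Stmt14.bconv μ c g (q (τ x * t)) =
      Stmt14.bconv μ (c ∘ₗ q) (g ∘ₗ q) (τ x * t))
    (ih : ∀ (c : 𝕋 V' →ₗ[k] N₁) (a : 𝕋 V →ₗ[k] V'), Stmt14.bconv μ c g (conv (τ ∘ₗ a) q t) =
      μ (c 1) (g (conv (τ ∘ₗ a) q t)) + Stmt14.bconv μ (c ∘ₗ conv (τ ∘ₗ a) q) (g ∘ₗ q) t)
    (c : 𝕋 V' →ₗ[k] N₁) (a : 𝕋 V →ₗ[k] V') :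
    Stmt14.bconv μ c g (conv (τ ∘ₗ a) q (τ x * t)) =
      μ (c 1) (g (conv (τ ∘ₗ a) q (τ x * t))) +
        Stmt14.bconv μ (c ∘ₗ conv (τ ∘ₗ a) q) (g ∘ₗ q) (τ x * t) := by
  have e1 : lsh (c ∘ₗ conv (τ ∘ₗ a) q) x =
      lsh (lsh c (a 1) ∘ₗ q) x + c ∘ₗ conv (τ ∘ₗ lsh a x) q := by
    ext s; simp [lsh_apply, bconv_cons, lsh_comp]
  rw [bconv_cons (c := c ∘ₗ conv (τ ∘ₗ a) q), e1]
  have e2 := hq (lsh c (a 1))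
  rw [bconv_cons] at e2
  have e3 := ih c (lsh a x)
  simp only [bconv_cons, LinearMap.comp_apply, LinearMap.mul_apply', map_add, lsh_comp,
    LinearMap.add_apply, bconv_one, h1, mul_one] at e2 e3 ⊢
  rw [e2, e3]
  simp only [lsh_apply, mul_one]
  abel

theorem IsCoalg.bconv_conv {q : 𝕋 V →ₗ[k] 𝕋 V'} (hq : IsCoalg q) (μ : N₁ →ₗ[k] N₂ →ₗ[k] N₃)
    (c : 𝕋 V' →ₗ[k] N₁) (g : 𝕋 V' →ₗ[k] N₂) (a : 𝕋 V →ₗ[k] V') (t : 𝕋 V) :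
    Stmt14.bconv μ c g (conv (τ ∘ₗ a) q t) =
      μ (c 1) (g (conv (τ ∘ₗ a) q t)) + Stmt14.bconv μ (c ∘ₗ conv (τ ∘ₗ a) q) (g ∘ₗ q) t := by
  revert c a
  induction t using tensor_induction with
  | one =>
    intro c a
    simp only [bconv_one, LinearMap.comp_apply, LinearMap.mul_apply', hq.one]
    rw [bconv_cons, bconv_one, lsh_apply]
  | cons x t ih =>
    exact IsCoalg.bconv_conv_step hq.one μ g x t
      (fun c => LinearMap.congr_fun (hq.bconv μ c g) _) ih
  | add s t hs ht => intro c a; simp only [map_add, hs, ht]; abel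
  | smul r t ht => intro c a; simp only [map_smul, ht, smul_add]

theorem IsCoalg.bconv_pconv {q : 𝕋 V →ₗ[k] 𝕋 V'} (hq : IsCoalg q) (μ : N₁ →ₗ[k] N₂ →ₗ[k] N₃)
    (c : 𝕋 V' →ₗ[k] N₁) (g : 𝕋 V' →ₗ[k] N₂) (a : 𝕋 V →ₗ[k] V') :
    Stmt14.bconv μ c g ∘ₗ Stmt14.pconv (τ ∘ₗ a) q =
      μ (c 1) ∘ₗ g ∘ₗ Stmt14.pconv (τ ∘ₗ a) q +
        Stmt14.bconv μ (c ∘ₗ Stmt14.pconv (τ ∘ₗ a) q) (g ∘ₗ q) := by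
  ext t
  exact hq.bconv_conv μ c g (a ∘ₗ Stmt14.pplus k V) t

/-- The coderivation with linear part `a`, twisted by `q` on the right and by the algebra morphism
generated by `σ` on the left. -/
noncomputable def coder (a : 𝕋 V →ₗ[k] V') (q : 𝕋 V →ₗ[k] 𝕋 V') (σ : V →ₗ[k] V') :
    𝕋 V →ₗ[k] 𝕋 V' := conv (tmap σ) (pconv (τ ∘ₗ a) q)

theorem coder_one (a : 𝕋 V →ₗ[k] V') (q : 𝕋 V →ₗ[k] 𝕋 V') (σ : V →ₗ[k] V') :
    coder a q σ 1 = 0 := by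
  simp [coder, bconv_one, pconv_one]

theorem lsh_tmap (σ : V →ₗ[k] V') (x : V) :
    lsh (tmap σ) x = LinearMap.mulLeft k (τ (σ x)) ∘ₗ tmap σ := by
  ext t; simp [lsh_apply, tmap_cons]

theorem mul_conv {R : Type} [Ring R] [Algebra k R] (r : R) (c g : 𝕋 V →ₗ[k] R) (t : 𝕋 V) :
    conv (LinearMap.mulLeft k r ∘ₗ c) g t = r * conv c g t :=
  (LinearMap.congr_fun (bconv_map (μ := LinearMap.mul k R) (μ' := LinearMap.mul k R)
    (θ := LinearMap.mulLeft k r) (θ₁ := LinearMap.mulLeft k r) (θ₂ := LinearMap.id)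
    (by simp [mul_assoc]) c g) t).symm

theorem coder_cons (a : 𝕋 V →ₗ[k] V') (q : 𝕋 V →ₗ[k] 𝕋 V') (σ : V →ₗ[k] V') (x : V) (t : 𝕋 V) :
    coder a q σ (τ x * t) = pconv (τ ∘ₗ a) q (τ x * t) + τ (σ x) * coder a q σ t := by
  simp [coder, bconv_cons, tmap_one, lsh_tmap, mul_conv]

theorem bconv_coder {q : 𝕋 V →ₗ[k] 𝕋 V'} (hq : IsCoalg q) (a : 𝕋 V →ₗ[k] V') (σ : V →ₗ[k] V')
    (μ : N₁ →ₗ[k] N₂ →ₗ[k] N₃) (c : 𝕋 V' →ₗ[k] N₁) (g : 𝕋 V' →ₗ[k] N₂) :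
    bconv μ c g ∘ₗ coder a q σ =
      bconv μ (c ∘ₗ coder a q σ) (g ∘ₗ q) + bconv μ (c ∘ₗ tmap σ) (g ∘ₗ coder a q σ) := by
  revert c
  apply tensor_ext_family
  · intro c
    simp [coder_one, bconv_one]
  · intro x t ih c
    have e1 : lsh (c ∘ₗ coder a q σ) x =
        lsh (c ∘ₗ pconv (τ ∘ₗ a) q) x + lsh c (σ x) ∘ₗ coder a q σ := by
      ext s; simp [lsh_apply, coder_cons]
    have e2 : lsh (c ∘ₗ tmap σ) x = lsh c (σ x) ∘ₗ tmap σ := by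
      ext s; simp [lsh_apply, tmap_cons]
    have e3 := ih (lsh c (σ x))
    have e4 := LinearMap.congr_fun (hq.bconv_pconv μ c g a) (τ x * t)
    simp only [LinearMap.comp_apply, LinearMap.add_apply] at e3 e4 ⊢
    rw [coder_cons, map_add, e4, bconv_cons μ c, e3]
    simp only [bconv_cons, e1, e2]
    simp only [LinearMap.comp_apply, LinearMap.add_apply, map_add, tmap_one, coder_one,
      pconv_one, map_zero, LinearMap.zero_apply, zero_add, coder_cons]
    abel

theorem pconv_coder {R : Type} [Ring R] [Algebra k R] {q : 𝕋 V →ₗ[k] 𝕋 V'} (hq : IsCoalg q)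
    (a : 𝕋 V →ₗ[k] V') (σ : V →ₗ[k] V') (c g : 𝕋 V' →ₗ[k] R) :
    pconv c g ∘ₗ coder a q σ =
      conv (c ∘ₗ pplus k V' ∘ₗ coder a q σ) (g ∘ₗ q) +
        pconv (c ∘ₗ tmap σ) (g ∘ₗ coder a q σ) := by
  rw [pconv, bconv_coder hq, LinearMap.comp_assoc, LinearMap.comp_assoc, (isCoalg_tmap σ).pplus]
  rfl

/-- A fixed point of a convolution with a factor of positive length vanishes. -/
theorem eq_zero_of_eq_pconv {R : Type} [Ring R] [Algebra k R] {φ E : 𝕋 V →ₗ[k] R}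
    (h : E = pconv φ E) : E = 0 := by
  have key : ∀ t, E t = 0 ∧ ∀ c : 𝕋 V →ₗ[k] R, conv c E t = 0 := by
    intro t
    induction t using tensor_induction with
    | one =>
      have : E 1 = 0 := by rw [h, pconv_one]
      exact ⟨this, fun c => by simp [bconv_one, this]⟩
    | cons x t ih =>
      have : E (τ x * t) = 0 := by rw [h, pconv_cons, ih.2]
      exact ⟨this, fun c => by rw [bconv_cons, this, ih.2, map_zero, zero_add]⟩
    | add s t hs ht =>
      exact ⟨by rw [map_add, hs.1, ht.1, zero_add],
        fun c => by rw [map_add, hs.2, ht.2, zero_add]⟩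
    | smul a t ht => exact ⟨by rw [map_smul, ht.1, smul_zero],
        fun c => by rw [map_smul, ht.2, smul_zero]⟩
  ext t; exact (key t).1

/-- Auxiliary recursion: `cogAux f t c` is the convolution of `c` and `cog f` at `t`. -/
noncomputable def cogAux (f : 𝕋 V →ₗ[k] V') :
    𝕋 V →ₗ[k] (𝕋 V →ₗ[k] 𝕋 V') →ₗ[k] 𝕋 V' :=
  tensorRec 0 (LinearMap.mk₂ k
    (fun x n => LinearMap.mulRight k (n (lsh (τ ∘ₗ f) x)) ∘ₗ LinearMap.applyₗ (1 : 𝕋 V) +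
      n ∘ₗ (lsh.flip x))
    (by intros; ext; simp [mul_add]; abel)
    (by intros; ext; simp)
    (by intros; ext; simp [mul_add]; abel)
    (by intros; ext; simp)) (LinearMap.applyₗ 1)

theorem cogAux_one (f : 𝕋 V →ₗ[k] V') (c : 𝕋 V →ₗ[k] 𝕋 V') : cogAux f 1 c = c 1 := by
  rw [cogAux, tensorRec_one]; rfl

theorem cogAux_cons (f : 𝕋 V →ₗ[k] V') (x : V) (t : 𝕋 V) (c : 𝕋 V →ₗ[k] 𝕋 V') :
    cogAux f (τ x * t) c = c 1 * cogAux f t (lsh (τ ∘ₗ f) x) + cogAux f t (lsh c x) := by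
  rw [cogAux, tensorRec_cons]; simp

/-- The morphism of coalgebras generated by `f`. -/
noncomputable def cog (f : 𝕋 V →ₗ[k] V') : 𝕋 V →ₗ[k] 𝕋 V' :=
  (cogAux f).flip (uaug k V (𝕋 V'))

theorem cog_one (f : 𝕋 V →ₗ[k] V') : cog f 1 = 1 := by
  simp [cog, cogAux_one, uaug_one]

theorem cogAux_eq (f : 𝕋 V →ₗ[k] V') (t : 𝕋 V) : ∀ c, cogAux f t c = conv c (cog f) t := by
  induction t using tensor_induction with
  | one => intro c; simp [cogAux_one, bconv_one, cog_one]
  | cons x t ih =>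
    intro c
    have : cog f (τ x * t) = cogAux f t (lsh (τ ∘ₗ f) x) := by
      simp [cog, cogAux_cons, uaug_one, lsh_uaug]
    rw [cogAux_cons, bconv_cons, ih (lsh c x), this, LinearMap.mul_apply']
  | add s t hs ht => intro c; rw [map_add, LinearMap.add_apply, hs, ht, map_add]
  | smul a t ht => intro c; rw [map_smul, LinearMap.smul_apply, ht, map_smul]

theorem cog_cons' (f : 𝕋 V →ₗ[k] V') (x : V) (t : 𝕋 V) :
    cog f (τ x * t) = conv (τ ∘ₗ lsh f x) (cog f) t := by
  rw [← lsh_comp, ← cogAux_eq]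
  simp [cog, cogAux_cons, uaug_one, lsh_uaug]

theorem cog_cons (f : 𝕋 V →ₗ[k] V') (x : V) (t : 𝕋 V) :
    cog f (τ x * t) = pconv (τ ∘ₗ f) (cog f) (τ x * t) := by
  rw [cog_cons', pconv_cons]; rfl

theorem cog_eq (f : 𝕋 V →ₗ[k] V') : cog f = uaug k V (𝕋 V') + pconv (τ ∘ₗ f) (cog f) := by
  apply tensor_ext
  · simp [cog_one, uaug_one, pconv_one]
  · intro x t _
    simp [cog_cons f x t, uaug_cons]

theorem cog_unique {f : 𝕋 V →ₗ[k] V'} {X : 𝕋 V →ₗ[k] 𝕋 V'}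
    (h : X = uaug k V (𝕋 V') + pconv (τ ∘ₗ f) X) : X = cog f := by
  rw [← sub_eq_zero]
  apply eq_zero_of_eq_pconv (φ := τ ∘ₗ f)
  conv_lhs => rw [h, cog_eq f]
  simp [pconv]

theorem isCoalg_cog (f : 𝕋 V →ₗ[k] V') : IsCoalg (cog f) := by
  have aug_conv : ∀ (a : 𝕋 V →ₗ[k] V') (t), aug V' (conv (τ ∘ₗ a) (cog f) t) = 0 := by
    intro a t
    have := LinearMap.congr_fun (conv_map (aug V') (τ ∘ₗ a) (cog f)) t
    simp only [LinearMap.comp_apply, AlgHom.toLinearMap_apply] at this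
    rw [this]
    have e : (aug V').toLinearMap ∘ₗ τ ∘ₗ a = 0 := by
      ext t
      exact aug_letter (a t)
    rw [e]; simp [conv]
  refine IsCoalg.of_bconv (cog_one f) ?_ ?_
  · intro t
    induction t using tensor_induction with
    | one => simp [cog_one]
    | cons x t ih => rw [cog_cons', aug_conv, aug_cons]
    | add s t hs ht => simp [hs, ht]
    | smul a t ht => simp [ht]
  · intro c t
    have key : (∀ c : 𝕋 V' →ₗ[k] 𝕋 V', bconv (TensorProduct.mk k (𝕋 V') (𝕋 V')) c LinearMap.id (cog f t) =
        bconv (TensorProduct.mk k (𝕋 V') (𝕋 V')) (c ∘ₗ cog f) (LinearMap.id ∘ₗ cog f) t) ∧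
        ∀ (c : 𝕋 V' →ₗ[k] 𝕋 V') (a : 𝕋 V →ₗ[k] V'),
        bconv (TensorProduct.mk k (𝕋 V') (𝕋 V')) c LinearMap.id (conv (τ ∘ₗ a) (cog f) t) =
          TensorProduct.mk k (𝕋 V') (𝕋 V') (c 1) ((LinearMap.id : 𝕋 V' →ₗ[k] 𝕋 V') (conv (τ ∘ₗ a) (cog f) t)) +
          bconv (TensorProduct.mk k (𝕋 V') (𝕋 V')) (c ∘ₗ conv (τ ∘ₗ a) (cog f))
            (LinearMap.id ∘ₗ cog f) t := by
      clear c
      induction t using tensor_induction with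
      | one =>
        refine ⟨fun c => by simp [bconv_one, cog_one], fun c a => ?_⟩
        simp only [bconv_one, LinearMap.comp_apply, LinearMap.mul_apply', cog_one]
        rw [bconv_cons, bconv_one, lsh_apply]
      | cons x t ih =>
        have h1 : ∀ c : 𝕋 V' →ₗ[k] 𝕋 V',
            bconv (TensorProduct.mk k (𝕋 V') (𝕋 V')) c LinearMap.id (cog f (τ x * t)) =
            bconv (TensorProduct.mk k (𝕋 V') (𝕋 V')) (c ∘ₗ cog f) (LinearMap.id ∘ₗ cog f) (τ x * t) := by
          intro c
          have e : lsh (c ∘ₗ cog f) x = c ∘ₗ conv (τ ∘ₗ lsh f x) (cog f) := by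
            ext s; simp [lsh_apply, cog_cons']
          rw [cog_cons', ih.2, bconv_cons, e, LinearMap.comp_apply, LinearMap.comp_apply, cog_one,
            cog_cons']
        exact ⟨h1, IsCoalg.bconv_conv_step (cog_one f) _ _ x t h1 ih.2⟩
      | add s t hs ht =>
        exact ⟨fun c => by simp only [map_add, hs.1, ht.1],
          fun c a => by simp only [map_add, hs.2, ht.2]; abel⟩
      | smul r t ht =>
        exact ⟨fun c => by simp only [map_smul, ht.1],
          fun c a => by simp only [map_smul, ht.2, smul_add]⟩
    exact key.1 c

theorem IsCoalg.uaug {R : Type} [Ring R] [Algebra k R] {q : 𝕋 V →ₗ[k] 𝕋 V'} (hq : IsCoalg q) :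
    uaug k V' R ∘ₗ q = uaug k V R := by
  ext t; simp [uaug_apply, hq.aug]

theorem cog_comp (f : 𝕋 V' →ₗ[k] V'') (y : 𝕋 V →ₗ[k] V') :
    cog f ∘ₗ cog y = cog (f ∘ₗ cog y) := by
  apply cog_unique
  conv_lhs => rw [cog_eq f]
  rw [LinearMap.add_comp, (isCoalg_cog y).uaug, (isCoalg_cog y).pconv]
  rfl

variable (k V) in
/-- The projection of the tensor algebra to the letters. -/
noncomputable def letter : 𝕋 V →ₗ[k] V :=
  tensorRec ((LinearMap.lsmul k V).flip.compr₂ LinearMap.id |>.compl₂ (aug V).toLinearMap) 0 0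

theorem letter_one : letter k V 1 = 0 := tensorRec_one _ _ _

theorem letter_cons (x : V) (t : 𝕋 V) : letter k V (τ x * t) = aug V t • x := by
  simp [letter, tensorRec_cons]

theorem letter_letter (x : V) : letter k V (τ x) = x := by
  rw [← mul_one (τ x), letter_cons]; simp

theorem letter_conv {q : 𝕋 V →ₗ[k] 𝕋 V'} (hq : IsCoalg q) (a : 𝕋 V →ₗ[k] V') :
    letter k V' ∘ₗ conv (τ ∘ₗ a) q = a := by
  revert a
  apply tensor_ext_family
  · intro a
    simp [bconv_one, hq.one, letter_letter]
  · intro x t ih a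
    have := ih (lsh a x)
    simp only [LinearMap.comp_apply] at this
    simp [bconv_cons, letter_cons, hq.aug, aug_cons, lsh_comp, this, lsh_apply]

theorem letter_pconv {q : 𝕋 V →ₗ[k] 𝕋 V'} (hq : IsCoalg q) (a : 𝕋 V →ₗ[k] V') :
    letter k V' ∘ₗ pconv (τ ∘ₗ a) q = a ∘ₗ pplus k V := by
  rw [pconv, LinearMap.comp_assoc, letter_conv hq]

end Coalgebra

section Comodule

variable {V V' N N₁ N₂ N₃ N₁' N₂' N₃' : Type} [AddCommGroup V] [Module k V] [AddCommGroup V']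
  [Module k V'] [AddCommGroup N] [Module k N] [AddCommGroup N₁] [Module k N₁] [AddCommGroup N₂]
  [Module k N₂] [AddCommGroup N₃] [Module k N₃] [AddCommGroup N₁'] [Module k N₁']
  [AddCommGroup N₂'] [Module k N₂'] [AddCommGroup N₃'] [Module k N₃']

theorem comp_bconv_congr {μ : N₁ →ₗ[k] N₂ →ₗ[k] N₃} {μ' : N₁' →ₗ[k] N₂' →ₗ[k] N₃'}
    {θ : N₃ →ₗ[k] N} {θ' : N₃' →ₗ[k] N} {c : 𝕋 V →ₗ[k] N₁} {g : 𝕋 V →ₗ[k] N₂}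
    {c' : 𝕋 V →ₗ[k] N₁'} {g' : 𝕋 V →ₗ[k] N₂'}
    (h : ∀ s t, θ (μ (c s) (g t)) = θ' (μ' (c' s) (g' t))) :
    θ ∘ₗ bconv μ c g = θ' ∘ₗ bconv μ' c' g' := by
  simp only [bconv, LinearMap.mk₂_apply, ← LinearMap.comp_assoc]
  congr 1
  apply TensorProduct.ext'
  intro s t
  simp [h]

/-- The endomorphism of right comodules with linear part `φ`. -/
noncomputable def com (φ : 𝕋 V →ₗ[k] V) : 𝕋 V →ₗ[k] 𝕋 V := pconv (τ ∘ₗ φ) LinearMap.id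

theorem com_one (φ : 𝕋 V →ₗ[k] V) : com φ 1 = 0 := pconv_one _ _

theorem com_add (φ ψ : 𝕋 V →ₗ[k] V) : com (φ + ψ) = com φ + com ψ := by
  simp [com, pconv, conv, LinearMap.comp_add, LinearMap.add_comp]

theorem com_smul (a : k) (φ : 𝕋 V →ₗ[k] V) : com (a • φ) = a • com φ := by
  simp [com, pconv, conv, LinearMap.comp_smul, LinearMap.smul_comp]

theorem com_neg (φ : 𝕋 V →ₗ[k] V) : com (-φ) = -com φ := by
  simp [com, pconv, conv, LinearMap.comp_neg, LinearMap.neg_comp]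

theorem com_sub (φ ψ : 𝕋 V →ₗ[k] V) : com (φ - ψ) = com φ - com ψ := by
  rw [sub_eq_add_neg, com_add, com_neg, sub_eq_add_neg]

theorem com_zero : com (0 : 𝕋 V →ₗ[k] V) = 0 := by
  simp [com, pconv, conv]

theorem aug_conv (a : 𝕋 V →ₗ[k] V') (q : 𝕋 V →ₗ[k] 𝕋 V') (t : 𝕋 V) :
    aug V' (conv (τ ∘ₗ a) q t) = 0 := by
  have := LinearMap.congr_fun (conv_map (aug V') (τ ∘ₗ a) q) t
  simp only [LinearMap.comp_apply, AlgHom.toLinearMap_apply] at this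
  rw [this]
  have e : (aug V').toLinearMap ∘ₗ τ ∘ₗ a = 0 := by
    ext t
    exact aug_letter (a t)
  rw [e]; simp [conv]

theorem pplus_of_aug {t : 𝕋 V} (h : aug V t = 0) : pplus k V t = t := by
  simp [pplus, uaug_apply, h]

theorem pplus_pconv (a : 𝕋 V →ₗ[k] V') (q : 𝕋 V →ₗ[k] 𝕋 V') :
    pplus k V' ∘ₗ pconv (τ ∘ₗ a) q = pconv (τ ∘ₗ a) q := by
  ext t
  exact pplus_of_aug (aug_conv (a ∘ₗ pplus k V) q t)

theorem pplus_com (φ : 𝕋 V →ₗ[k] V) : pplus k V ∘ₗ com φ = com φ := pplus_pconv _ _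

theorem aug_pconv (a : 𝕋 V →ₗ[k] V') (q : 𝕋 V →ₗ[k] 𝕋 V') (t : 𝕋 V) :
    aug V' (pconv (τ ∘ₗ a) q t) = 0 := aug_conv (a ∘ₗ pplus k V) q t

theorem aug_com (φ : 𝕋 V →ₗ[k] V) (t : 𝕋 V) : aug V (com φ t) = 0 := aug_pconv _ _ t

theorem comp_pplus {c : 𝕋 V →ₗ[k] N} (h : c 1 = 0) : c ∘ₗ pplus k V = c := by
  ext t
  simp [pplus, uaug_apply, Algebra.algebraMap_eq_smul_one, h]

theorem com_pplus (φ : 𝕋 V →ₗ[k] V) : com φ ∘ₗ pplus k V = com φ := comp_pplus (com_one φ)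

theorem pplus_pplus : pplus k V ∘ₗ pplus k V = pplus k V := comp_pplus pplus_one

theorem com_comp_pplus (φ : 𝕋 V →ₗ[k] V) : com (φ ∘ₗ pplus k V) = com φ := by
  simp only [com, pconv, LinearMap.comp_assoc, pplus_pplus]

theorem letter_com (φ : 𝕋 V →ₗ[k] V) : letter k V ∘ₗ com φ = φ ∘ₗ pplus k V :=
  letter_pconv isCoalg_id φ

theorem com_letter : com (letter k V) = pplus k V := by
  have key : ∀ (x : V), lsh (letter k V) x = LinearMap.smulRight (aug V).toLinearMap x := by
    intro x; ext t; simp [lsh_apply, letter_cons]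
  apply tensor_ext
  · rw [com_one, pplus_one]
  · intro x t _
    rw [com, pconv_cons, pplus_cons, lsh_comp, key]
    have : τ ∘ₗ LinearMap.smulRight (aug V).toLinearMap x =
        LinearMap.mulLeft k (τ x) ∘ₗ uaug k V (𝕋 V) := by
      ext t
      simp [uaug_apply, Algebra.algebraMap_eq_smul_one]
    rw [this, mul_conv, uaug_conv]; rfl

theorem conv_id_mul {c : 𝕋 V →ₗ[k] 𝕋 V} (w u : 𝕋 V) :
    conv c LinearMap.id (w * u) =
      conv c LinearMap.id w * u + pconv (c ∘ₗ LinearMap.mulLeft k w) LinearMap.id u := by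
  revert c
  induction w using tensor_induction with
  | one =>
    intro c
    have : c ∘ₗ LinearMap.mulLeft k 1 = c := by ext; simp
    rw [one_mul, conv_eq, this, bconv_one]; simp
  | cons x w ih =>
    intro c
    have : lsh c x ∘ₗ LinearMap.mulLeft k w = c ∘ₗ LinearMap.mulLeft k (τ x * w) := by
      ext; simp [lsh_apply]
    rw [mul_assoc, bconv_cons, ih, bconv_cons, this]
    simp [add_mul, mul_assoc, add_assoc]
  | add s t hs ht =>
    intro c
    have : c ∘ₗ LinearMap.mulLeft k (s + t) =
      c ∘ₗ LinearMap.mulLeft k s + c ∘ₗ LinearMap.mulLeft k t := by ext; simp [add_mul]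
    have h2 : ∀ a b : 𝕋 V →ₗ[k] 𝕋 V, pconv (a + b) LinearMap.id =
        pconv a LinearMap.id + pconv b LinearMap.id := by
      intro a b; simp [pconv, conv, LinearMap.add_comp]
    rw [add_mul, map_add, hs, ht, this, h2, map_add, LinearMap.add_apply, add_mul]; abel
  | smul a t ht =>
    intro c
    have : c ∘ₗ LinearMap.mulLeft k (a • t) = a • (c ∘ₗ LinearMap.mulLeft k t) := by ext; simp
    have h2 : ∀ b : 𝕋 V →ₗ[k] 𝕋 V, pconv (a • b) LinearMap.id = a • pconv b LinearMap.id := by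
      intro b; simp [pconv, conv, LinearMap.smul_comp]
    rw [smul_mul_assoc, map_smul, ht, this, h2, map_smul, LinearMap.smul_apply, smul_add,
      smul_mul_assoc]

theorem com_cons_mul (φ : 𝕋 V →ₗ[k] V) (x : V) (w u : 𝕋 V) :
    com φ (τ x * w * u) = com φ (τ x * w) * u +
      com (φ ∘ₗ LinearMap.mulLeft k (τ x * w)) u := by
  have : (lsh (τ ∘ₗ φ) x) ∘ₗ LinearMap.mulLeft k w =
      τ ∘ₗ φ ∘ₗ LinearMap.mulLeft k (τ x * w) := by
    ext; simp [lsh_apply]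
  rw [mul_assoc, com, pconv_cons, pconv_cons, conv_id_mul, this]; rfl

theorem com_cons (φ : 𝕋 V →ₗ[k] V) (x : V) (t : 𝕋 V) :
    com φ (τ x * t) = τ (φ (τ x)) * t + com (lsh φ x) t := by
  have := com_cons_mul φ x 1 t
  have h : com φ (τ x) = τ (φ (τ x)) := by
    rw [← mul_one (τ x), com, pconv_cons, bconv_one]
    simp [lsh_apply]
  rw [mul_one, h] at this
  exact this

theorem bconv_com (μ : N₁ →ₗ[k] N₂ →ₗ[k] N₃) (c : 𝕋 V →ₗ[k] N₁) (g : 𝕋 V →ₗ[k] N₂)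
    (φ : 𝕋 V →ₗ[k] V) :
    bconv μ c g ∘ₗ com φ = μ (c 1) ∘ₗ g ∘ₗ com φ + bconv μ (c ∘ₗ com φ) g :=
  isCoalg_id.bconv_pconv μ c g φ

theorem com_comp_com (φ ψ : 𝕋 V →ₗ[k] V) : com φ ∘ₗ com ψ = com (φ ∘ₗ com ψ) := by
  conv_lhs => rw [com, pconv, conv, bconv_com]
  simp only [LinearMap.comp_apply, pplus_one, map_zero, LinearMap.zero_comp, zero_add, com, pconv]
  congr 2
  simp only [LinearMap.comp_assoc]
  congr 2
  exact (pplus_com ψ).trans (com_pplus ψ).symm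

theorem tmap_com_tmap (σ : V →ₗ[k] V) (hσ : σ ∘ₗ σ = LinearMap.id) (φ : 𝕋 V →ₗ[k] V) :
    tmap σ ∘ₗ com φ ∘ₗ tmap σ = com (σ ∘ₗ φ ∘ₗ tmap σ) := by
  rw [com, (isCoalg_tmap σ).pconv, tmap_pconv, com]
  simp only [LinearMap.id_comp, tmap_comp, hσ, tmap_id]
  congr 1
  ext t
  simp [tmap_letter]

/-- The inverse of `1 - com ν` differs from the augmentation by a comodule map. -/
theorem exists_com_of_inverse {ν : 𝕋 V →ₗ[k] V} {R : 𝕋 V →ₗ[k] 𝕋 V}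
    (h1 : (LinearMap.id - com ν) ∘ₗ R = LinearMap.id)
    (h2 : R ∘ₗ (LinearMap.id - com ν) = LinearMap.id) :
    R = uaug k V (𝕋 V) + com (letter k V ∘ₗ R) := by
  have hR1 : R 1 = 1 := by
    have := LinearMap.congr_fun h2 1
    simpa [com_one] using this
  have haug : ∀ t, aug V (R t) = aug V t := by
    intro t
    have := congrArg (aug V) (LinearMap.congr_fun h1 t)
    simpa [aug_com] using this
  set q : 𝕋 V →ₗ[k] TensorProduct k (𝕋 V) (𝕋 V) :=
    comul - TensorProduct.mk k (𝕋 V) (𝕋 V) 1 with hq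
  have e0 : ∀ t, bconv (TensorProduct.mk k (𝕋 V) (𝕋 V)) LinearMap.id LinearMap.id t = comul t := by
    intro t
    have e1 : TensorProduct.lift ((TensorProduct.mk k (𝕋 V) (𝕋 V)).compl₁₂ LinearMap.id
        LinearMap.id) = LinearMap.id := by
      ext; simp
    simp only [Stmt14.bconv, LinearMap.mk₂_apply, LinearMap.comp_apply]
    rw [e1]; rfl
  have e2 : ∀ (X : 𝕋 V →ₗ[k] 𝕋 V) (t), bconv (TensorProduct.mk k (𝕋 V) (𝕋 V)) X LinearMap.id t =
      X.rTensor (𝕋 V) (comul t) := by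
    intro X t
    simp only [Stmt14.bconv, LinearMap.mk₂_apply, LinearMap.comp_apply]
    congr 1
  have hN : q ∘ₗ (LinearMap.id - com ν) = (LinearMap.id - com ν).rTensor (𝕋 V) ∘ₗ q := by
    have h3 : ∀ t, comul (com ν t) = TensorProduct.tmul k 1 (com ν t) +
        (com ν).rTensor (𝕋 V) (comul t) := by
      intro t
      have := LinearMap.congr_fun (bconv_com (TensorProduct.mk k (𝕋 V) (𝕋 V)) LinearMap.id
        LinearMap.id ν) t
      simp only [LinearMap.comp_apply, LinearMap.add_apply, LinearMap.id_apply, e0,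
        LinearMap.id_comp, e2] at this
      rw [this]; rfl
    ext t
    simp [hq, LinearMap.rTensor_sub, h3, com_one, TensorProduct.tmul_sub]
    abel
  have hqR : q ∘ₗ R = R.rTensor (𝕋 V) ∘ₗ q := by
    calc q ∘ₗ R = (R ∘ₗ (LinearMap.id - com ν)).rTensor (𝕋 V) ∘ₗ q ∘ₗ R := by
          rw [h2, LinearMap.rTensor_id]; rfl
      _ = R.rTensor (𝕋 V) ∘ₗ ((LinearMap.id - com ν).rTensor (𝕋 V) ∘ₗ q) ∘ₗ R := by
          rw [LinearMap.rTensor_comp]; rfl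
      _ = R.rTensor (𝕋 V) ∘ₗ q ∘ₗ ((LinearMap.id - com ν) ∘ₗ R) := by
          rw [← hN]; rfl
      _ = _ := by rw [h1]; rfl
  ext t
  have h4 := congrArg (TensorProduct.lift ((LinearMap.mul k (𝕋 V)).compl₁₂
    (τ ∘ₗ letter k V) LinearMap.id)) (LinearMap.congr_fun hqR t)
  have h5 : ∀ (X : 𝕋 V →ₗ[k] 𝕋 V) (s), X 1 = 1 → TensorProduct.lift ((LinearMap.mul k (𝕋 V)).compl₁₂
      (τ ∘ₗ letter k V) LinearMap.id) (X.rTensor (𝕋 V) (q s)) = com (letter k V ∘ₗ X) s := by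
    intro X s hX
    have h6 : com (letter k V ∘ₗ X) = conv (τ ∘ₗ letter k V ∘ₗ X) LinearMap.id := by
      rw [com, pconv, comp_pplus]
      simp [hX, letter_one]
    rw [h6, conv, bconv, LinearMap.mk₂_apply, LinearMap.comp_apply, hq, LinearMap.sub_apply, map_sub,
      map_sub]
    have h7 : TensorProduct.lift ((LinearMap.mul k (𝕋 V)).compl₁₂ (τ ∘ₗ letter k V) LinearMap.id) ∘ₗ
      X.rTensor (𝕋 V) = TensorProduct.lift ((LinearMap.mul k (𝕋 V)).compl₁₂ (τ ∘ₗ letter k V ∘ₗ X)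
        LinearMap.id) := by ext; simp
    rw [← h7]
    simp [hX, letter_one]
  have h6 := h5 LinearMap.id (R t) rfl
  rw [LinearMap.rTensor_id, LinearMap.comp_id, com_letter] at h6
  simp only [LinearMap.comp_apply, LinearMap.id_apply] at h4 h6
  rw [h5 R t hR1, h6] at h4
  rw [LinearMap.add_apply, ← h4]
  simp [pplus, uaug_apply, haug]

end Comodule

theorem aug_coder {V : Type} [AddCommGroup V] [Module k V] (a : 𝕋 V →ₗ[k] V) (q : 𝕋 V →ₗ[k] 𝕋 V)
    (σ : V →ₗ[k] V) (t : 𝕋 V) : aug V (coder a q σ t) = 0 := by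
  have : (aug V).toLinearMap ∘ₗ coder a q σ = 0 := by
    apply tensor_ext
    · simp [coder_one]
    · intro x t _
      simp [coder_cons, aug_pconv, aug_letter]
  exact LinearMap.congr_fun this t

theorem letter_coder {V : Type} [AddCommGroup V] [Module k V] (a : 𝕋 V →ₗ[k] V)
    {q : 𝕋 V →ₗ[k] 𝕋 V} (hq : IsCoalg q) (σ : V →ₗ[k] V) :
    letter k V ∘ₗ coder a q σ = a ∘ₗ pplus k V := by
  apply tensor_ext
  · simp [coder_one, pplus_one]
  · intro x t _
    have := LinearMap.congr_fun (letter_pconv hq a) (τ x * t)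
    simp only [LinearMap.comp_apply] at this
    simp [coder_cons, letter_cons, aug_coder, this]

variable (k) in
/-- An A∞-structure in coalgebraic form: `b` collects all operations and `sg` is the sign
operator of the grading. -/
structure CoA (V : Type) [AddCommGroup V] [Module k V] where
  sg : V →ₗ[k] V
  b : 𝕋 V →ₗ[k] V
  sg_sg : ∀ x, sg (sg x) = x
  b_one : b 1 = 0
  b_sg : ∀ t, b (tmap sg t) = -sg (b t)
  b_coder : ∀ t, b (coder b LinearMap.id sg t) = 0

namespace CoA

variable {V : Type} [AddCommGroup V] [Module k V] (A : CoA k V)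

/-- The sign operator on tensors. -/
noncomputable def S : 𝕋 V →ₗ[k] 𝕋 V := tmap A.sg

/-- The codifferential of the bar construction. -/
noncomputable def D : 𝕋 V →ₗ[k] 𝕋 V := coder A.b LinearMap.id A.sg

theorem S_one : A.S 1 = 1 := tmap_one _

theorem S_mul (s t : 𝕋 V) : A.S (s * t) = A.S s * A.S t := tmap_mul _ _ _

theorem S_letter (x : V) : A.S (τ x) = τ (A.sg x) := tmap_letter _ _

theorem sg_comp_sg : A.sg ∘ₗ A.sg = LinearMap.id := by ext x; exact A.sg_sg x

theorem S_comp_S : A.S ∘ₗ A.S = LinearMap.id := by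
  rw [S, tmap_comp, sg_comp_sg, tmap_id]

theorem S_S (t : 𝕋 V) : A.S (A.S t) = t := LinearMap.congr_fun A.S_comp_S t

theorem b_S (t : 𝕋 V) : A.b (A.S t) = -A.sg (A.b t) := A.b_sg t

theorem b_comp_S : A.b ∘ₗ A.S = -(A.sg ∘ₗ A.b) := by ext t; exact A.b_S t

theorem b_D (t : 𝕋 V) : A.b (A.D t) = 0 := A.b_coder t

theorem D_one : A.D 1 = 0 := coder_one _ _ _

theorem D_cons (x : V) (t : 𝕋 V) :
    A.D (τ x * t) = com A.b (τ x * t) + τ (A.sg x) * A.D t := coder_cons _ _ _ _ _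

theorem D_eq : A.D = conv A.S (com A.b) := rfl

theorem aug_S (t : 𝕋 V) : aug V (A.S t) = aug V t := (isCoalg_tmap _).aug t

theorem aug_D (t : 𝕋 V) : aug V (A.D t) = 0 := aug_coder _ _ _ t

theorem pplus_D (t : 𝕋 V) : pplus k V (A.D t) = A.D t := pplus_of_aug (A.aug_D t)

theorem pplus_S (t : 𝕋 V) : pplus k V (A.S t) = A.S (pplus k V t) :=
  LinearMap.congr_fun (isCoalg_tmap A.sg).pplus t

theorem D_pplus (t : 𝕋 V) : A.D (pplus k V t) = A.D t :=
  LinearMap.congr_fun (comp_pplus A.D_one) t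

theorem letter_D (t : 𝕋 V) : letter k V (A.D t) = A.b t := by
  have := LinearMap.congr_fun (letter_coder A.b isCoalg_id A.sg) t
  rwa [comp_pplus A.b_one] at this

theorem S_comp_letter : A.S ∘ₗ τ = τ ∘ₗ A.sg := by ext x; exact A.S_letter x

theorem S_comp_D : A.S ∘ₗ A.D = -(A.D ∘ₗ A.S) := by
  have h1 : A.S ∘ₗ com A.b = pconv (τ ∘ₗ A.sg ∘ₗ A.b) A.S := by
    rw [com, S, tmap_pconv, ← S, ← LinearMap.comp_assoc, S_comp_letter]; rfl
  have h2 : com A.b ∘ₗ A.S = -pconv (τ ∘ₗ A.sg ∘ₗ A.b) A.S := by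
    rw [com, S, (isCoalg_tmap _).pconv, ← S, LinearMap.comp_assoc, b_comp_S]
    simp [pconv, conv, LinearMap.comp_neg, LinearMap.neg_comp]
  have h3 : A.S ∘ₗ conv A.S (com A.b) = conv (A.S ∘ₗ A.S) (A.S ∘ₗ com A.b) := tmap_conv _ _ _
  have h4 : conv A.S (com A.b) ∘ₗ A.S = conv (A.S ∘ₗ A.S) (com A.b ∘ₗ A.S) :=
    (isCoalg_tmap _).bconv _ _ _
  rw [D_eq, h3, h4, h1, h2, conv, conv, map_neg, neg_neg]

theorem S_D (t : 𝕋 V) : A.S (A.D t) = -A.D (A.S t) := LinearMap.congr_fun A.S_comp_D t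

theorem S_comp_com (φ : 𝕋 V →ₗ[k] V) :
    A.S ∘ₗ com φ = conv (τ ∘ₗ A.sg ∘ₗ φ ∘ₗ pplus k V) A.S := by
  have : A.S ∘ₗ com φ = pconv ((A.S ∘ₗ τ) ∘ₗ φ) A.S := tmap_pconv _ _ _
  rw [this, S_comp_letter]; rfl

theorem D_D (t : 𝕋 V) : A.D (A.D t) = 0 := by
  have h1 : A.D ∘ₗ A.D = conv (A.S ∘ₗ A.D) (com A.b) + conv (A.S ∘ₗ A.S) (com A.b ∘ₗ A.D) :=
    bconv_coder isCoalg_id _ _ _ _ _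
  have h2 : com A.b ∘ₗ A.D = conv ((τ ∘ₗ A.b) ∘ₗ pplus k V ∘ₗ A.D) LinearMap.id +
      pconv ((τ ∘ₗ A.b) ∘ₗ A.S) A.D := pconv_coder isCoalg_id _ _ _ _
  have h3 : (τ ∘ₗ A.b) ∘ₗ pplus k V ∘ₗ A.D = 0 := by
    ext t; simp [pplus_D, b_D]
  have h4 : A.S ∘ₗ A.D = conv (A.S ∘ₗ A.S) (conv (τ ∘ₗ A.sg ∘ₗ A.b ∘ₗ pplus k V) A.S) := by
    rw [← S_comp_com]; exact tmap_conv _ _ _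
  have h5 : pconv ((τ ∘ₗ A.b) ∘ₗ A.S) A.D = -conv (τ ∘ₗ A.sg ∘ₗ A.b ∘ₗ pplus k V) A.D := by
    rw [LinearMap.comp_assoc, b_comp_S]
    simp [pconv, conv, LinearMap.comp_neg, LinearMap.neg_comp, LinearMap.comp_assoc]
  rw [h4, conv_assoc, conv_assoc, ← D_eq, h2, h3, h5] at h1
  simpa [conv] using LinearMap.congr_fun h1 t

/-- The differential (up to sign) of the endomorphism algebra in terms of linear parts. -/
theorem D_com (φ : 𝕋 V →ₗ[k] V) (t : 𝕋 V) :
    A.D (com φ t) - A.S (com φ (A.S (A.D t))) =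
      com (A.b ∘ₗ com φ - A.sg ∘ₗ φ ∘ₗ A.S ∘ₗ A.D) t := by
  have h1 : A.D ∘ₗ com φ = com (A.b ∘ₗ com φ) +
      conv (τ ∘ₗ A.sg ∘ₗ φ ∘ₗ pplus k V) A.D := by
    have h0 : ∀ X : 𝕋 V →ₗ[k] 𝕋 V, LinearMap.mul k (𝕋 V) 1 ∘ₗ X = X := by
      intro X; ext t; simp
    rw [D_eq, conv, bconv_com, ← conv, S_comp_com, conv_assoc, S_one, com_comp_com, h0]
  have h2 : A.S ∘ₗ com φ ∘ₗ A.S = com (A.sg ∘ₗ φ ∘ₗ A.S) := tmap_com_tmap _ A.sg_comp_sg _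
  have h3 : com (A.sg ∘ₗ φ ∘ₗ A.S) ∘ₗ A.D =
      conv ((τ ∘ₗ A.sg ∘ₗ φ ∘ₗ A.S) ∘ₗ pplus k V ∘ₗ A.D) LinearMap.id +
      pconv ((τ ∘ₗ A.sg ∘ₗ φ ∘ₗ A.S) ∘ₗ A.S) A.D := pconv_coder isCoalg_id _ _ _ _
  have h4 : pplus k V ∘ₗ A.D = A.D ∘ₗ pplus k V := by ext t; simp [pplus_D, D_pplus]
  have h5 : (τ ∘ₗ A.sg ∘ₗ φ ∘ₗ A.S) ∘ₗ A.S = τ ∘ₗ A.sg ∘ₗ φ := by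
    simp only [LinearMap.comp_assoc, S_comp_S]; rfl
  have h6 : A.S (com φ (A.S (A.D t))) = com (A.sg ∘ₗ φ ∘ₗ A.S) (A.D t) :=
    LinearMap.congr_fun h2 _
  have h7 := LinearMap.congr_fun h1 t
  have h8 := LinearMap.congr_fun h3 t
  rw [h4, h5] at h8
  simp only [LinearMap.comp_apply, LinearMap.add_apply] at h7 h8
  rw [h6, h7, h8, com_sub, LinearMap.sub_apply]
  have h9 : conv ((τ ∘ₗ A.sg ∘ₗ φ ∘ₗ A.S) ∘ₗ A.D ∘ₗ pplus k V) LinearMap.id t =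
    com (A.sg ∘ₗ φ ∘ₗ A.S ∘ₗ A.D) t := rfl
  have h10 : pconv (τ ∘ₗ A.sg ∘ₗ φ) A.D t = conv (τ ∘ₗ A.sg ∘ₗ φ ∘ₗ pplus k V) A.D t := rfl
  rw [h9, h10]; abel

theorem com_sg (φ : 𝕋 V →ₗ[k] V) (t : 𝕋 V) :
    com (A.sg ∘ₗ φ ∘ₗ A.S) t = A.S (com φ (A.S t)) :=
  (LinearMap.congr_fun (tmap_com_tmap _ A.sg_comp_sg φ) t).symm

/-- The unary operation of the endomorphism algebra. -/
noncomputable def endDiff : (𝕋 V →ₗ[k] V) →ₗ[k] (𝕋 V →ₗ[k] V) where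
  toFun φ := -(A.b ∘ₗ com φ - A.sg ∘ₗ φ ∘ₗ A.S ∘ₗ A.D)
  map_add' φ ψ := by ext t; simp [com_add]; abel
  map_smul' a φ := by ext t; simp [com_smul, smul_sub]

/-- The binary operation of the endomorphism algebra. -/
noncomputable def endMul : (𝕋 V →ₗ[k] V) →ₗ[k] (𝕋 V →ₗ[k] V) →ₗ[k] (𝕋 V →ₗ[k] V) :=
  LinearMap.mk₂ k (fun φ ψ => A.sg ∘ₗ φ ∘ₗ A.S ∘ₗ com ψ)
    (by intros; ext; simp) (by intros; ext; simp)
    (by intros; ext; simp [com_add]) (by intros; ext; simp [com_smul])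

/-- The sign operator of the endomorphism algebra. -/
noncomputable def endSg : (𝕋 V →ₗ[k] V) →ₗ[k] (𝕋 V →ₗ[k] V) where
  toFun φ := -(A.sg ∘ₗ φ ∘ₗ A.S)
  map_add' φ ψ := by ext t; simp; abel
  map_smul' a φ := by ext t; simp

theorem endDiff_apply (φ : 𝕋 V →ₗ[k] V) (t : 𝕋 V) :
    A.endDiff φ t = A.sg (φ (A.S (A.D t))) - A.b (com φ t) := by simp [endDiff]

theorem endMul_apply (φ ψ : 𝕋 V →ₗ[k] V) (t : 𝕋 V) :
    A.endMul φ ψ t = A.sg (φ (A.S (com ψ t))) := rfl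

theorem endSg_apply (φ : 𝕋 V →ₗ[k] V) (t : 𝕋 V) : A.endSg φ t = -A.sg (φ (A.S t)) := rfl

theorem com_endDiff (φ : 𝕋 V →ₗ[k] V) (t : 𝕋 V) :
    com (A.endDiff φ) t = A.S (com φ (A.S (A.D t))) - A.D (com φ t) := by
  rw [← neg_sub, D_com, ← LinearMap.neg_apply, ← com_neg]; rfl

theorem com_endMul (φ ψ : 𝕋 V →ₗ[k] V) (t : 𝕋 V) :
    com (A.endMul φ ψ) t = A.S (com φ (A.S (com ψ t))) := by
  rw [← com_sg, ← LinearMap.comp_apply, com_comp_com]; rfl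

theorem com_endSg (φ : 𝕋 V →ₗ[k] V) (t : 𝕋 V) :
    com (A.endSg φ) t = -A.S (com φ (A.S t)) := by
  rw [← com_sg, ← LinearMap.neg_apply, ← com_neg]; rfl

theorem endSg_endSg (φ : 𝕋 V →ₗ[k] V) : A.endSg (A.endSg φ) = φ := by
  ext t; simp [endSg_apply, sg_sg, S_S]

theorem endDiff_endDiff (φ : 𝕋 V →ₗ[k] V) : A.endDiff (A.endDiff φ) = 0 := by
  ext t
  simp [endDiff_apply, com_endDiff, b_D, b_S, S_D, D_D]

theorem endDiff_endSg (φ : 𝕋 V →ₗ[k] V) : A.endDiff (A.endSg φ) = -A.endSg (A.endDiff φ) := by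
  ext t
  simp [endDiff_apply, com_endSg, endSg_apply, b_S, sg_sg, S_S, S_D]
  abel

theorem endMul_endSg (φ ψ : 𝕋 V →ₗ[k] V) :
    A.endMul (A.endSg φ) (A.endSg ψ) = -A.endSg (A.endMul φ ψ) := by
  ext t
  simp [endMul_apply, com_endSg, endSg_apply, sg_sg, S_S]

theorem endDiff_endMul (φ ψ : 𝕋 V →ₗ[k] V) :
    A.endDiff (A.endMul φ ψ) + A.endMul (A.endDiff φ) ψ + A.endMul (A.endSg φ) (A.endDiff ψ) =
      0 := by
  ext t
  simp [endDiff_apply, endMul_apply, endSg_apply, com_endDiff, com_endMul, b_S, sg_sg, S_S, S_D]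

theorem endMul_assoc (φ ψ χ : 𝕋 V →ₗ[k] V) :
    A.endMul (A.endMul φ ψ) χ + A.endMul (A.endSg φ) (A.endMul ψ χ) = 0 := by
  ext t
  simp [endMul_apply, endSg_apply, com_endMul, sg_sg, S_S]

theorem endMul_letter (ψ : 𝕋 V →ₗ[k] V) (h : ψ 1 = 0) : A.endMul (letter k V) ψ = ψ := by
  have h1 : ∀ t, letter k V (A.S t) = A.sg (letter k V t) := by
    intro t
    have : letter k V ∘ₗ A.S = A.sg ∘ₗ letter k V := by
      apply tensor_ext
      · simp [S_one, letter_one]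
      · intro x t _
        simp [S_mul, S_letter, letter_cons, aug_S]
    exact LinearMap.congr_fun this t
  have h2 : ∀ t, letter k V (com ψ t) = ψ t := by
    intro t
    rw [← comp_pplus h]
    have := LinearMap.congr_fun (letter_com ψ) t
    rwa [← com_comp_pplus] at this
  ext t
  simp [endMul_apply, h1, h2, sg_sg]

theorem letter_endMul (ψ : 𝕋 V →ₗ[k] V) (h : ψ 1 = 0) :
    A.endMul ψ (letter k V) = -A.endSg ψ := by
  ext t
  rw [endMul_apply, com_letter, ← pplus_S, LinearMap.neg_apply, endSg_apply, neg_neg]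
  congr 1
  exact LinearMap.congr_fun (comp_pplus h) _

/-- The A∞-structure given by the operations of a differential graded algebra. -/
noncomputable def ofDG {W : Type} [AddCommGroup W] [Module k W] (sg m₁ : W →ₗ[k] W)
    (m₂ : W →ₗ[k] W →ₗ[k] W) (sg_sg : ∀ x, sg (sg x) = x) (m₁_sg : ∀ x, m₁ (sg x) = -sg (m₁ x))
    (m₂_sg : ∀ x y, m₂ (sg x) (sg y) = -sg (m₂ x y)) (m₁_m₁ : ∀ x, m₁ (m₁ x) = 0)
    (m₁_m₂ : ∀ x y, m₁ (m₂ x y) + m₂ (m₁ x) y + m₂ (sg x) (m₁ y) = 0)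
    (assoc : ∀ x y z, m₂ (m₂ x y) z + m₂ (sg x) (m₂ y z) = 0) : CoA k W where
  sg := sg
  b := m₁ ∘ₗ letter k W + bconv m₂ (letter k W) (letter k W)
  sg_sg := sg_sg
  b_one := by simp [letter_one, bconv_one]
  b_sg := by
    have h1 : letter k W ∘ₗ tmap sg = sg ∘ₗ letter k W := by
      apply tensor_ext
      · simp [tmap_one, letter_one]
      · intro x t _
        simp [tmap_cons, letter_cons, (isCoalg_tmap sg).aug]
    intro t
    have h2 := LinearMap.congr_fun ((isCoalg_tmap sg).bconv m₂ (letter k W) (letter k W)) t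
    have h3 := LinearMap.congr_fun (comp_bconv_congr (μ := m₂) (μ' := m₂) (θ := -sg)
      (θ' := LinearMap.id) (c := letter k W) (g := letter k W) (c' := sg ∘ₗ letter k W)
      (g' := sg ∘ₗ letter k W) (by intro s t; simp [m₂_sg])) t
    have h4 := LinearMap.congr_fun h1 t
    simp only [LinearMap.comp_apply, LinearMap.neg_apply, LinearMap.id_apply] at h2 h3 h4
    rw [h1] at h2
    rw [LinearMap.add_apply, h2, ← h3, LinearMap.comp_apply, h4, m₁_sg]
    simp; abel
  b_coder := by
    intro t
    set p := letter k W
    set b := m₁ ∘ₗ p + bconv m₂ p p with hb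
    set D := coder b LinearMap.id sg
    have b_one : b 1 = 0 := by simp [hb, p, letter_one, bconv_one]
    have hp : p ∘ₗ D = b := by
      rw [letter_coder b isCoalg_id sg, comp_pplus b_one]
    have hs : p ∘ₗ tmap sg = sg ∘ₗ p := by
      apply tensor_ext
      · simp [tmap_one, p, letter_one]
      · intro x t _
        simp [p, tmap_cons, letter_cons, (isCoalg_tmap sg).aug]
    have h1 : b ∘ₗ D = m₁ ∘ₗ b + (bconv m₂ b p + bconv m₂ (sg ∘ₗ p) b) := by
      conv_lhs => rw [hb]
      rw [LinearMap.add_comp, LinearMap.comp_assoc, hp, bconv_coder isCoalg_id, hp, hs]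
      rfl
    have h2 : m₁ ∘ₗ bconv m₂ p p + (bconv m₂ (m₁ ∘ₗ p) p + bconv m₂ (sg ∘ₗ p) (m₁ ∘ₗ p)) = 0 := by
      have e1 : bconv m₂ (m₁ ∘ₗ p) p + bconv m₂ (sg ∘ₗ p) (m₁ ∘ₗ p) =
          LinearMap.id ∘ₗ bconv (m₂ ∘ₗ m₁ + m₂.compl₁₂ sg m₁) p p := by
        simp only [bconv, LinearMap.mk₂_apply, ← LinearMap.comp_assoc, ← LinearMap.add_comp]
        congr 1
        ext; simp
      have e2 : (-m₁) ∘ₗ bconv m₂ p p =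
          LinearMap.id ∘ₗ bconv (m₂ ∘ₗ m₁ + m₂.compl₁₂ sg m₁) p p := by
        apply comp_bconv_congr
        intro s t
        have := m₁_m₂ (p s) (p t)
        simp only [LinearMap.neg_apply, LinearMap.id_apply, LinearMap.add_apply,
          LinearMap.comp_apply, LinearMap.compl₁₂_apply]
        rw [add_assoc] at this
        exact (eq_neg_of_add_eq_zero_right this).symm
      rw [e1, ← e2, LinearMap.neg_comp, add_neg_cancel]
    have h3 : bconv m₂ (bconv m₂ p p) p + bconv m₂ (sg ∘ₗ p) (bconv m₂ p p) = 0 := by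
      have e1 : bconv m₂ (sg ∘ₗ p) (bconv m₂ p p) = LinearMap.id ∘ₗ bconv (m₂ ∘ₗ sg) p (bconv m₂ p p) :=
        comp_bconv_congr (θ := LinearMap.id) (by intro s t; rfl)
      rw [bconv_assoc (ν' := -(m₂ ∘ₗ sg)) (ν := m₂), e1]
      · have e2 : ∀ μ : W →ₗ[k] W →ₗ[k] W, bconv (-μ) p (bconv m₂ p p) =
            -bconv μ p (bconv m₂ p p) := by
          intro μ
          have e3 : LinearMap.id ∘ₗ bconv (-μ) p (bconv m₂ p p) =
              (-LinearMap.id) ∘ₗ bconv μ p (bconv m₂ p p) :=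
            comp_bconv_congr (by intro s t; simp)
          rw [LinearMap.id_comp] at e3
          rw [e3, LinearMap.neg_comp, LinearMap.id_comp]
        rw [e2, LinearMap.id_comp, neg_add_cancel]
      · intro x y z
        exact eq_neg_of_add_eq_zero_left (assoc x y z)
    have h4 : b ∘ₗ D = 0 := by
      rw [h1, hb]
      simp only [LinearMap.comp_add, map_add, LinearMap.add_apply]
      have h5 : m₁ ∘ₗ m₁ ∘ₗ p = 0 := by ext; simp [m₁_m₁]
      rw [h5]
      calc _ = (m₁ ∘ₗ bconv m₂ p p + (bconv m₂ (m₁ ∘ₗ p) p + bconv m₂ (sg ∘ₗ p) (m₁ ∘ₗ p))) +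
          (bconv m₂ (bconv m₂ p p) p + bconv m₂ (sg ∘ₗ p) (bconv m₂ p p)) := by abel
        _ = 0 := by rw [h2, h3, add_zero]
    exact LinearMap.congr_fun h4 t

end CoA

/-! ### The Yoneda morphism -/

namespace CoA

variable {V : Type} [AddCommGroup V] [Module k V] (A : CoA k V)

/-- `com` as a linear map. -/
noncomputable def comLin : (𝕋 V →ₗ[k] V) →ₗ[k] 𝕋 V →ₗ[k] 𝕋 V where
  toFun φ := com φ
  map_add' := com_add
  map_smul' := com_smul

/-- The Yoneda morphism: `yon w` is the operation `t ↦ b (w t)`. -/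
noncomputable def yon : 𝕋 V →ₗ[k] 𝕋 V →ₗ[k] V where
  toFun w := A.b ∘ₗ LinearMap.mulLeft k (pplus k V w) ∘ₗ pplus k V
  map_add' v w := by ext t; simp [add_mul]
  map_smul' a w := by ext t; simp

theorem yon_apply (w t : 𝕋 V) : A.yon w t = A.b (pplus k V w * pplus k V t) := rfl

theorem yon_one : A.yon 1 = 0 := by
  ext t; simp [yon_apply, pplus_one]

theorem yon_apply_one (w : 𝕋 V) : A.yon w 1 = 0 := by simp [yon_apply, pplus_one]

theorem pplus_letter (x : V) : pplus k V (τ x) = τ x := by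
  have := pplus_cons x (1 : 𝕋 V)
  rwa [mul_one] at this

theorem yon_letter (x : V) : A.yon (τ x) = lsh A.b x ∘ₗ pplus k V := by
  ext t; rw [yon_apply, pplus_letter]; rfl

theorem com_yon_cons (x : V) (w : 𝕋 V) :
    com (A.yon (τ x * w)) = com (A.b ∘ₗ LinearMap.mulLeft k (τ x * w)) := by
  rw [← com_comp_pplus (A.b ∘ₗ LinearMap.mulLeft k (τ x * w))]
  congr 1
  ext t; simp [yon_apply, pplus_cons, mul_assoc]

theorem lsh_S (x : V) : lsh A.S x = LinearMap.mulLeft k (τ (A.sg x)) ∘ₗ A.S := lsh_tmap _ _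

theorem D_mul (w u : 𝕋 V) :
    A.D (w * u) = A.D w * u + conv A.S (comLin.flip u ∘ₗ A.yon) w + A.S w * A.D u := by
  induction w using tensor_induction with
  | one => simp [conv, bconv_one, yon_one, D_one, S_one]
  | cons x w ih =>
    have h1 : com A.b (τ x * w * u) = com A.b (τ x * w) * u + com (A.yon (τ x * w)) u := by
      rw [com_cons_mul, com_yon_cons]
    rw [mul_assoc, D_cons, ← mul_assoc, h1, ih, D_cons, S_mul, S_letter]
    have h2 : conv A.S (comLin.flip u ∘ₗ A.yon) (τ x * w) =
        com (A.yon (τ x * w)) u + τ (A.sg x) * conv A.S (comLin.flip u ∘ₗ A.yon) w := by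
      rw [conv, bconv_cons, lsh_S, ← conv, mul_conv]
      simp [S_one, comLin]
    rw [h2]
    simp only [add_mul, mul_add, mul_assoc]; abel
  | add s t hs ht => simp only [add_mul, map_add, hs, ht]; abel
  | smul a t ht => simp only [smul_mul_assoc, map_smul, ht, smul_add]

theorem b_S_mul (s t : 𝕋 V) : A.b (A.S s * t) = -A.sg (A.b (s * A.S t)) := by
  rw [← b_S, S_mul, S_S]

theorem yon_D_aux (x z : V) (w t : 𝕋 V) : A.yon (A.D (τ x * w)) (τ z * t) =
    A.endDiff (A.yon (τ x * w)) (τ z * t) + bconv A.endMul A.yon A.yon (τ x * w) (τ z * t) := by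
  have h1 := A.b_D ((τ x * w) * (τ z * t))
  rw [D_mul, conv_eq] at h1
  have h2 : A.b ∘ₗ conv (A.S ∘ₗ pplus k V) (comLin.flip (τ z * t) ∘ₗ A.yon) =
      (-(LinearMap.applyₗ (τ z * t))) ∘ₗ bconv A.endMul A.yon A.yon := by
    apply comp_bconv_congr
    intro s s'
    simp only [LinearMap.comp_apply, LinearMap.mul_apply', LinearMap.flip_apply,
      LinearMap.neg_apply, LinearMap.applyₗ_apply_apply, endMul_apply, comLin, A.yon_apply s,
      LinearMap.coe_mk, AddHom.coe_mk]
    rw [b_S_mul, pplus_S, ← LinearMap.comp_apply (pplus k V), pplus_com]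
  have h3 := LinearMap.congr_fun h2 (τ x * w)
  simp only [LinearMap.comp_apply, LinearMap.neg_apply, LinearMap.applyₗ_apply_apply] at h3
  rw [← pconv] at h3
  simp only [map_add, S_one, one_mul] at h1
  rw [LinearMap.comp_apply] at h1
  have h4 : A.b (A.S (τ x * w) * A.D (τ z * t)) =
      -A.sg (A.yon (τ x * w) (A.S (A.D (τ z * t)))) := by
    rw [b_S_mul, yon_apply, pplus_S, pplus_D, pplus_cons]
  have h5 : A.yon (A.D (τ x * w)) (τ z * t) = A.b (A.D (τ x * w) * (τ z * t)) := by
    rw [yon_apply, pplus_D, pplus_cons]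
  rw [h3, h4, ← h5] at h1
  rw [endDiff_apply]
  have h6 : comLin.flip (τ z * t) (A.yon (τ x * w)) = com (A.yon (τ x * w)) (τ z * t) := rfl
  rw [h6] at h1
  rw [← sub_eq_zero, ← h1]; abel

theorem yon_comp_D : A.yon ∘ₗ A.D = A.endDiff ∘ₗ A.yon + bconv A.endMul A.yon A.yon := by
  apply tensor_ext
  · simp [D_one, yon_one, bconv_one]
  · intro x w _
    apply tensor_ext
    · have : ∀ w, bconv A.endMul A.yon A.yon w 1 = 0 := by
        intro w
        have h2 : LinearMap.applyₗ (1 : 𝕋 V) ∘ₗ bconv A.endMul A.yon A.yon =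
            (0 : V →ₗ[k] V) ∘ₗ bconv (0 : V →ₗ[k] V →ₗ[k] V) A.b A.b := by
          apply comp_bconv_congr
          intro s s'
          simp [endMul_apply, com_one]
        simpa using LinearMap.congr_fun h2 w
      simp [yon_apply_one, endDiff_apply, D_one, com_one, this]
    · intro z t _
      exact A.yon_D_aux x z w t

theorem com_singleton (φ : 𝕋 V →ₗ[k] V) (x : V) : com φ (τ x) = τ (φ (τ x)) := by
  have := com_cons φ x 1
  rwa [mul_one, com_one, mul_one, add_zero] at this

theorem D_letter (x : V) : A.D (τ x) = τ (A.b (τ x)) := by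
  have := A.D_cons x 1
  rwa [D_one, mul_one, mul_zero, add_zero, com_singleton] at this

theorem yon_letter_b (x : V) : A.yon (τ (A.b (τ x))) = A.endDiff (A.yon (τ x)) := by
  have h1 := LinearMap.congr_fun A.yon_comp_D (τ x)
  have h3 : bconv A.endMul A.yon A.yon (τ x) = 0 := by
    have := bconv_cons A.endMul A.yon A.yon x 1
    rw [bconv_one, yon_one, mul_one] at this
    rw [this]; simp
  simpa [D_letter, h3] using h1

/-! ### The Yoneda morphism is a quasi-isomorphism -/

theorem D_cons_yon (x : V) (u : 𝕋 V) :
    A.D (τ x * u) = τ (A.b (τ x)) * u + com (A.yon (τ x)) u + τ (A.sg x) * A.D u := by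
  rw [D_cons, com_cons, yon_letter, com_comp_pplus]

theorem b_letter_sg (x : V) : A.b (τ (A.sg x)) = -A.sg (A.b (τ x)) := by
  rw [← S_letter, b_S]

theorem yon_sg (x : V) (t : 𝕋 V) : A.sg (A.yon (τ x) (A.S t)) = -A.yon (τ (A.sg x)) t := by
  rw [yon_apply, yon_apply, pplus_letter, pplus_letter, ← S_letter, b_S_mul, pplus_S, neg_neg]

theorem com_yon_sg (x : V) (t : 𝕋 V) :
    A.S (com (A.yon (τ x)) (A.S t)) = -com (A.yon (τ (A.sg x))) t := by
  rw [← com_sg, ← LinearMap.neg_apply, ← com_neg]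
  congr 2
  ext t
  exact A.yon_sg x t

/-- Insertion of `e` as the first argument. -/
noncomputable def ins (e : V) (φ : 𝕋 V →ₗ[k] V) : 𝕋 V →ₗ[k] V := lsh φ e ∘ₗ pplus k V

theorem com_ins (e : V) (φ : 𝕋 V →ₗ[k] V) (u : 𝕋 V) :
    com (ins e φ) u = com φ (τ e * u) - τ (φ (τ e)) * u := by
  rw [ins, com_comp_pplus, com_cons]; abel

theorem com_injective {φ ψ : 𝕋 V →ₗ[k] V} (h1 : φ 1 = ψ 1) (h : com φ = com ψ) : φ = ψ := by
  have h2 := congrArg (letter k V ∘ₗ ·) (com_sub φ ψ)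
  simp only [letter_com, h, sub_self, LinearMap.comp_zero] at h2
  rw [comp_pplus (by simp [h1])] at h2
  exact sub_eq_zero.1 h2

variable {A}

theorem com_endDiff_ins {e : V} (he : A.sg e = -e) (hde : A.b (τ e) = 0) {φ : 𝕋 V →ₗ[k] V}
    (hφ : A.endDiff φ = 0) (u : 𝕋 V) :
    com (A.endDiff (ins e φ)) u = com (A.yon (τ (φ (τ e)))) u -
      A.S (com φ (A.S (com (A.yon (τ e)) u))) := by
  have hφ' : ∀ u, A.D (com φ u) = A.S (com φ (A.S (A.D u))) := by
    intro u
    have := A.com_endDiff φ u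
    rw [hφ, com_zero] at this
    exact (sub_eq_zero.1 this.symm).symm
  have hz : A.b (τ (φ (τ e))) = 0 := by
    have := LinearMap.congr_fun hφ (τ e)
    have h2 := com_cons φ e 1
    rw [mul_one, com_one, mul_one, add_zero] at h2
    rw [endDiff_apply, D_letter, hde, h2] at this
    simpa using this
  rw [com_endDiff, com_ins, com_ins, map_sub, map_sub, hφ', D_cons_yon, D_cons_yon, hde, hz, he]
  simp only [map_zero, zero_mul, zero_add, map_add, map_neg, neg_mul, S_mul, S_letter, he, S_S]
  abel

theorem exists_yon_sub_eq {e : V} (he : A.sg e = -e) (hde : A.b (τ e) = 0) {s s' : V →ₗ[k] V}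
    (hs : ∀ x, A.sg (s x) = -s (A.sg x))
    (hs' : ∀ x, -A.b (τ (A.sg x) * τ e) = x + A.b (τ (s' x)) + s' (A.b (τ x)))
    {R : 𝕋 V →ₗ[k] 𝕋 V}
    (hR1 : (LinearMap.id - com (letter k V + A.b ∘ₗ com (s ∘ₗ letter k V) + s ∘ₗ A.b
      - A.yon (τ e))) ∘ₗ R = LinearMap.id)
    (hR2 : R ∘ₗ (LinearMap.id - com (letter k V + A.b ∘ₗ com (s ∘ₗ letter k V) + s ∘ₗ A.b
      - A.yon (τ e))) = LinearMap.id) {φ : 𝕋 V →ₗ[k] V} (hφ1 : φ 1 = 0) (hφ : A.endDiff φ = 0) :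
    A.yon (τ (-A.sg (φ (τ e)))) - φ = A.endDiff
      ((ins e (A.sg ∘ₗ φ ∘ₗ A.S) + A.yon (τ (s' (-A.sg (φ (τ e))))) - ins e (A.yon (τ (φ (τ e)))) -
        A.sg ∘ₗ (φ - A.yon (τ (-A.sg (φ (τ e))))) ∘ₗ A.S ∘ₗ com (s ∘ₗ letter k V)) ∘ₗ
        com (letter k V ∘ₗ R)) := by
  set z := φ (τ e) with hz
  set x := -A.sg z with hx
  set ν := letter k V + A.b ∘ₗ com (s ∘ₗ letter k V) + s ∘ₗ A.b - A.yon (τ e) with hν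
  set ω := φ - A.yon (τ x) with hω
  set θ₁ := ins e (A.sg ∘ₗ φ ∘ₗ A.S) + A.yon (τ (s' x)) - ins e (A.yon (τ z)) with hθ₁
  set θ₂ := θ₁ - A.sg ∘ₗ ω ∘ₗ A.S ∘ₗ com (s ∘ₗ letter k V) with hθ₂
  have hdz : A.b (τ z) = 0 := by
    have := LinearMap.congr_fun hφ (τ e)
    have h2 := com_cons φ e 1
    rw [mul_one, com_one, mul_one, add_zero] at h2
    rw [endDiff_apply, D_letter, hde, h2] at this
    simpa using this
  have hxz : A.sg x = -z := by simp [hx, A.sg_sg]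
  have hdx : A.b (τ x) = 0 := by
    rw [hx, map_neg, map_neg, b_letter_sg, hdz]; simp
  have hyx : A.endDiff (A.yon (τ x)) = 0 := by
    rw [← yon_letter_b, hdx, map_zero, map_zero]
  have hyz : A.endDiff (A.yon (τ z)) = 0 := by
    rw [← yon_letter_b, hdz, map_zero, map_zero]
  have hωc : A.endDiff ω = 0 := by rw [hω, map_sub, hφ, hyx, sub_zero]
  have hφs : A.endDiff (A.sg ∘ₗ φ ∘ₗ A.S) = 0 := by
    have h1 : A.sg ∘ₗ φ ∘ₗ A.S = -A.endSg φ := by ext t; simp [endSg_apply]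
    rw [h1, map_neg, endDiff_endSg, hφ]; simp
  have comSub : ∀ (α β : 𝕋 V →ₗ[k] V) u, com (α - β) u = com α u - com β u := by
    intro α β u; rw [com_sub]; rfl
  have comAdd : ∀ (α β : 𝕋 V →ₗ[k] V) u, com (α + β) u = com α u + com β u := by
    intro α β u; rw [com_add]; rfl
  -- the unit acts on the closed morphism `ω` by a coboundary
  have h1 : ∀ u, com (A.endDiff θ₁) u = -com ω (com (A.yon (τ e)) u) := by
    intro u
    have e1 := com_endDiff_ins he hde hφs u
    have e2 := com_endDiff_ins he hde hyz u
    have e3 : A.endDiff (A.yon (τ (s' x))) = A.yon (τ (A.b (τ z * τ e))) - A.yon (τ x) := by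
      have := hs' x
      rw [hdx, map_zero, add_zero, hxz, map_neg, neg_mul, map_neg, neg_neg] at this
      rw [← yon_letter_b, this]; simp
    have e4 : A.yon (τ z) (τ e) = A.b (τ z * τ e) := by
      rw [yon_apply, pplus_letter, pplus_letter]
    have e5 : (A.sg ∘ₗ φ ∘ₗ A.S) (τ e) = x := by
      simp [S_letter, he, hx, hz]
    rw [hθ₁, map_sub, map_add, comSub, comAdd, e1, e2, e3, e4, e5, com_sg, com_yon_sg, hω,
      comSub, comSub, S_S, S_S, hx]
    simp only [map_neg, com_neg, LinearMap.neg_apply]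
    abel
  have hcω : ∀ u, com ω (A.D u) = A.D (A.S (com ω (A.S u))) := by
    intro u
    have := A.com_endDiff ω (A.S u)
    rw [hωc, com_zero] at this
    have h2 := sub_eq_zero.1 this.symm
    have h3 : A.D (A.S (com ω (A.S u))) = -A.S (A.D (com ω (A.S u))) := by
      rw [S_D, neg_neg]
    rw [h3, ← h2, S_S, ← neg_neg (A.S (A.D (A.S u))), S_D, S_S]; simp
  have hSs : ∀ u, A.S (com (s ∘ₗ letter k V) (A.S u)) = -com (s ∘ₗ letter k V) u := by
    intro u
    rw [← com_sg, ← LinearMap.neg_apply, ← com_neg]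
    congr 2
    apply tensor_ext
    · simp [S_one, letter_one]
    · intro v t _
      simp [S_mul, S_letter, letter_cons, aug_S, hs, A.sg_sg]
  have hcν : ∀ u, com ν u = pplus k V u + (A.D (com (s ∘ₗ letter k V) u) +
      com (s ∘ₗ letter k V) (A.D u)) - com (A.yon (τ e)) u := by
    intro u
    have e1 := A.D_com (s ∘ₗ letter k V) u
    rw [hSs, sub_neg_eq_add] at e1
    rw [e1, ← com_letter, ← comAdd, ← comSub, hν]
    congr 2
    rw [add_assoc]
    congr 2
    rw [sub_eq_add_neg]
    congr 1
    ext t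
    have : A.sg (s (letter k V (A.S (A.D t)))) = -s (A.b t) := by
      rw [hs, S_D, map_neg, map_neg, map_neg, neg_neg, letter_D, b_S, map_neg, map_neg, A.sg_sg]
    simp [this]
  have hωp : ∀ u, com ω (pplus k V u) = com ω u := by
    intro u; exact LinearMap.congr_fun (com_pplus ω) u
  have h2 : ∀ u, com (A.endDiff θ₂) u = -(com ω (u - com ν u)) := by
    intro u
    rw [hθ₂, map_sub, comSub, h1, hcν]
    have e1 : A.sg ∘ₗ ω ∘ₗ A.S ∘ₗ com (s ∘ₗ letter k V) = A.endMul ω (s ∘ₗ letter k V) := rfl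
    rw [e1, com_endDiff, com_endMul, com_endMul]
    simp only [map_sub, map_add, hωp, hcω, S_S, hSs]
    simp only [map_neg]
    abel
  have hND : ∀ u, com ν (A.D u) = A.D (com ν u) := by
    intro u
    have e1 : com (A.yon (τ e)) (A.D u) = A.D (com (A.yon (τ e)) u) := by
      have := A.com_endDiff (A.yon (τ e)) u
      rw [← yon_letter_b, hde, map_zero, map_zero, com_zero, com_yon_sg, he] at this
      simpa [com_neg, sub_eq_zero] using this.symm
    simp [hcν, pplus_D, D_pplus, D_D, e1]
  have hNS : ∀ u, com ν (A.S u) = A.S (com ν u) := by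
    intro u
    have e1 : com (A.yon (τ e)) (A.S u) = A.S (com (A.yon (τ e)) u) := by
      have := A.com_yon_sg e u
      rw [he, map_neg, map_neg, com_neg, LinearMap.neg_apply, neg_neg] at this
      rw [← this, S_S]
    have e2 : ∀ v, com (s ∘ₗ letter k V) (A.S v) = -A.S (com (s ∘ₗ letter k V) v) := by
      intro v
      rw [← map_neg, ← hSs, S_S]
    have e3 : ∀ v, A.D (A.S v) = -A.S (A.D v) := by
      intro v; rw [S_D, neg_neg]
    simp [hcν, pplus_S, e1, e2, e3]
  have hR1' : ∀ u, R u - com ν (R u) = u := fun u => by simpa using LinearMap.congr_fun hR1 u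
  have hR2' : ∀ u, R (u - com ν u) = u := fun u => by simpa using LinearMap.congr_fun hR2 u
  have hRD : ∀ u, R (A.D u) = A.D (R u) := by
    intro u
    conv_lhs => rw [← hR1' u, map_sub, ← hND, hR2']
  have hRS : ∀ u, R (A.S u) = A.S (R u) := by
    intro u
    conv_lhs => rw [← hR1' u, map_sub, ← hNS, hR2']
  have hR := exists_com_of_inverse hR1 hR2
  have hθR : ∀ u, com (θ₂ ∘ₗ com (letter k V ∘ₗ R)) u = com θ₂ (R u) := by
    intro u
    rw [← com_comp_com]
    conv_rhs => rw [hR]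
    simp [uaug_apply, Algebra.algebraMap_eq_smul_one, com_one]
  apply com_injective
  · rw [LinearMap.sub_apply, yon_apply_one, hφ1, endDiff_apply, D_one, com_one]; simp
  · ext1 u
    rw [com_endDiff, hθR, hθR, hRS, hRD, ← com_endDiff, h2, hR1', hω, ← LinearMap.neg_apply,
      ← com_neg, neg_sub]

theorem eq_b_of_yon_eq {e : V} (he : A.sg e = -e) (hde : A.b (τ e) = 0) {s' : V →ₗ[k] V}
    (hs' : ∀ x, -A.b (τ (A.sg x) * τ e) = x + A.b (τ (s' x)) + s' (A.b (τ x)))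
    {x : V} (hx : A.b (τ x) = 0) {θ : 𝕋 V →ₗ[k] V} (hθ : A.yon (τ x) = A.endDiff θ) :
    x = A.b (τ (-(A.sg (θ (τ e)) + s' x))) := by
  have h1 := LinearMap.congr_fun hθ (τ e)
  have h2 := hs' x
  have h3 : A.b (τ (A.sg x) * τ e) = A.sg (A.b (τ x * τ e)) := by
    rw [← S_letter, b_S_mul, S_letter, he]; simp
  rw [yon_apply, pplus_letter, pplus_letter, endDiff_apply, D_letter, hde, com_singleton] at h1
  simp only [map_zero, zero_sub] at h1
  rw [h3, h1, hx, map_zero, add_zero, map_neg, neg_neg, ← neg_neg (A.sg _), ← b_letter_sg] at h2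
  simp only [map_neg, map_add]
  refine (eq_sub_of_add_eq h2.symm).trans ?_
  abel

end CoA

/-! ### Homogeneous words -/

section Words

variable {V V' : Type} [AddCommGroup V] [Module k V] [AddCommGroup V'] [Module k V']

/-- `HWord gr n q t`: `t` is a product of `n` homogeneous letters with total degree `q`. -/
inductive HWord (gr : ℤ → Submodule k V) : ℕ → ℤ → 𝕋 V → Prop
  | one : HWord gr 0 0 1
  | cons {p : ℤ} {x : V} {n : ℕ} {q : ℤ} {t : 𝕋 V} (hx : x ∈ gr p) (ht : HWord gr n q t) :
      HWord gr (n + 1) (p + q) (τ x * t)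

/-- The span of the homogeneous words of degree `q` and length at most `n`. -/
def TF (gr : ℤ → Submodule k V) (n : ℕ) (q : ℤ) : Submodule k (𝕋 V) :=
  Submodule.span k {t | ∃ m ≤ n, HWord gr m q t}

variable {gr : ℤ → Submodule k V} {gr' : ℤ → Submodule k V'}

theorem HWord.mem {n : ℕ} {q : ℤ} {t : 𝕋 V} (h : HWord gr n q t) : t ∈ TF gr n q :=
  Submodule.subset_span ⟨n, le_rfl, h⟩

theorem TF_mono {m n : ℕ} (h : m ≤ n) (q : ℤ) : TF gr m q ≤ TF gr n q :=
  Submodule.span_mono fun _ ⟨l, hl, ht⟩ => ⟨l, hl.trans h, ht⟩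

theorem HWord.letter {p : ℤ} {x : V} (hx : x ∈ gr p) : HWord gr 1 p (τ x) := by
  have := HWord.cons hx HWord.one
  simpa using this

theorem HWord.mul {n m : ℕ} {q r : ℤ} {s t : 𝕋 V} (hs : HWord gr n q s) (ht : HWord gr m r t) :
    HWord gr (n + m) (q + r) (s * t) := by
  induction hs with
  | one => simpa using ht
  | cons hx _ ih =>
    have := HWord.cons hx ih
    rw [← mul_assoc, ← add_assoc] at this
    convert this using 1
    omega

theorem mul_mem_TF {n m l : ℕ} {q r c : ℤ} {s t : 𝕋 V} (hs : s ∈ TF gr n q) (ht : t ∈ TF gr m r)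
    (hl : n + m ≤ l) (hc : q + r = c) : s * t ∈ TF gr l c := by
  subst hc
  induction hs using Submodule.span_induction with
  | mem s hs =>
    obtain ⟨a, ha, hs⟩ := hs
    induction ht using Submodule.span_induction with
    | mem t ht =>
      obtain ⟨b, hb, ht⟩ := ht
      exact Submodule.subset_span ⟨a + b, by omega, hs.mul ht⟩
    | zero => simp
    | add u v _ _ hu hv => rw [mul_add]; exact add_mem hu hv
    | smul a u _ hu => rw [mul_smul_comm]; exact Submodule.smul_mem _ _ hu
  | zero => simp
  | add u v _ _ hu hv => rw [add_mul]; exact add_mem hu hv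
  | smul a u _ hu => rw [smul_mul_assoc]; exact Submodule.smul_mem _ _ hu

theorem letter_mem_TF {p : ℤ} {x : V} (hx : x ∈ gr p) : τ x ∈ TF gr 1 p := (HWord.letter hx).mem

theorem iSup_TF (h : ⨆ p, gr p = ⊤) : ⨆ i : ℕ × ℤ, TF gr i.1 i.2 = ⊤ := by
  have key : ∀ x : V, ∀ t ∈ ⨆ i : ℕ × ℤ, TF gr i.1 i.2, τ x * t ∈ ⨆ i : ℕ × ℤ, TF gr i.1 i.2 := by
    intro x t ht
    have hx : x ∈ ⨆ p, gr p := h ▸ Submodule.mem_top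
    induction hx using Submodule.iSup_induction' with
    | mem p x hx =>
      induction ht using Submodule.iSup_induction' with
      | mem i t ht =>
        exact Submodule.mem_iSup_of_mem (i.1 + 1, p + i.2)
          (mul_mem_TF (letter_mem_TF hx) ht (by omega) rfl)
      | zero => simp
      | add u v _ _ hu hv => rw [mul_add]; exact add_mem hu hv
    | zero => simp
    | add u v _ _ hu hv => rw [map_add, add_mul]; exact add_mem hu hv
  rw [eq_top_iff]
  rintro t -
  induction t using tensor_induction with
  | one => exact Submodule.mem_iSup_of_mem (0, 0) HWord.one.mem
  | cons x t ht => exact key x t ht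
  | add s t hs ht => exact add_mem hs ht
  | smul a t ht => exact Submodule.smul_mem _ _ ht

theorem HWord.exists_cons {n : ℕ} {q : ℤ} {t : 𝕋 V} (h : HWord gr (n + 1) q t) :
    ∃ p r x u, x ∈ gr p ∧ HWord gr n r u ∧ q = p + r ∧ t = τ x * u := by
  cases h with
  | cons hx ht => exact ⟨_, _, _, _, hx, ht, rfl, rfl⟩

theorem HWord.eq_one {q : ℤ} {t : 𝕋 V} (h : HWord gr 0 q t) : t = 1 ∧ q = 0 := by
  cases h; exact ⟨rfl, rfl⟩

/-- Two linear maps which agree on homogeneous words are equal. -/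
theorem ext_HWord {N : Type} [AddCommGroup N] [Module k N] (h : ⨆ p, gr p = ⊤)
    {F G : 𝕋 V →ₗ[k] N} (hFG : ∀ n q t, HWord gr n q t → F t = G t) : F = G := by
  ext1 t
  have ht : t ∈ ⨆ i : ℕ × ℤ, TF gr i.1 i.2 := iSup_TF h ▸ Submodule.mem_top
  induction ht using Submodule.iSup_induction' with
  | mem i t ht =>
    induction ht using Submodule.span_induction with
    | mem t ht => obtain ⟨m, _, ht⟩ := ht; exact hFG _ _ _ ht
    | zero => simp
    | add u v _ _ hu hv => simp [hu, hv]
    | smul a u _ hu => simp [hu]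
  | zero => simp
  | add u v _ _ hu hv => simp [hu, hv]

/-- `φ` raises the degree by `r`. -/
def Deg (gr : ℤ → Submodule k V) (gr' : ℤ → Submodule k V') (r : ℤ) (φ : 𝕋 V →ₗ[k] V') : Prop :=
  ∀ n q t, HWord gr n q t → φ t ∈ gr' (q + r)

/-- `Φ` raises the degree by `r` and preserves the length filtration. -/
def Op (gr : ℤ → Submodule k V) (gr' : ℤ → Submodule k V') (r : ℤ) (Φ : 𝕋 V →ₗ[k] 𝕋 V') : Prop :=
  ∀ n q t, HWord gr n q t → Φ t ∈ TF gr' n (q + r)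

theorem map_mem_of_TF {N : Type} [AddCommGroup N] [Module k N] {F : 𝕋 V →ₗ[k] N}
    {P : Submodule k N} {n : ℕ} {q : ℤ} (h : ∀ m ≤ n, ∀ t, HWord gr m q t → F t ∈ P) {t : 𝕋 V}
    (ht : t ∈ TF gr n q) : F t ∈ P := by
  have : TF gr n q ≤ P.comap F := Submodule.span_le.2 fun t ⟨m, hm, ht⟩ => h m hm t ht
  exact this ht

theorem Deg.mem {r : ℤ} {φ : 𝕋 V →ₗ[k] V'} (h : Deg gr gr' r φ) {n : ℕ} {q : ℤ} {t : 𝕋 V}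
    (ht : t ∈ TF gr n q) : φ t ∈ gr' (q + r) :=
  map_mem_of_TF (fun m _ t ht => h m q t ht) ht

theorem Op.mem {r : ℤ} {Φ : 𝕋 V →ₗ[k] 𝕋 V'} (h : Op gr gr' r Φ) {n : ℕ} {q : ℤ} {t : 𝕋 V}
    (ht : t ∈ TF gr n q) : Φ t ∈ TF gr' n (q + r) :=
  map_mem_of_TF (fun m hm t ht => TF_mono hm _ (h m q t ht)) ht

theorem Deg.comp_op {V'' : Type} [AddCommGroup V''] [Module k V''] {gr'' : ℤ → Submodule k V''}
    {r s c : ℤ} {φ : 𝕋 V' →ₗ[k] V''} {Φ : 𝕋 V →ₗ[k] 𝕋 V'}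
    (h : Deg gr' gr'' r φ) (hΦ : Op gr gr' s Φ) (hc : s + r = c) : Deg gr gr'' c (φ ∘ₗ Φ) := by
  subst hc
  intro n q t ht
  have := h.mem (hΦ n q t ht)
  rwa [add_assoc] at this

theorem Op.comp {V'' : Type} [AddCommGroup V''] [Module k V''] {gr'' : ℤ → Submodule k V''}
    {r s c : ℤ} {Ψ : 𝕋 V' →ₗ[k] 𝕋 V''} {Φ : 𝕋 V →ₗ[k] 𝕋 V'}
    (h : Op gr' gr'' r Ψ) (hΦ : Op gr gr' s Φ) (hc : s + r = c) : Op gr gr'' c (Ψ ∘ₗ Φ) := by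
  subst hc
  intro n q t ht
  have := h.mem (hΦ n q t ht)
  rwa [add_assoc] at this

theorem Deg.map {V'' : Type} [AddCommGroup V''] [Module k V''] {gr'' : ℤ → Submodule k V''}
    {r s c : ℤ} {φ : 𝕋 V →ₗ[k] V'} {f : V' →ₗ[k] V''}
    (hf : ∀ p, ∀ x ∈ gr' p, f x ∈ gr'' (p + s)) (h : Deg gr gr' r φ) (hc : r + s = c) :
    Deg gr gr'' c (f ∘ₗ φ) := by
  subst hc
  intro n q t ht
  have := hf _ _ (h n q t ht)
  rwa [add_assoc] at this

theorem Deg.add {r : ℤ} {φ ψ : 𝕋 V →ₗ[k] V'} (h : Deg gr gr' r φ) (h' : Deg gr gr' r ψ) :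
    Deg gr gr' r (φ + ψ) := fun n q t ht => add_mem (h n q t ht) (h' n q t ht)

theorem Deg.sub {r : ℤ} {φ ψ : 𝕋 V →ₗ[k] V'} (h : Deg gr gr' r φ) (h' : Deg gr gr' r ψ) :
    Deg gr gr' r (φ - ψ) := fun n q t ht => sub_mem (h n q t ht) (h' n q t ht)

theorem Deg.neg {r : ℤ} {φ : 𝕋 V →ₗ[k] V'} (h : Deg gr gr' r φ) :
    Deg gr gr' r (-φ) := fun n q t ht => neg_mem (h n q t ht)

theorem op_pplus : Op gr gr 0 (pplus k V) := by
  intro n q t ht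
  cases ht with
  | one => simp [pplus_one]
  | cons hx ht => rw [pplus_cons, add_zero]; exact (HWord.cons hx ht).mem

theorem deg_letter : Deg gr gr 0 (letter k V) := by
  intro n q t ht
  cases ht with
  | one => simp [letter_one]
  | cons hx ht =>
    rw [letter_cons]
    cases ht with
    | one => simpa using hx
    | cons hx ht => simp [aug_cons]

theorem Deg.lsh {r p c : ℤ} {φ : 𝕋 V →ₗ[k] V'} (h : Deg gr gr' r φ) {x : V} (hx : x ∈ gr p)
    (hc : p + r = c) : Deg gr gr' c (lsh φ x) := by
  subst hc
  intro n q t ht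
  have := h _ _ _ (HWord.cons hx ht)
  rw [add_right_comm, add_comm (p + r)] at this
  exact this

theorem op_tmap {f : V →ₗ[k] V'} (hf : ∀ p, ∀ x ∈ gr p, f x ∈ gr' p) : Op gr gr' 0 (tmap f) := by
  intro n q t ht
  rw [add_zero]
  induction ht with
  | one => rw [tmap_one]; exact HWord.one.mem
  | cons hx _ ih =>
    rw [tmap_cons]
    exact mul_mem_TF (letter_mem_TF (hf _ _ hx)) ih (by omega) rfl

theorem Deg.com {r : ℤ} {φ : 𝕋 V →ₗ[k] V} (h : Deg gr gr r φ) : Op gr gr r (com φ) := by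
  intro n q t ht
  induction ht generalizing φ r with
  | one => simp [com_one]
  | @cons p x n q t hx ht ih =>
    rw [com_cons]
    have h1 := h _ _ _ (HWord.letter hx)
    refine add_mem (mul_mem_TF (letter_mem_TF h1) ht.mem (by omega) (by ring)) ?_
    have := TF_mono (Nat.le_succ n) _ (ih (h.lsh hx rfl))
    convert this using 2
    ring

theorem Deg.com_lower {r : ℤ} {φ : 𝕋 V →ₗ[k] V} (h : Deg gr gr r φ) (h0 : ∀ x, φ (τ x) = 0)
    {n : ℕ} {q : ℤ} {t : 𝕋 V} (ht : HWord gr (n + 1) q t) :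
    Stmt14.com φ t ∈ TF gr n (q + r) := by
  obtain ⟨p, q', x, u, hx, hu, rfl, rfl⟩ := ht.exists_cons
  rw [com_cons, h0, map_zero, zero_mul, zero_add]
  have := (h.lsh hx rfl).com _ _ _ hu
  convert this using 2
  ring

theorem op_coder {r : ℤ} {a : 𝕋 V →ₗ[k] V} (ha : Deg gr gr r a) {σ : V →ₗ[k] V}
    (hσ : ∀ p, ∀ x ∈ gr p, σ x ∈ gr p) : Op gr gr r (coder a LinearMap.id σ) := by
  intro n q t ht
  induction ht with
  | one => simp [coder_one]
  | @cons p x n q t hx ht ih =>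
    rw [coder_cons]
    refine add_mem (ha.com _ _ _ (HWord.cons hx ht)) ?_
    exact mul_mem_TF (letter_mem_TF (hσ _ _ hx)) ih (by omega) (by ring)

theorem coder_lower {r : ℤ} {a : 𝕋 V →ₗ[k] V} (ha : Deg gr gr r a) (h0 : ∀ x, a (τ x) = 0)
    {σ : V →ₗ[k] V} (hσ : ∀ p, ∀ x ∈ gr p, σ x ∈ gr p) {n : ℕ} {q : ℤ} {t : 𝕋 V}
    (ht : HWord gr (n + 1) q t) : coder a LinearMap.id σ t ∈ TF gr n (q + r) := by
  induction n generalizing q t with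
  | zero =>
    have h1 := ha.com_lower h0 ht
    obtain ⟨p, q', x, u, hx, hu, rfl, rfl⟩ := ht.exists_cons
    obtain ⟨rfl, rfl⟩ := hu.eq_one
    have h2 : pconv (τ ∘ₗ a) LinearMap.id (τ x * 1) ∈ TF gr 0 (p + 0 + r) := h1
    rw [coder_cons, coder_one, mul_zero]
    simpa only [add_zero] using h2
  | succ n ih =>
    have h1 := ha.com_lower h0 ht
    obtain ⟨p, q', x, u, hx, hu, rfl, rfl⟩ := ht.exists_cons
    rw [coder_cons]
    exact add_mem h1 (mul_mem_TF (letter_mem_TF (hσ _ _ hx)) (ih hu) (by omega) (by ring))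

theorem conv_cog_mem {f : 𝕋 V →ₗ[k] V'} (hf : Deg gr gr' 0 f) {n : ℕ} {q : ℤ} {t : 𝕋 V}
    (ht : HWord gr n q t) : ∀ (a : ℕ) (r : ℤ) (c : 𝕋 V →ₗ[k] 𝕋 V'),
    (∀ m q' s, HWord gr m q' s → c s ∈ TF gr' (m + a) (q' + r)) →
    conv c (cog f) t ∈ TF gr' (n + a) (q + r) := by
  induction ht with
  | one =>
    intro a r c hc
    have := hc _ _ _ HWord.one
    simpa [conv, bconv_one, cog_one] using this
  | @cons p x n q t hx ht ih =>
    intro a r c hc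
    rw [conv, bconv_cons, ← conv, cog_cons']
    have h1 := hc _ _ _ HWord.one
    rw [zero_add, zero_add] at h1
    have h2 := ih 1 p (τ ∘ₗ lsh f x) (by
      intro m q' s hs
      have := hf.lsh hx (add_zero p) m q' s hs
      exact TF_mono (by omega) _ (letter_mem_TF this))
    refine add_mem (mul_mem_TF h1 h2 (by omega) (by ring)) ?_
    have h3 := ih (a + 1) (p + r) (lsh c x) (by
      intro m q' s hs
      have := hc _ _ _ (HWord.cons hx hs)
      rw [lsh_apply]
      convert this using 2
      · omega
      · ring)
    convert h3 using 2
    · omega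
    · ring

theorem op_cog {f : 𝕋 V →ₗ[k] V'} (hf : Deg gr gr' 0 f) : Op gr gr' 0 (cog f) := by
  intro n q t ht
  cases ht with
  | one => rw [cog_one]; exact HWord.one.mem
  | @cons p x n q t hx ht =>
    rw [cog_cons']
    have := conv_cog_mem hf ht 1 p (τ ∘ₗ Stmt14.lsh f x) (by
      intro m q' s hs
      have := hf.lsh hx (add_zero p) m q' s hs
      exact TF_mono (by omega) _ (letter_mem_TF this))
    convert this using 2
    ring

theorem pow_mem_bot {Φ : Module.End k (𝕋 V)} (h1 : Φ 1 = 0)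
    (hΦ : ∀ n q t, HWord gr (n + 1) q t → Φ t ∈ TF gr n q) {n : ℕ} {q : ℤ} {t : 𝕋 V}
    (ht : t ∈ TF gr n q) : (Φ ^ (n + 1)) t = 0 := by
  induction n generalizing t with
  | zero =>
    have : Φ t ∈ (⊥ : Submodule k (𝕋 V)) := map_mem_of_TF (F := Φ) (by
      intro m hm s hs
      obtain rfl : m = 0 := by omega
      rw [hs.eq_one.1, h1]; exact zero_mem _) ht
    simpa using this
  | succ n ih =>
    rw [pow_succ, Module.End.mul_apply]
    apply ih
    refine map_mem_of_TF (F := Φ) ?_ ht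
    intro m hm s hs
    rcases m with _ | m
    · rw [hs.eq_one.1, h1]; exact zero_mem _
    · exact TF_mono (by omega) _ (hΦ _ _ _ hs)

theorem exists_pow_eq_zero (hgr : ⨆ p, gr p = ⊤) {Φ : Module.End k (𝕋 V)} (h1 : Φ 1 = 0)
    (hΦ : ∀ n q t, HWord gr (n + 1) q t → Φ t ∈ TF gr n q) (t : 𝕋 V) : ∃ n, (Φ ^ n) t = 0 := by
  have ht : t ∈ ⨆ i : ℕ × ℤ, TF gr i.1 i.2 := iSup_TF hgr ▸ Submodule.mem_top
  induction ht using Submodule.iSup_induction' with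
  | mem i t ht => exact ⟨_, pow_mem_bot h1 hΦ ht⟩
  | zero => exact ⟨0, by simp⟩
  | add u v _ _ hu hv =>
    obtain ⟨a, ha⟩ := hu
    obtain ⟨b, hb⟩ := hv
    refine ⟨a + b, ?_⟩
    rw [map_add]
    conv_lhs => congr; rw [add_comm]
    rw [pow_add, Module.End.mul_apply, ha, pow_add, Module.End.mul_apply, hb]
    simp

theorem exists_inverse (hgr : ⨆ p, gr p = ⊤) {Φ : Module.End k (𝕋 V)} (h1 : Φ 1 = 0)
    (hΦ : ∀ n q t, HWord gr (n + 1) q t → Φ t ∈ TF gr n q) :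
    ∃ R : 𝕋 V →ₗ[k] 𝕋 V, (LinearMap.id - Φ) ∘ₗ R = LinearMap.id ∧
      R ∘ₗ (LinearMap.id - Φ) = LinearMap.id ∧ Op gr gr 0 R := by
  have hnil := exists_pow_eq_zero hgr h1 hΦ
  have hinj : Function.Injective (LinearMap.id - Φ : 𝕋 V →ₗ[k] 𝕋 V) := by
    rw [← LinearMap.ker_eq_bot, eq_bot_iff]
    intro t ht
    have h2 : Φ t = t := by
      have := LinearMap.mem_ker.1 ht
      exact (sub_eq_zero.1 this).symm
    obtain ⟨n, hn⟩ := hnil t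
    have h3 : ∀ n, (Φ ^ n) t = t := by
      intro n
      induction n with
      | zero => simp
      | succ n ih => rw [pow_succ, Module.End.mul_apply, h2, ih]
    rw [h3] at hn
    simpa using hn
  have hgeom : ∀ n t, (Φ ^ n) t = 0 →
      (LinearMap.id - Φ : 𝕋 V →ₗ[k] 𝕋 V) ((∑ i ∈ Finset.range n, Φ ^ i) t) = t := by
    intro n t hn
    have := LinearMap.congr_fun (mul_neg_geom_sum Φ n) t
    rwa [LinearMap.sub_apply, hn, sub_zero] at this
  have hsurj : Function.Surjective (LinearMap.id - Φ : 𝕋 V →ₗ[k] 𝕋 V) := by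
    intro t
    obtain ⟨n, hn⟩ := hnil t
    exact ⟨_, hgeom n t hn⟩
  let E := LinearEquiv.ofBijective (LinearMap.id - Φ : 𝕋 V →ₗ[k] 𝕋 V) ⟨hinj, hsurj⟩
  refine ⟨E.symm.toLinearMap, ?_, ?_, ?_⟩
  · ext1 t; exact E.apply_symm_apply t
  · ext1 t; exact E.symm_apply_apply t
  · intro n q t ht
    have h2 : E.symm t = (∑ i ∈ Finset.range (n + 1), Φ ^ i) t := by
      rw [LinearEquiv.symm_apply_eq]
      exact (hgeom (n + 1) t (pow_mem_bot h1 hΦ ht.mem)).symm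
    have h3 : ∀ i, (Φ ^ i) t ∈ TF gr n q := by
      intro i
      induction i with
      | zero => simpa using ht.mem
      | succ i ih =>
        rw [pow_succ', Module.End.mul_apply]
        refine map_mem_of_TF (F := Φ) ?_ ih
        intro m hm s hs
        rcases m with _ | m
        · rw [hs.eq_one.1, h1]; exact zero_mem _
        · exact TF_mono (by omega) _ (hΦ _ _ _ hs)
    rw [add_zero, LinearEquiv.coe_coe, h2, LinearMap.sum_apply]
    exact Submodule.sum_mem _ fun i _ => h3 i

end Words

/-! ### Graded linear algebra -/

section Graded

variable {V N : Type} [AddCommGroup V] [Module k V] [AddCommGroup N] [Module k N]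
  {gr : ℤ → Submodule k V}

/-- The linear map which is prescribed on the homogeneous components. -/
noncomputable def glue (hgr : DirectSum.IsInternal gr) (F : ∀ p, gr p →ₗ[k] N) : V →ₗ[k] N :=
  DirectSum.toModule k ℤ N F ∘ₗ
    (LinearEquiv.ofBijective (DirectSum.coeLinearMap gr) hgr).symm.toLinearMap

theorem glue_apply (hgr : DirectSum.IsInternal gr) (F : ∀ p, gr p →ₗ[k] N) {p : ℤ} {x : V}
    (hx : x ∈ gr p) : glue hgr F x = F p ⟨x, hx⟩ := by
  have : (LinearEquiv.ofBijective (DirectSum.coeLinearMap gr) hgr).symm x =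
      DirectSum.lof k ℤ (fun p => gr p) p ⟨x, hx⟩ := by
    rw [LinearEquiv.symm_apply_eq]
    exact (DirectSum.coeLinearMap_lof gr p ⟨x, hx⟩).symm
  rw [glue, LinearMap.comp_apply, LinearEquiv.coe_coe, this, DirectSum.toModule_lof]

theorem ext_gr (hgr : ⨆ p, gr p = ⊤) {f g : V →ₗ[k] N} (h : ∀ p, ∀ x ∈ gr p, f x = g x) :
    f = g := by
  ext1 x
  have hx : x ∈ ⨆ p, gr p := hgr ▸ Submodule.mem_top
  induction hx using Submodule.iSup_induction' with
  | mem p x hx => exact h p x hx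
  | zero => simp
  | add u v _ _ hu hv => simp [hu, hv]

/-- The sign operator of a grading. -/
noncomputable def sgn (hgr : DirectSum.IsInternal gr) : V →ₗ[k] V :=
  glue hgr fun p => ((-1 : k) ^ p) • (gr p).subtype

theorem sgn_apply (hgr : DirectSum.IsInternal gr) {p : ℤ} {x : V} (hx : x ∈ gr p) :
    sgn hgr x = ((-1 : k) ^ p) • x := by
  rw [sgn, glue_apply hgr _ hx]; rfl

theorem iSup_of_internal (hgr : DirectSum.IsInternal gr) : ⨆ p, gr p = ⊤ :=
  hgr.submodule_iSup_eq_top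

theorem neg_one_zpow_mul_self (p : ℤ) : (-1 : k) ^ p * (-1) ^ p = 1 := by
  rw [← mul_zpow]; simp

theorem sgn_mem (hgr : DirectSum.IsInternal gr) (p : ℤ) (x : V) (hx : x ∈ gr p) :
    sgn hgr x ∈ gr p := by
  rw [sgn_apply hgr hx]; exact Submodule.smul_mem _ _ hx

theorem sgn_sgn (hgr : DirectSum.IsInternal gr) (x : V) : sgn hgr (sgn hgr x) = x := by
  have : sgn hgr ∘ₗ sgn hgr = LinearMap.id := by
    apply ext_gr (iSup_of_internal hgr)
    intro p x hx
    rw [LinearMap.comp_apply, sgn_apply hgr hx, map_smul, sgn_apply hgr hx, smul_smul,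
      neg_one_zpow_mul_self, one_smul]; rfl
  exact LinearMap.congr_fun this x

/-- The projection to a homogeneous component. -/
noncomputable def proj (hgr : DirectSum.IsInternal gr) (q : ℤ) : V →ₗ[k] V :=
  glue hgr fun p => if p = q then (gr p).subtype else 0

theorem proj_of_mem (hgr : DirectSum.IsInternal gr) {p : ℤ} {x : V} (hx : x ∈ gr p) :
    proj hgr p x = x := by
  rw [proj, glue_apply hgr _ hx]; simp

theorem proj_of_ne (hgr : DirectSum.IsInternal gr) {p q : ℤ} (h : p ≠ q) {x : V} (hx : x ∈ gr p) :
    proj hgr q x = 0 := by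
  rw [proj, glue_apply hgr _ hx]; simp [h]

theorem proj_mem (hgr : DirectSum.IsInternal gr) (q : ℤ) (x : V) : proj hgr q x ∈ gr q := by
  have hx : x ∈ ⨆ p, gr p := iSup_of_internal hgr ▸ Submodule.mem_top
  induction hx using Submodule.iSup_induction' with
  | mem p x hx =>
    by_cases h : p = q
    · subst h; rwa [proj_of_mem hgr hx]
    · rw [proj_of_ne hgr h hx]; exact zero_mem _
  | zero => simp
  | add u v _ _ hu hv => rw [map_add]; exact add_mem hu hv

theorem proj_comm (hgr : DirectSum.IsInternal gr) {d : V →ₗ[k] V} {r : ℤ}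
    (hd : ∀ p, ∀ x ∈ gr p, d x ∈ gr (p + r)) (q : ℤ) (x : V) :
    d (proj hgr q x) = proj hgr (q + r) (d x) := by
  have : d ∘ₗ proj hgr q = proj hgr (q + r) ∘ₗ d := by
    apply ext_gr (iSup_of_internal hgr)
    intro p x hx
    by_cases h : p = q
    · subst h
      simp [proj_of_mem hgr hx, proj_of_mem hgr (hd _ _ hx)]
    · have h' : p + r ≠ q + r := by omega
      simp [proj_of_ne hgr h hx, proj_of_ne hgr h' (hd _ _ hx)]
  exact LinearMap.congr_fun this x

theorem sgn_comm {V' : Type} [AddCommGroup V'] [Module k V'] {gr' : ℤ → Submodule k V'}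
    (hgr : DirectSum.IsInternal gr) (hgr' : DirectSum.IsInternal gr') {f : V →ₗ[k] V'}
    {r : ℤ} (hf : ∀ p, ∀ x ∈ gr p, f x ∈ gr' (p + r)) (x : V) :
    sgn hgr' (f x) = (-1 : k) ^ r • f (sgn hgr x) := by
  have : sgn hgr' ∘ₗ f = (-1 : k) ^ r • (f ∘ₗ sgn hgr) := by
    apply ext_gr (iSup_of_internal hgr)
    intro p x hx
    have h0 : (-1 : k) ≠ 0 := by simp
    simp [sgn_apply hgr hx, sgn_apply hgr' (hf _ _ hx), zpow_add₀ h0, smul_smul, mul_comm]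
  exact LinearMap.congr_fun this x

theorem exists_ungraded_splitting (d : V →ₗ[k] V) (u : V) (hu : u = 0 ∨ u ∉ LinearMap.range d) :
    ∃ g : V →ₗ[k] V, (∀ x, d (g (d x)) = d x) ∧ g u = 0 := by
  obtain ⟨s, hs⟩ := d.rangeRestrict.exists_rightInverse_of_surjective d.range_rangeRestrict
  obtain ⟨g, hg⟩ := s.exists_extend
  have hgd : ∀ x, d (g (d x)) = d x := by
    intro x
    have h1 : g (d x) = s (d.rangeRestrict x) := LinearMap.congr_fun hg (d.rangeRestrict x)
    have h2 := LinearMap.congr_fun hs (d.rangeRestrict x)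
    rw [h1]
    exact congrArg Subtype.val h2
  rcases hu with rfl | hu
  · exact ⟨g, hgd, map_zero g⟩
  · obtain ⟨l, hl, hle⟩ := Submodule.exists_le_ker_of_notMem hu
    refine ⟨g - (l u)⁻¹ • l.smulRight (g u), ?_, ?_⟩
    · intro x
      have : l (d x) = 0 := hle ⟨x, rfl⟩
      simp [this, hgd]
    · simp [smul_smul, hl]

/-- Contractions of a complex of vector spaces onto its homology, compatible with a given cycle. -/
theorem exists_splitting (hgr : DirectSum.IsInternal gr) {d : V →ₗ[k] V}
    (hd : ∀ p, ∀ x ∈ gr p, d x ∈ gr (p + 1)) (hdd : ∀ x, d (d x) = 0) {u : V} {q : ℤ}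
    (huq : u ∈ gr q) (hdu : d u = 0) (hu : u = 0 ∨ u ∉ LinearMap.range d) :
    ∃ h : V →ₗ[k] V, (∀ p, ∀ x ∈ gr p, h x ∈ gr (p + -1)) ∧ (∀ x, d (h (d x)) = d x) ∧
      (∀ x, h (d (h x)) = h x) ∧ (∀ x, h (h x) = 0) ∧ h u = 0 := by
  obtain ⟨g, hg, hgu⟩ := exists_ungraded_splitting d u hu
  let h₀ : V →ₗ[k] V := glue hgr fun p => proj hgr (p + -1) ∘ₗ g ∘ₗ (gr p).subtype
  have h₀_apply : ∀ {p x}, x ∈ gr p → h₀ x = proj hgr (p + -1) (g x) := fun hx =>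
    glue_apply hgr _ hx
  have h₀_deg : ∀ p, ∀ x ∈ gr p, h₀ x ∈ gr (p + -1) := by
    intro p x hx
    rw [h₀_apply hx]; exact proj_mem hgr _ _
  have h₀_d : ∀ x, d (h₀ (d x)) = d x := by
    intro x
    have : d ∘ₗ h₀ ∘ₗ d = d := by
      apply ext_gr (iSup_of_internal hgr)
      intro p x hx
      have h1 := hd p x hx
      rw [LinearMap.comp_apply, LinearMap.comp_apply, h₀_apply h1, proj_comm hgr hd, hg,
        neg_add_cancel_right, proj_of_mem hgr h1]
    exact LinearMap.congr_fun this x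
  have h₀_u : h₀ u = 0 := by rw [h₀_apply huq, hgu, map_zero]
  let h₁ := h₀ ∘ₗ d ∘ₗ h₀
  have h₁_d : ∀ x, d (h₁ (d x)) = d x := by intro x; simp [h₁, h₀_d]
  have h₁_h : ∀ x, h₁ (d (h₁ x)) = h₁ x := by intro x; simp [h₁, h₀_d]
  have h₁_u : h₁ u = 0 := by simp [h₁, h₀_u]
  have h₁_deg : ∀ p, ∀ x ∈ gr p, h₁ x ∈ gr (p + -1) := by
    intro p x hx
    have := h₀_deg _ _ (hd _ _ (h₀_deg p x hx))
    rwa [neg_add_cancel_right] at this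
  refine ⟨h₁ - h₁ ∘ₗ h₁ ∘ₗ d, ?_, ?_, ?_, ?_, ?_⟩
  · intro p x hx
    refine sub_mem (h₁_deg p x hx) ?_
    have := h₁_deg _ _ (h₁_deg _ _ (hd _ _ hx))
    rwa [add_neg_cancel_right] at this
  · intro x; simp [hdd, h₁_d]
  · intro x; simp [hdd, h₁_h]
  · intro x
    simp [h₁_h]
  · simp [h₁_u, hdu]

/-- A chain map which maps cycles to boundaries is homotopic to zero. -/
theorem exists_null_homotopy (hgr : DirectSum.IsInternal gr) {d : V →ₗ[k] V}
    (hd : ∀ p, ∀ x ∈ gr p, d x ∈ gr (p + 1)) (hdd : ∀ x, d (d x) = 0) {c : V →ₗ[k] V}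
    (hc : ∀ p, ∀ x ∈ gr p, c x ∈ gr p) (hcd : ∀ x, d (c x) = c (d x))
    (h0 : ∀ p, ∀ x ∈ gr p, d x = 0 → ∃ z, c x = d z) :
    ∃ s : V →ₗ[k] V, (∀ p, ∀ x ∈ gr p, s x ∈ gr (p + -1)) ∧ ∀ x, c x = d (s x) + s (d x) := by
  obtain ⟨h, h_deg, hdhd, hhdh, hhh, -⟩ :=
    exists_splitting hgr hd hdd (zero_mem (gr 0)) (map_zero d) (Or.inl rfl)
  let Q : V →ₗ[k] V := LinearMap.id - d ∘ₗ h - h ∘ₗ d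
  have Q_deg : ∀ p, ∀ x ∈ gr p, Q x ∈ gr p := by
    intro p x hx
    have e1 := hd _ _ (h_deg _ _ hx)
    have e2 := h_deg _ _ (hd _ _ hx)
    rw [neg_add_cancel_right] at e1
    rw [add_neg_cancel_right] at e2
    exact sub_mem (sub_mem hx e1) e2
  have hdQ : ∀ x, d (Q x) = 0 := by intro x; simp [Q, hdd, hdhd]
  have hQd : ∀ x, Q (d x) = 0 := by intro x; simp [Q, hdd, hdhd]
  have key : d ∘ₗ h ∘ₗ c ∘ₗ Q = c ∘ₗ Q := by
    apply ext_gr (iSup_of_internal hgr)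
    intro p x hx
    obtain ⟨z, hz⟩ := h0 p (Q x) (Q_deg p x hx) (hdQ x)
    simp [hz, hdhd]
  refine ⟨h ∘ₗ c ∘ₗ Q + c ∘ₗ h, ?_, ?_⟩
  · intro p x hx
    exact add_mem (h_deg _ _ (hc _ _ (Q_deg _ _ hx))) (hc _ _ (h_deg _ _ hx))
  · intro x
    have := LinearMap.congr_fun key x
    simp only [LinearMap.comp_apply] at this
    simp only [LinearMap.add_apply, LinearMap.comp_apply, map_add, hQd, map_zero, zero_add, hcd,
      this]
    rw [← map_add, ← map_add]
    congr 1
    simp [Q]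
    abel

/-- Submodules spanned by homogeneous elements inherit the grading. -/
theorem internal_comap {J : Submodule k V} (hind : iSupIndep gr) (hJ : J ≤ ⨆ p, J ⊓ gr p) :
    DirectSum.IsInternal fun p => (gr p).comap J.subtype := by
  rw [DirectSum.isInternal_submodule_iff_iSupIndep_and_iSup_eq_top]
  constructor
  · rw [iSupIndep_def] at hind ⊢
    intro p
    rw [Submodule.disjoint_def]
    intro x hx hx'
    have h1 : (x : V) ∈ ⨆ q, ⨆ (_ : q ≠ p), gr q := by
      have : Submodule.map J.subtype (⨆ q, ⨆ (_ : q ≠ p), (gr q).comap J.subtype) ≤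
          ⨆ q, ⨆ (_ : q ≠ p), gr q := by
        simp only [Submodule.map_iSup]
        exact iSup_mono fun q => iSup_mono fun _ => Submodule.map_comap_le _ _
      exact this ⟨x, hx', rfl⟩
    have h2 := (Submodule.disjoint_def.1 (hind p)) (x : V) hx h1
    exact Subtype.ext h2
  · rw [eq_top_iff]
    rintro ⟨x, hx⟩ -
    have h1 : (⨆ p, J ⊓ gr p) ≤ Submodule.map J.subtype (⨆ p, (gr p).comap J.subtype) := by
      rw [Submodule.map_iSup]
      refine iSup_mono fun p y hy => ⟨⟨y, hy.1⟩, hy.2, rfl⟩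
    obtain ⟨y, hy, hyx⟩ := h1 (hJ hx)
    have : y = ⟨x, hx⟩ := Subtype.ext hyx
    rwa [← this]

end Graded

/-! ### Strict units and homotopy transfer -/

namespace CoA

variable {W : Type} [AddCommGroup W] [Module k W]

/-- A strict unit, in coalgebraic form. -/
structure StrictUnit (A : CoA k W) (u : W) : Prop where
  sg : A.sg u = -u
  b : ∀ s t, A.b (s * (τ u * t)) =
    aug W s • letter k W t - aug W t • A.sg (letter k W s)

variable {A : CoA k W}

theorem StrictUnit.b_letter {u : W} (hu : A.StrictUnit u) : A.b (τ u) = 0 := by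
  have := hu.b 1 1
  simpa [letter_one] using this

theorem com_aug_smul (v : W) :
    com ((aug W).toLinearMap.smulRight v : 𝕋 W →ₗ[k] W) = 0 := by
  have : ((aug W).toLinearMap.smulRight v : 𝕋 W →ₗ[k] W) ∘ₗ pplus k W = 0 := by
    ext t
    simp [pplus, uaug_apply]
  rw [← com_comp_pplus, this, com_zero]

theorem StrictUnit.D_mul {u : W} (hu : A.StrictUnit u) (s t : 𝕋 W) :
    A.D (s * (τ u * t)) = A.D s * (τ u * t) + aug W s • t - aug W t • A.S s -
      A.S s * (τ u * A.D t) := by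
  induction s using tensor_induction with
  | one =>
    have h1 : lsh A.b u = letter k W := by
      ext t
      have := hu.b 1 t
      simpa [letter_one, lsh_apply] using this
    rw [one_mul, D_cons, com_cons, h1, com_letter, hu.b_letter, hu.sg]
    simp [D_one, S_one, pplus, uaug_apply, Algebra.algebraMap_eq_smul_one]
    abel
  | cons x s ih =>
    have h1 : A.b (τ x * s * τ u) = -(aug W s • A.sg x) := by
      have := hu.b (τ x * s) 1
      simpa [letter_one, letter_cons] using this
    have h2 : lsh (A.b ∘ₗ LinearMap.mulLeft k (τ x * s)) u =
        (aug W).toLinearMap.smulRight (-(aug W s • A.sg x)) := by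
      ext t
      have := hu.b (τ x * s) t
      simp only [aug_cons, zero_smul, letter_cons] at this
      rw [lsh_apply, LinearMap.comp_apply, LinearMap.mulLeft_apply, this]
      simp
    rw [mul_assoc, D_cons, ← mul_assoc, com_cons_mul, com_cons _ u t, h2, com_aug_smul, ih, D_cons, S_mul,
      S_letter]
    simp only [LinearMap.comp_apply, LinearMap.mulLeft_apply, h1, aug_cons]
    simp [mul_add, mul_sub, add_mul, mul_assoc]
    abel
  | add a b ha hb => simp only [add_mul, map_add, ha, hb, add_smul, smul_add]; abel
  | smul r a ha =>
    simp only [smul_mul_assoc, map_smul, ha, smul_sub, smul_add, smul_assoc]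
    rw [smul_comm r (aug W t)]

/-- A contraction of the complex underlying an A∞-algebra. -/
structure Contraction (A : CoA k W) (H : Type) [AddCommGroup H] [Module k H] where
  sg : H →ₗ[k] H
  pr : W →ₗ[k] H
  inc : H →ₗ[k] W
  h : W →ₗ[k] W
  pr_inc : ∀ x, pr (inc x) = x
  htpy : ∀ x, A.b (τ (h x)) + h (A.b (τ x)) = x - inc (pr x)
  b_inc : ∀ x, A.b (τ (inc x)) = 0
  pr_b : ∀ x, pr (A.b (τ x)) = 0
  h_h : ∀ x, h (h x) = 0
  h_inc : ∀ x, h (inc x) = 0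
  pr_h : ∀ x, pr (h x) = 0
  pr_sg : ∀ x, pr (A.sg x) = sg (pr x)
  sg_inc : ∀ x, A.sg (inc x) = inc (sg x)
  sg_h : ∀ x, A.sg (h x) = -h (A.sg x)

namespace Contraction

variable {H : Type} [AddCommGroup H] [Module k H] (C : Contraction A H)

/-- The projection to the image of the contraction, on tensors. -/
noncomputable def Q : 𝕋 W →ₗ[k] 𝕋 W := tmap (C.inc ∘ₗ C.pr)

/-- The homotopy on tensors. -/
noncomputable def hT : 𝕋 W →ₗ[k] 𝕋 W := coder (C.h ∘ₗ letter k W) C.Q A.sg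

variable (A) in
/-- The linear part of the codifferential. -/
noncomputable def dT : 𝕋 W →ₗ[k] 𝕋 W :=
  coder (A.b ∘ₗ τ ∘ₗ letter k W) LinearMap.id A.sg

variable (A) in
/-- The operations of arity at least two. -/
noncomputable def bhigh : 𝕋 W →ₗ[k] W := A.b - A.b ∘ₗ τ ∘ₗ letter k W

variable (A) in
/-- The nonlinear part of the codifferential. -/
noncomputable def delta : 𝕋 W →ₗ[k] 𝕋 W := coder (bhigh A) LinearMap.id A.sg

theorem dT_add_delta : dT A + delta A = A.D := by
  have h1 : ∀ a c : 𝕋 W →ₗ[k] W, coder a LinearMap.id A.sg + coder c LinearMap.id A.sg =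
      coder (a + c) LinearMap.id A.sg := by
    intro a c
    simp [coder, pconv, conv, LinearMap.comp_add, LinearMap.add_comp]
  rw [dT, delta, h1, bhigh, add_sub_cancel]; rfl

theorem coder_letter_cons (a : W →ₗ[k] W) {q : 𝕋 W →ₗ[k] 𝕋 W} (σ : W →ₗ[k] W)
    (x : W) (t : 𝕋 W) : coder (a ∘ₗ letter k W) q σ (τ x * t) =
      τ (a x) * q t + τ (σ x) * coder (a ∘ₗ letter k W) q σ t := by
  have h1 : lsh (τ ∘ₗ a ∘ₗ letter k W) x =
      LinearMap.mulLeft k (τ (a x)) ∘ₗ uaug k W (𝕋 W) := by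
    ext t
    simp [lsh_apply, letter_cons, uaug_apply, Algebra.algebraMap_eq_smul_one]
  rw [coder_cons, pconv_cons, h1, mul_conv, uaug_conv]

theorem hT_one : C.hT 1 = 0 := coder_one _ _ _

theorem hT_cons (x : W) (t : 𝕋 W) : C.hT (τ x * t) = τ (C.h x) * C.Q t + τ (A.sg x) * C.hT t :=
  coder_letter_cons _ _ _ _

theorem dT_one : dT A 1 = 0 := coder_one _ _ _

theorem dT_cons (x : W) (t : 𝕋 W) :
    dT A (τ x * t) = τ (A.b (τ x)) * t + τ (A.sg x) * dT A t := by
  have := coder_letter_cons (A.b ∘ₗ τ) (q := LinearMap.id) A.sg x t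
  rwa [LinearMap.comp_assoc] at this

theorem Q_one : C.Q 1 = 1 := tmap_one _

theorem Q_cons (x : W) (t : 𝕋 W) : C.Q (τ x * t) = τ (C.inc (C.pr x)) * C.Q t := tmap_cons _ _ _

theorem Q_eq : C.Q = tmap C.inc ∘ₗ tmap C.pr := (tmap_comp _ _).symm

theorem hT_Q (t : 𝕋 W) : C.hT (C.Q t) = 0 := by
  have : C.hT ∘ₗ C.Q = 0 := by
    apply tensor_ext
    · simp [Q_one, hT_one]
    · intro x t ih
      simp only [LinearMap.comp_apply, LinearMap.zero_apply] at ih ⊢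
      simp [Q_cons, hT_cons, ih, C.h_inc]
  exact LinearMap.congr_fun this t

theorem Q_hT (t : 𝕋 W) : C.Q (C.hT t) = 0 := by
  have : C.Q ∘ₗ C.hT = 0 := by
    apply tensor_ext
    · simp [hT_one]
    · intro x t ih
      simp only [LinearMap.comp_apply, LinearMap.zero_apply] at ih ⊢
      simp [Q_cons, hT_cons, ih, C.pr_h]
  exact LinearMap.congr_fun this t

theorem hT_hT (t : 𝕋 W) : C.hT (C.hT t) = 0 := by
  have : C.hT ∘ₗ C.hT = 0 := by
    apply tensor_ext
    · simp [hT_one]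
    · intro x t ih
      simp only [LinearMap.comp_apply, LinearMap.zero_apply] at ih ⊢
      simp [hT_cons, ih, C.h_h, hT_Q, Q_hT]
  exact LinearMap.congr_fun this t

theorem dT_inc (t : 𝕋 H) : dT A (tmap C.inc t) = 0 := by
  have : dT A ∘ₗ tmap C.inc = 0 := by
    apply tensor_ext
    · simp [tmap_one, dT_one]
    · intro x t ih
      simp only [LinearMap.comp_apply, LinearMap.zero_apply] at ih ⊢
      simp [tmap_cons, dT_cons, ih, C.b_inc]
  exact LinearMap.congr_fun this t

theorem dT_Q (t : 𝕋 W) : dT A (C.Q t) = 0 := by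
  rw [Q_eq]; exact C.dT_inc _

theorem Q_dT (t : 𝕋 W) : C.Q (dT A t) = 0 := by
  have : C.Q ∘ₗ dT A = 0 := by
    apply tensor_ext
    · simp [dT_one]
    · intro x t ih
      simp only [LinearMap.comp_apply, LinearMap.zero_apply] at ih ⊢
      simp [Q_cons, dT_cons, ih, C.pr_b]
  exact LinearMap.congr_fun this t

theorem htpy_T (t : 𝕋 W) : dT A (C.hT t) + C.hT (dT A t) = t - C.Q t := by
  have : dT A ∘ₗ C.hT + C.hT ∘ₗ dT A = LinearMap.id - C.Q := by
    apply tensor_ext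
    · simp [dT_one, hT_one, Q_one]
    · intro x t ih
      simp only [LinearMap.comp_apply, LinearMap.add_apply, LinearMap.sub_apply,
        LinearMap.id_apply] at ih ⊢
      have e1 : C.hT (dT A t) = t - C.Q t - dT A (C.hT t) := by rw [← ih]; abel
      have e2 : C.h (A.b (τ x)) = x - C.inc (C.pr x) - A.b (τ (C.h x)) := by rw [← C.htpy]; abel
      simp [dT_cons, hT_cons, Q_cons, A.sg_sg, C.sg_h, dT_Q, Q_dT, e1, e2, b_letter_sg, sub_mul,
        mul_sub]
      abel
  exact LinearMap.congr_fun this t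

theorem S_dT (t : 𝕋 W) : A.S (dT A t) = -dT A (A.S t) := by
  have : A.S ∘ₗ dT A = -(dT A ∘ₗ A.S) := by
    apply tensor_ext
    · simp [dT_one, S_one]
    · intro x t ih
      simp only [LinearMap.comp_apply, LinearMap.neg_apply] at ih ⊢
      simp [dT_cons, S_mul, S_letter, ih, b_letter_sg]
      abel
  exact LinearMap.congr_fun this t

theorem S_delta (t : 𝕋 W) : A.S (delta A t) = -delta A (A.S t) := by
  have h1 : ∀ t, delta A t = A.D t - dT A t := by intro t; rw [← dT_add_delta]; simp
  simp [h1, S_D, S_dT]; abel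

theorem S_Q (t : 𝕋 W) : A.S (C.Q t) = C.Q (A.S t) := by
  have h1 : A.sg ∘ₗ C.inc ∘ₗ C.pr = (C.inc ∘ₗ C.pr) ∘ₗ A.sg := by
    ext x; simp [C.pr_sg, C.sg_inc]
  have : A.S ∘ₗ C.Q = C.Q ∘ₗ A.S := by rw [S, Q, tmap_comp, tmap_comp, h1]
  exact LinearMap.congr_fun this t

theorem S_hT (t : 𝕋 W) : A.S (C.hT t) = -C.hT (A.S t) := by
  have : A.S ∘ₗ C.hT = -(C.hT ∘ₗ A.S) := by
    apply tensor_ext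
    · simp [hT_one, S_one]
    · intro x t ih
      simp only [LinearMap.comp_apply, LinearMap.neg_apply] at ih ⊢
      simp [hT_cons, S_mul, S_letter, ih, C.sg_h, S_Q]
      abel
  exact LinearMap.congr_fun this t

theorem letter_hT : letter k W ∘ₗ C.hT = C.h ∘ₗ letter k W := by
  have h1 : (C.h ∘ₗ letter k W) 1 = 0 := by simp [letter_one]
  rw [← comp_pplus h1]
  exact letter_coder _ (isCoalg_tmap _) _

end Contraction

end CoA

theorem letter_cog {V V' : Type} [AddCommGroup V] [Module k V] [AddCommGroup V'] [Module k V']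
    {f : 𝕋 V →ₗ[k] V'} (hf : f 1 = 0) (t : 𝕋 V) : letter k V' (cog f t) = f t := by
  have h1 := LinearMap.congr_fun (letter_pconv (isCoalg_cog f) f) t
  rw [comp_pplus hf] at h1
  simp only [LinearMap.comp_apply] at h1
  conv_lhs => rw [cog_eq f]
  rw [LinearMap.add_apply, map_add, h1, uaug_apply, Algebra.algebraMap_eq_smul_one, map_smul,
    letter_one, smul_zero, zero_add]

theorem cog_letter {V : Type} [AddCommGroup V] [Module k V] :
    cog (letter k V) = LinearMap.id := by
  refine (cog_unique ?_).symm
  have : pconv (τ ∘ₗ letter k V) LinearMap.id = pplus k V := com_letter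
  rw [this, pplus, add_sub_cancel]

theorem cog_comp_coalg {V V' V'' : Type} [AddCommGroup V] [Module k V] [AddCommGroup V']
    [Module k V'] [AddCommGroup V''] [Module k V''] {q : 𝕋 V →ₗ[k] 𝕋 V'} (hq : IsCoalg q)
    (f : 𝕋 V' →ₗ[k] V'') : cog f ∘ₗ q = cog (f ∘ₗ q) := by
  apply cog_unique
  conv_lhs => rw [cog_eq f]
  rw [LinearMap.add_comp, hq.uaug, hq.pconv]
  rfl

theorem cog_comp_letter {V V' : Type} [AddCommGroup V] [Module k V] [AddCommGroup V']
    [Module k V'] (q : V →ₗ[k] V') : cog (q ∘ₗ letter k V) = tmap q := by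
  have h1 : q ∘ₗ letter k V = letter k V' ∘ₗ tmap q := by
    apply tensor_ext
    · simp [tmap_one, letter_one]
    · intro x t _
      simp [tmap_cons, letter_cons, (isCoalg_tmap q).aug]
  rw [h1, ← cog_comp_coalg (isCoalg_tmap q), cog_letter, LinearMap.id_comp]

namespace CoA

namespace Contraction

variable {W H : Type} [AddCommGroup W] [Module k W] [AddCommGroup H] [Module k H] {A : CoA k W}


/-- The defining equation of the transferred morphism. -/
def IsTransfer (C : Contraction A H) (f : 𝕋 W →ₗ[k] H) : Prop :=
  ∀ t, f t + f (delta A (C.hT t)) = C.pr (letter k W t)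

variable {C : Contraction A H} {f : TensorAlgebra k W →ₗ[k] H}
  {R : TensorAlgebra k W →ₗ[k] TensorAlgebra k W}

theorem IsTransfer.f_one (hf : C.IsTransfer f) : f 1 = 0 := by
  have := hf 1
  simpa [hT_one, letter_one] using this

theorem IsTransfer.f_hT (hf : C.IsTransfer f) (t : 𝕋 W) : f (C.hT t) = 0 := by
  have := hf (C.hT t)
  have h1 := LinearMap.congr_fun C.letter_hT t
  simp only [LinearMap.comp_apply] at h1
  simpa [hT_hT, h1, C.pr_h] using this

theorem IsTransfer.f_inc (hf : C.IsTransfer f) (t : 𝕋 H) : f (tmap C.inc t) = letter k H t := by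
  have h1 : C.hT (tmap C.inc t) = 0 := by
    have : tmap C.inc t = C.Q (tmap C.inc t) := by
      rw [Q_eq, ← LinearMap.comp_apply, LinearMap.comp_assoc, tmap_comp C.pr]
      have e : C.pr ∘ₗ C.inc = LinearMap.id := by ext x; exact C.pr_inc x
      rw [e, tmap_id]; rfl
    rw [this, hT_Q]
  have h2 : letter k W ∘ₗ tmap C.inc = C.inc ∘ₗ letter k H := by
    apply tensor_ext
    · simp [tmap_one, letter_one]
    · intro x t _
      simp [tmap_cons, letter_cons, (isCoalg_tmap C.inc).aug]
  have h3 := LinearMap.congr_fun h2 t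
  simp only [LinearMap.comp_apply] at h3
  have := hf (tmap C.inc t)
  simpa [h1, h3, C.pr_inc] using this

theorem IsTransfer.f_S (hf : C.IsTransfer f) (hR : ∀ t, R t + delta A (C.hT (R t)) = t) (t : 𝕋 W) :
    f (A.S t) = C.sg (f t) := by
  have key : ∀ t, f (A.S t) - C.sg (f t) +
      (f (A.S (delta A (C.hT t))) - C.sg (f (delta A (C.hT t)))) = 0 := by
    intro t
    have h1 := hf (A.S t)
    have h2 := congrArg C.sg (hf t)
    have h3 : C.hT (A.S t) = -A.S (C.hT t) := by rw [S_hT, neg_neg]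
    have h4 : delta A (A.S (C.hT t)) = -A.S (delta A (C.hT t)) := by rw [S_delta, neg_neg]
    have h5 : letter k W (A.S t) = A.sg (letter k W t) := by
      have : letter k W ∘ₗ A.S = A.sg ∘ₗ letter k W := by
        apply tensor_ext
        · simp [S_one, letter_one]
        · intro x t _
          simp [S_mul, S_letter, letter_cons, aug_S]
      exact LinearMap.congr_fun this t
    rw [h3, map_neg, h4, neg_neg, h5, C.pr_sg, ← h2, map_add] at h1
    rw [← sub_eq_zero] at h1
    rw [← h1]; abel
  have := key (R t)
  have h6 : delta A (C.hT (R t)) = t - R t := by rw [eq_sub_iff_add_eq, add_comm, hR]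
  rw [h6] at this
  simp only [map_sub] at this
  rw [← sub_eq_zero, ← this]; abel

theorem IsTransfer.cog_hT (hf : C.IsTransfer f) (t : 𝕋 W) : cog f (C.hT t) = 0 := by
  have h0 : (τ ∘ₗ f) ∘ₗ pplus k W ∘ₗ C.hT = 0 := by
    ext t
    have : pplus k W (C.hT t) = C.hT t := pplus_of_aug (by
      have h : (aug W).toLinearMap ∘ₗ C.hT = 0 := by
        apply tensor_ext
        · simp [hT_one]
        · intro x t _
          simp [hT_cons, aug_letter]
      exact LinearMap.congr_fun h t)
    simp [this, hf.f_hT]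
  have h1 : cog f ∘ₗ C.hT = 0 := by
    apply eq_zero_of_eq_pconv (φ := (τ ∘ₗ f) ∘ₗ A.S)
    conv_lhs => rw [cog_eq f]
    have h2 : pconv (τ ∘ₗ f) (cog f) ∘ₗ C.hT = conv ((τ ∘ₗ f) ∘ₗ pplus k W ∘ₗ C.hT) (cog f ∘ₗ C.Q) +
        pconv ((τ ∘ₗ f) ∘ₗ A.S) (cog f ∘ₗ C.hT) := pconv_coder (isCoalg_tmap _) _ _ _ _
    have h3 : uaug k W (𝕋 H) ∘ₗ C.hT = 0 := by
      apply tensor_ext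
      · simp [hT_one]
      · intro x t _
        simp [hT_cons, uaug_apply, aug_letter]
    rw [LinearMap.add_comp, h2, h0, h3]
    simp [conv]
  exact LinearMap.congr_fun h1 t

theorem IsTransfer.cog_inc (hf : C.IsTransfer f) (t : 𝕋 H) : cog f (tmap C.inc t) = t := by
  have h1 : f ∘ₗ tmap C.inc = letter k H := by ext t; exact hf.f_inc t
  have := cog_comp_coalg (isCoalg_tmap C.inc) f
  rw [h1, cog_letter] at this
  exact LinearMap.congr_fun this t

theorem IsTransfer.cog_Q (hf : C.IsTransfer f) (t : 𝕋 W) : cog f (C.Q t) = tmap C.pr t := by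
  rw [Q_eq]; exact hf.cog_inc _

theorem delta_one : delta A 1 = 0 := coder_one _ _ _

theorem aug_delta (t : 𝕋 W) : aug W (delta A t) = 0 := aug_coder _ _ _ t

end Contraction

end CoA

theorem uaug_coder {V : Type} [AddCommGroup V] [Module k V] {R : Type} [Ring R] [Algebra k R]
    (a : 𝕋 V →ₗ[k] V) (q : 𝕋 V →ₗ[k] 𝕋 V) (σ : V →ₗ[k] V) : uaug k V R ∘ₗ coder a q σ = 0 := by
  ext t
  simp [uaug_apply, aug_coder]

theorem pplus_coder {V : Type} [AddCommGroup V] [Module k V]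
    (a : 𝕋 V →ₗ[k] V) (q : 𝕋 V →ₗ[k] 𝕋 V) (σ : V →ₗ[k] V) :
    pplus k V ∘ₗ coder a q σ = coder a q σ := by
  ext t
  exact pplus_of_aug (aug_coder _ _ _ _)

/-- A recursive characterisation of coderivations along the identity. -/
theorem coder_eq {V : Type} [AddCommGroup V] [Module k V] (a : 𝕋 V →ₗ[k] V) (σ : V →ₗ[k] V) :
    coder a LinearMap.id σ =
      com a + pconv (τ ∘ₗ σ ∘ₗ letter k V) (coder a LinearMap.id σ) := by
  have h1 : ∀ x : V, lsh (τ ∘ₗ σ ∘ₗ letter k V) x =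
      LinearMap.mulLeft k (τ (σ x)) ∘ₗ uaug k V (𝕋 V) := by
    intro x
    ext t
    simp [lsh_apply, letter_cons, uaug_apply, Algebra.algebraMap_eq_smul_one]
  apply tensor_ext
  · rw [LinearMap.add_apply, coder_one, com_one, pconv_one, add_zero]
  · intro x t _
    rw [LinearMap.add_apply, pconv_cons, h1, mul_conv, uaug_conv, coder_cons]; rfl

theorem eq_coder {V : Type} [AddCommGroup V] [Module k V] {a : 𝕋 V →ₗ[k] V} {σ : V →ₗ[k] V}
    {E : 𝕋 V →ₗ[k] 𝕋 V} (h : E = com a + pconv (τ ∘ₗ σ ∘ₗ letter k V) E) :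
    E = coder a LinearMap.id σ := by
  rw [← sub_eq_zero]
  refine eq_zero_of_eq_pconv (φ := τ ∘ₗ σ ∘ₗ letter k V) ?_
  conv_lhs => rw [h, coder_eq, add_sub_add_left_eq_sub]
  simp [pconv, conv]

namespace CoA

namespace Contraction

variable {W H : Type} [AddCommGroup W] [Module k W] [AddCommGroup H] [Module k H] {A : CoA k W}

variable {C : Contraction A H} {f : TensorAlgebra k W →ₗ[k] H}
  {R : TensorAlgebra k W →ₗ[k] TensorAlgebra k W}

theorem cog_comp_delta (f : TensorAlgebra k W →ₗ[k] H) :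
    cog f ∘ₗ delta A = conv (τ ∘ₗ f ∘ₗ delta A) (cog f) +
      pconv (τ ∘ₗ f ∘ₗ A.S) (cog f ∘ₗ delta A) := by
  conv_lhs => rw [cog_eq f]
  have h := pconv_coder (isCoalg_id) (bhigh A) A.sg (τ ∘ₗ f) (cog f)
  rw [LinearMap.add_comp, delta, uaug_coder, zero_add, h, pplus_coder]
  rfl

theorem IsTransfer.cog_delta_hT (hf : C.IsTransfer f) (t : 𝕋 W) :
    cog f (delta A (C.hT t)) = tmap C.pr t - cog f t := by
  have h1 : cog f ∘ₗ delta A ∘ₗ C.hT = conv (τ ∘ₗ f ∘ₗ delta A ∘ₗ C.hT) (tmap C.pr) +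
      pconv (τ ∘ₗ f) (cog f ∘ₗ delta A ∘ₗ C.hT) := by
    conv_lhs => rw [← LinearMap.comp_assoc, cog_comp_delta, LinearMap.add_comp]
    have e1 : conv (τ ∘ₗ f ∘ₗ delta A) (cog f) ∘ₗ C.hT =
      conv ((τ ∘ₗ f ∘ₗ delta A) ∘ₗ C.hT) (cog f ∘ₗ C.Q) +
        conv ((τ ∘ₗ f ∘ₗ delta A) ∘ₗ A.S) (cog f ∘ₗ C.hT) := bconv_coder (isCoalg_tmap _) _ _ _ _ _
    have e2 : pconv (τ ∘ₗ f ∘ₗ A.S) (cog f ∘ₗ delta A) ∘ₗ C.hT =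
      conv ((τ ∘ₗ f ∘ₗ A.S) ∘ₗ pplus k W ∘ₗ C.hT) ((cog f ∘ₗ delta A) ∘ₗ C.Q) +
        pconv ((τ ∘ₗ f ∘ₗ A.S) ∘ₗ A.S) ((cog f ∘ₗ delta A) ∘ₗ C.hT) :=
      pconv_coder (isCoalg_tmap _) _ _ _ _
    have e3 : cog f ∘ₗ C.Q = tmap C.pr := by ext1 t; exact hf.cog_Q t
    have e4 : cog f ∘ₗ C.hT = 0 := by ext1 t; exact hf.cog_hT t
    have e5 : (τ ∘ₗ f ∘ₗ A.S) ∘ₗ A.S = τ ∘ₗ f := by ext1 t; simp [A.S_S]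
    have e6 : (τ ∘ₗ f ∘ₗ A.S) ∘ₗ pplus k W ∘ₗ C.hT = 0 := by
      rw [hT, pplus_coder]
      change (τ ∘ₗ f ∘ₗ A.S) ∘ₗ C.hT = 0
      ext1 t
      simp [S_hT, hf.f_hT]
    rw [e1, e2, e3, e4, e5, e6]
    simp [conv, LinearMap.comp_assoc]
  have h2 : f ∘ₗ delta A ∘ₗ C.hT = C.pr ∘ₗ letter k W - f := by
    ext1 t
    have := hf t
    simp only [LinearMap.comp_apply, LinearMap.sub_apply, ← this]
    abel
  have hP : tmap C.pr = uaug k W (𝕋 H) + conv (τ ∘ₗ C.pr ∘ₗ letter k W) (tmap C.pr) := by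
    conv_lhs => rw [← cog_comp_letter, cog_eq]
    rw [cog_comp_letter, pconv, comp_pplus]
    simp [letter_one]
  have hfp : ∀ g : 𝕋 W →ₗ[k] 𝕋 H, pconv (τ ∘ₗ f) g = conv (τ ∘ₗ f) g := by
    intro g
    rw [pconv, comp_pplus]
    simp [hf.f_one]
  have h3 : cog f - tmap C.pr + cog f ∘ₗ delta A ∘ₗ C.hT = 0 := by
    apply eq_zero_of_eq_pconv (φ := τ ∘ₗ f)
    have hG : cog f = uaug k W (𝕋 H) + conv (τ ∘ₗ f) (cog f) := by rw [← hfp, ← cog_eq]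
    rw [h2, hfp, LinearMap.comp_sub] at h1
    simp only [conv, map_sub, LinearMap.sub_apply] at h1 hG hP
    rw [hfp]
    simp only [conv, map_sub, map_add]
    linear_combination (norm := abel) hG - hP + h1
  have := LinearMap.congr_fun h3 t
  simp only [LinearMap.comp_apply, LinearMap.add_apply, LinearMap.sub_apply,
    LinearMap.zero_apply] at this
  rw [← sub_eq_zero, ← this]; abel

theorem S_inc (C : Contraction A H) (t : 𝕋 H) :
    A.S (tmap C.inc t) = tmap C.inc (tmap C.sg t) := by
  have h1 : A.sg ∘ₗ C.inc = C.inc ∘ₗ C.sg := by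
    ext x; simp [C.sg_inc]
  have : A.S ∘ₗ tmap C.inc = tmap C.inc ∘ₗ tmap C.sg := by rw [S, tmap_comp, tmap_comp, h1]
  exact LinearMap.congr_fun this t

theorem IsTransfer.cog_delta_inc (hf : C.IsTransfer f) (hS : ∀ t, f (A.S t) = C.sg (f t)) :
    cog f ∘ₗ delta A ∘ₗ tmap C.inc =
      coder (f ∘ₗ delta A ∘ₗ tmap C.inc) LinearMap.id C.sg := by
  apply eq_coder
  conv_lhs => rw [← LinearMap.comp_assoc, cog_comp_delta, LinearMap.add_comp]
  rw [(isCoalg_tmap C.inc).bconv, (isCoalg_tmap C.inc).pconv]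
  have e1 : cog f ∘ₗ tmap C.inc = LinearMap.id := by ext1 t; exact hf.cog_inc t
  have e2 : (τ ∘ₗ f ∘ₗ A.S) ∘ₗ tmap C.inc = τ ∘ₗ C.sg ∘ₗ letter k H := by
    ext1 t; simp [hS, hf.f_inc]
  have e3 : com (f ∘ₗ delta A ∘ₗ tmap C.inc) =
      conv (τ ∘ₗ f ∘ₗ delta A ∘ₗ tmap C.inc) LinearMap.id := by
    rw [com, pconv, comp_pplus]
    simp [tmap_one, delta_one]
  rw [e1, e2, e3]
  rfl

theorem IsTransfer.cog_D (hf : C.IsTransfer f) (hS : ∀ t, f (A.S t) = C.sg (f t))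
    (hR : ∀ t, R t + delta A (C.hT (R t)) = t) (t : 𝕋 W) :
    cog f (A.D t) = coder (f ∘ₗ delta A ∘ₗ tmap C.inc) LinearMap.id C.sg (cog f t) := by
  set D' := coder (f ∘ₗ delta A ∘ₗ tmap C.inc) LinearMap.id C.sg with hD'
  have hDi : ∀ t, D' t = cog f (delta A (tmap C.inc t)) := by
    intro t; rw [hD', ← hf.cog_delta_inc hS]; rfl
  have hD : ∀ t, A.D t = dT A t + delta A t := by intro t; rw [← dT_add_delta]; rfl
  have hdh : ∀ t, dT A (C.hT t) = t - C.Q t - C.hT (dT A t) := by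
    intro t; rw [← C.htpy_T t]; abel
  have hDh : ∀ t, cog f (A.D (C.hT t)) = 0 := by
    intro t
    rw [hD, map_add, hf.cog_delta_hT, hdh]
    simp [hf.cog_Q, hf.cog_hT]
  set X : 𝕋 W →ₗ[k] 𝕋 H := cog f ∘ₗ A.D - D' ∘ₗ cog f with hX
  have hXa : ∀ t, X t = cog f (A.D t) - D' (cog f t) := fun t => rfl
  have hXQ : ∀ t, X (C.Q t) = 0 := by
    intro t
    rw [hXa, Q_eq, LinearMap.comp_apply, hf.cog_inc, hDi, hD, C.dT_inc, zero_add, sub_self]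
  have hXh : ∀ t, X (C.hT t) = 0 := by
    intro t
    rw [hXa, hDh, hf.cog_hT, map_zero, sub_zero]
  have hXDh : ∀ t, X (A.D (C.hT t)) = 0 := by
    intro t
    rw [hXa, A.D_D, hDh, map_zero, map_zero, sub_zero]
  have hX0 : ∀ t, X t + X (delta A (C.hT t)) = 0 := by
    intro t
    have := hXDh t
    rw [hD, map_add, hdh] at this
    simpa [hXQ, hXh] using this
  have : X t = 0 := by
    have h := hX0 (R t)
    rwa [← map_add, hR] at h
  rwa [hXa, sub_eq_zero] at this

/-- The transferred A∞-structure. -/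
noncomputable def transfer (C : Contraction A H) (f : 𝕋 W →ₗ[k] H) (R : 𝕋 W →ₗ[k] 𝕋 W)
    (hf : C.IsTransfer f) (hR : ∀ t, R t + delta A (C.hT (R t)) = t) : CoA k H where
  sg := C.sg
  b := f ∘ₗ delta A ∘ₗ tmap C.inc
  sg_sg x := by
    have h : ∀ x, C.sg x = C.pr (A.sg (C.inc x)) := by intro x; rw [C.pr_sg, C.pr_inc]
    rw [h (C.sg x), ← C.sg_inc, A.sg_sg, C.pr_inc]
  b_one := by simp [tmap_one, delta_one]
  b_sg t := by
    have := A.S_S (tmap C.inc t)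
    simp only [LinearMap.comp_apply]
    rw [← C.S_inc, ← hf.f_S hR, S_delta, map_neg, neg_neg]
  b_coder t := by
    have hS := hf.f_S hR
    set D' := coder (f ∘ₗ delta A ∘ₗ tmap C.inc) LinearMap.id C.sg with hD'
    have h1 : D' t = cog f (A.D (tmap C.inc t)) := by
      rw [hf.cog_D hS hR, hf.cog_inc]
    have h2 : D' (D' t) = 0 := by
      rw [h1, ← hf.cog_D hS hR, A.D_D, map_zero]
    have h3 := LinearMap.congr_fun
      (letter_coder (f ∘ₗ delta A ∘ₗ tmap C.inc) isCoalg_id C.sg) (D' t)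
    rw [comp_pplus (by simp [tmap_one, delta_one]), LinearMap.comp_apply, ← hD', h2, map_zero] at h3
    exact h3.symm

theorem transfer_b_cog (hf : C.IsTransfer f) (hR : ∀ t, R t + delta A (C.hT (R t)) = t) (t : 𝕋 W) :
    (C.transfer f R hf hR).b (cog f t) = f (A.D t) := by
  rw [← letter_D, ← letter_cog hf.f_one (A.D t), hf.cog_D (hf.f_S hR) hR]
  rfl

end Contraction

end CoA

namespace CoA

namespace Contraction

variable {W H : Type} [AddCommGroup W] [Module k W] [AddCommGroup H] [Module k H] {A : CoA k W}

theorem dT_mul (s t : 𝕋 W) : dT A (s * t) = dT A s * t + A.S s * dT A t := by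
  induction s using tensor_induction with
  | one => simp [dT_one, S_one]
  | cons x s ih => simp [mul_assoc, dT_cons, ih, S_mul, S_letter, mul_add, add_mul, add_assoc]
  | add a b ha hb => simp only [add_mul, map_add, ha, hb]; abel
  | smul r a ha => simp [ha]

theorem hT_mul (C : Contraction A H) (s t : 𝕋 W) :
    C.hT (s * t) = C.hT s * C.Q t + A.S s * C.hT t := by
  have hQ : ∀ s t, C.Q (s * t) = C.Q s * C.Q t := tmap_mul _
  induction s using tensor_induction with
  | one => simp [hT_one, S_one]
  | cons x s ih =>
    simp [mul_assoc, hT_cons, ih, S_mul, S_letter, mul_add, add_mul, add_assoc, hQ]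
  | add a b ha hb => simp only [add_mul, map_add, ha, hb]; abel
  | smul r a ha => simp [ha]

theorem delta_unit_mul {u : W} (hu : A.StrictUnit u) (s t : 𝕋 W) :
    delta A (s * (τ u * t)) = delta A s * (τ u * t) + aug W s • t - aug W t • A.S s -
      A.S s * (τ u * delta A t) := by
  have h1 : ∀ t, delta A t = A.D t - dT A t := by intro t; rw [← dT_add_delta]; simp
  have h2 : dT A (τ u) = 0 := by
    have := dT_cons (A := A) u 1
    rwa [mul_one, hu.b_letter, dT_one, map_zero, zero_mul, mul_zero, add_zero] at this
  simp only [h1, hu.D_mul, dT_mul, h2, S_letter, hu.sg]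
  simp [mul_sub, sub_mul]
  abel

theorem hT_unit_mul (C : Contraction A H) {u : W} (hu : A.StrictUnit u) (hh : C.h u = 0)
    (hi : C.inc (C.pr u) = u) (s t : 𝕋 W) :
    C.hT (s * (τ u * t)) = C.hT s * (τ u * C.Q t) - A.S s * (τ u * C.hT t) := by
  rw [hT_mul, hT_cons, Q_cons, hh, hi, hu.sg]
  simp
  abel

theorem aug_hT (C : Contraction A H) (t : 𝕋 W) : aug W (C.hT t) = 0 := aug_coder _ _ _ t

/-- The subspace on which the transferred morphism is forced to vanish by the strict unit. -/
noncomputable def unitSpace (C : Contraction A H) (u : W) : Submodule k (𝕋 W) :=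
  Submodule.span k {y | ∃ s t, (aug W s = 0 ∨ aug W t = 0) ∧ y = s * (τ u * t)} ⊔
    LinearMap.range C.hT

theorem mem_unitSpace {C : Contraction A H} {u : W} {s t : 𝕋 W} (h : aug W s = 0 ∨ aug W t = 0) :
    s * (τ u * t) ∈ C.unitSpace u :=
  Submodule.mem_sup_left (Submodule.subset_span ⟨s, t, h, rfl⟩)

theorem hT_mem_unitSpace {C : Contraction A H} {u : W} (t : 𝕋 W) : C.hT t ∈ C.unitSpace u :=
  Submodule.mem_sup_right ⟨t, rfl⟩

theorem unitSpace_stable {C : Contraction A H} {u : W} (hu : A.StrictUnit u) (hh : C.h u = 0)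
    (hi : C.inc (C.pr u) = u) {y : 𝕋 W} (hy : y ∈ C.unitSpace u) :
    delta A (C.hT y) ∈ C.unitSpace u := by
  have : C.unitSpace u ≤ (C.unitSpace u).comap (delta A ∘ₗ C.hT) := by
    refine sup_le (Submodule.span_le.2 ?_) ?_
    · rintro _ ⟨s, t, -, rfl⟩
      simp only [SetLike.mem_coe, Submodule.mem_comap, LinearMap.comp_apply]
      rw [C.hT_unit_mul hu hh hi, map_sub, delta_unit_mul hu, delta_unit_mul hu, S_hT]
      simp only [aug_hT, aug_S, zero_smul]
      have e : A.S (A.S s) * (τ u * delta A (C.hT t)) ∈ C.unitSpace u :=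
        mem_unitSpace (Or.inr (aug_delta _))
      refine sub_mem (sub_mem (sub_mem (add_mem (mem_unitSpace (Or.inl (aug_delta _)))
        (zero_mem _)) ?_) ?_) (sub_mem (sub_mem (add_mem (mem_unitSpace (Or.inl (aug_delta _)))
        ?_) (zero_mem _)) e)
      · exact Submodule.smul_mem _ _ (neg_mem (hT_mem_unitSpace _))
      · exact mem_unitSpace (Or.inl (by rw [map_neg, aug_hT, neg_zero]))
      · exact Submodule.smul_mem _ _ (hT_mem_unitSpace _)
    · rintro _ ⟨t, rfl⟩
      simp [hT_hT]
  exact this hy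

theorem letter_mul (s t : 𝕋 W) :
    letter k W (s * t) = aug W t • letter k W s + aug W s • letter k W t := by
  induction s using tensor_induction with
  | one => simp [letter_one]
  | cons x s _ => simp [mul_assoc, letter_cons, aug_letter, smul_smul, mul_comm]
  | add a b ha hb => simp only [add_mul, map_add, ha, hb, smul_add, add_smul]; abel
  | smul r a ha => simp [ha, smul_smul, mul_comm]

theorem pr_letter_unitSpace {C : Contraction A H} {u : W} {y : 𝕋 W} (hy : y ∈ C.unitSpace u) :
    C.pr (letter k W y) = 0 := by
  have : C.unitSpace u ≤ LinearMap.ker (C.pr ∘ₗ letter k W) := by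
    refine sup_le (Submodule.span_le.2 ?_) ?_
    · rintro _ ⟨s, t, h, rfl⟩
      rw [SetLike.mem_coe, LinearMap.mem_ker, LinearMap.comp_apply, letter_mul, letter_cons]
      rcases h with h | h <;> simp [h, aug_letter]
    · rintro _ ⟨t, rfl⟩
      have h1 := LinearMap.congr_fun C.letter_hT t
      simp only [LinearMap.comp_apply] at h1
      simp [h1, C.pr_h]
  exact this hy

theorem IsTransfer.eq_zero_of_mem_unitSpace {C : Contraction A H} {f : 𝕋 W →ₗ[k] H}
    (hf : C.IsTransfer f) {u : W} (hu : A.StrictUnit u) (hh : C.h u = 0)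
    (hi : C.inc (C.pr u) = u)
    (hnil : ∀ t, ∃ n, ((-(delta A ∘ₗ C.hT) : Module.End k (𝕋 W)) ^ n) t = 0)
    {y : 𝕋 W} (hy : y ∈ C.unitSpace u) : f y = 0 := by
  obtain ⟨n, hn⟩ := hnil y
  induction n generalizing y with
  | zero => rw [show y = 0 by simpa using hn, map_zero]
  | succ n ih =>
    have h1 := hf y
    rw [pr_letter_unitSpace hy] at h1
    rw [pow_succ, Module.End.mul_apply] at hn
    have h2 := ih (neg_mem (unitSpace_stable hu hh hi hy)) hn
    rw [map_neg, neg_eq_zero] at h2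
    rwa [h2, add_zero] at h1

theorem transfer_strictUnit {C : Contraction A H} {f : 𝕋 W →ₗ[k] H} {R : 𝕋 W →ₗ[k] 𝕋 W}
    (hf : C.IsTransfer f) (hR : ∀ t, R t + delta A (C.hT (R t)) = t)
    {u : W} (hu : A.StrictUnit u) (hh : C.h u = 0) (hi : C.inc (C.pr u) = u)
    (hnil : ∀ t, ∃ n, ((-(delta A ∘ₗ C.hT) : Module.End k (𝕋 W)) ^ n) t = 0) :
    (C.transfer f R hf hR).StrictUnit (C.pr u) where
  sg := by
    change C.sg (C.pr u) = _
    rw [← C.pr_sg, hu.sg, map_neg]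
  b s t := by
    change f (delta A (tmap C.inc (s * (τ (C.pr u) * t)))) =
      aug H s • letter k H t - aug H t • C.sg (letter k H s)
    have h0 := fun {y} => hf.eq_zero_of_mem_unitSpace hu hh hi hnil (y := y)
    rw [tmap_mul, tmap_cons, hi, delta_unit_mul hu, map_sub, map_sub, map_add,
      h0 (mem_unitSpace (Or.inl (aug_delta _))), h0 (mem_unitSpace (Or.inr (aug_delta _))),
      map_smul, map_smul, hf.f_inc, hf.f_S hR, hf.f_inc, (isCoalg_tmap _).aug, (isCoalg_tmap _).aug]
    simp

variable {gr : ℤ → Submodule k W} {grH : ℤ → Submodule k H}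

theorem op_hT (C : Contraction A H) (hsg : ∀ p, ∀ x ∈ gr p, A.sg x ∈ gr p)
    (hh : ∀ p, ∀ x ∈ gr p, C.h x ∈ gr (p - 1)) (hQ : ∀ p, ∀ x ∈ gr p, C.inc (C.pr x) ∈ gr p) :
    Op gr gr (-1) C.hT := by
  intro n q t ht
  induction ht with
  | one => simp [hT_one]
  | @cons p x n q t hx ht ih =>
    rw [hT_cons]
    refine add_mem (mul_mem_TF (letter_mem_TF (hh _ _ hx)) (op_tmap hQ _ _ _ ht) (by omega) (by ring))
      (mul_mem_TF (letter_mem_TF (hsg _ _ hx)) ih (by omega) (by ring))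

theorem deg_bhigh (hb : Deg gr gr 1 A.b) : Deg gr gr 1 (bhigh A) := by
  refine hb.sub ?_
  have h1 : ∀ p, ∀ x ∈ gr p, (A.b ∘ₗ τ) x ∈ gr (p + 1) := fun p x hx => hb _ _ _ (HWord.letter hx)
  exact deg_letter.map (f := A.b ∘ₗ τ) h1 (by ring)

/-- Homotopy transfer along a homogeneous contraction, preserving strict units. -/
theorem exists_transfer (C : Contraction A H) (hgr : ⨆ p, gr p = ⊤) (hb : Deg gr gr 1 A.b)
    (hsg : ∀ p, ∀ x ∈ gr p, A.sg x ∈ gr p)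
    (hh : ∀ p, ∀ x ∈ gr p, C.h x ∈ gr (p - 1)) (hpr : ∀ p, ∀ x ∈ gr p, C.pr x ∈ grH p)
    (hinc : ∀ p, ∀ x ∈ grH p, C.inc x ∈ gr p) {u : W} (hu : A.StrictUnit u) (hhu : C.h u = 0)
    (hiu : C.inc (C.pr u) = u) :
    ∃ (B : CoA k H) (f : 𝕋 W →ₗ[k] H), B.sg = C.sg ∧ Deg grH grH 1 B.b ∧ Deg gr grH 0 f ∧
      f 1 = 0 ∧ (∀ t, B.b (cog f t) = f (A.D t)) ∧ B.StrictUnit (C.pr u) ∧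
      ∀ x, f (τ x) = C.pr x := by
  have hQ : ∀ p, ∀ x ∈ gr p, C.inc (C.pr x) ∈ gr p := fun p x hx => hinc _ _ (hpr _ _ hx)
  have hopT := C.op_hT hsg hh hQ
  have hδ : Op gr gr 1 (delta A) := op_coder (deg_bhigh hb) hsg
  have h1 : (-(delta A ∘ₗ C.hT) : Module.End k (𝕋 W)) 1 = 0 := by
    simp [hT_one]
  have hΦ : ∀ n q t, HWord gr (n + 1) q t →
      (-(delta A ∘ₗ C.hT) : Module.End k (𝕋 W)) t ∈ TF gr n q := by
    intro n q t ht
    rw [LinearMap.neg_apply, neg_mem_iff, LinearMap.comp_apply]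
    refine map_mem_of_TF (fun m hm t ht => ?_) (hopT _ _ _ ht)
    cases m with
    | zero => rw [ht.eq_one.1, delta_one]; exact zero_mem _
    | succ m =>
      have h2 : ∀ x, bhigh A (τ x) = 0 := by intro x; simp [bhigh, letter_letter]
      have := TF_mono (Nat.le_of_succ_le_succ hm) _ (coder_lower (deg_bhigh hb) h2 hsg ht)
      rwa [neg_add_cancel_right] at this
  obtain ⟨R, hR1, hR2, hR⟩ := exists_inverse hgr h1 hΦ
  have hR1' : ∀ t, R t + delta A (C.hT (R t)) = t := by
    intro t
    have := LinearMap.congr_fun hR1 t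
    simpa using this
  have hf : C.IsTransfer (C.pr ∘ₗ letter k W ∘ₗ R) := by
    intro t
    have := LinearMap.congr_fun hR2 t
    simp only [sub_neg_eq_add, LinearMap.comp_apply, LinearMap.add_apply, LinearMap.id_apply,
      map_add] at this
    rw [LinearMap.comp_apply, LinearMap.comp_apply, LinearMap.comp_apply, LinearMap.comp_apply,
      ← map_add, ← map_add, this]
  have hfd : Deg gr grH 0 (C.pr ∘ₗ letter k W ∘ₗ R) := by
    have h3 : ∀ p, ∀ x ∈ gr p, C.pr x ∈ grH (p + 0) := by simpa using hpr
    exact (deg_letter.comp_op hR (add_zero 0)).map h3 (add_zero 0)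
  refine ⟨C.transfer _ R hf hR1', _, rfl, ?_, hfd, hf.f_one, C.transfer_b_cog hf hR1',
    C.transfer_strictUnit hf hR1' hu hhu hiu (exists_pow_eq_zero hgr h1 hΦ), ?_⟩
  · exact hfd.comp_op (hδ.comp (op_tmap hinc) (zero_add 1)) (add_zero 1)
  · intro x
    have h4 : C.hT (τ x) = τ (C.h x) := by
      have := C.hT_cons x 1
      rwa [mul_one, hT_one, mul_zero, add_zero, Q, tmap_one, mul_one] at this
    have h5 : ∀ y, delta A (τ y) = 0 := by
      intro y
      have : delta A (τ y * 1) = com (bhigh A) (τ y * 1) + τ (A.sg y) * delta A 1 :=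
        coder_cons _ _ _ _ _
      rw [mul_one, com_singleton, delta_one, mul_zero, add_zero] at this
      rw [this]; simp [bhigh, letter_letter]
    have h6 := hf (τ x)
    rwa [h4, h5, map_zero, add_zero, letter_letter] at h6

end Contraction

end CoA

/-! ### Operations of given arity -/

section Arity

variable {V V' : Type} [AddCommGroup V] [Module k V] [AddCommGroup V'] [Module k V']

variable (k) in
/-- The product of a list of letters. -/
noncomputable def word (l : List V) : 𝕋 V := (l.map τ).prod

theorem word_nil : word k ([] : List V) = 1 := rfl

theorem word_cons (x : V) (l : List V) : word k (x :: l) = τ x * word k l := by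
  simp [word]

theorem word_append (l l' : List V) : word k (l ++ l') = word k l * word k l' := by
  simp [word]

theorem word_ofFn {n : ℕ} (v : Fin n → V) :
    word k (List.ofFn v) = TensorAlgebra.tprod k V n v := by
  rw [TensorAlgebra.tprod_apply, word, List.map_ofFn]; rfl

/-- The operations of arity `n` encoded by a linear map on the tensor algebra. -/
noncomputable def nary (F : 𝕋 V →ₗ[k] V') (n : ℕ) (v : Fin n → V) : V' := F (word k (List.ofFn v))

theorem isMultilinear_nary (F : 𝕋 V →ₗ[k] V') (n : ℕ) : IsMultilinear k (nary F n) := by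
  constructor
  · intro v i x y
    simp [nary, word_ofFn, MultilinearMap.map_update_add]
  · intro v i a x
    simp [nary, word_ofFn, MultilinearMap.map_update_smul]

theorem exists_eq_nary {b : ∀ n : ℕ, (Fin n → V) → V'} (hb : ∀ n, IsMultilinear k (b n)) :
    ∃ F : 𝕋 V →ₗ[k] V', b = nary F := by
  let m : ∀ n, MultilinearMap k (fun _ : Fin n => V) V' := fun n =>
    MultilinearMap.mk' (b n) (hb n).1 (hb n).2
  refine ⟨DirectSum.toModule k ℕ V' (fun n => PiTensorProduct.lift (m n)) ∘ₗ
    (TensorAlgebra.equivDirectSum (R := k) (M := V)).toLinearMap, ?_⟩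
  funext n v
  have h : (TensorAlgebra.equivDirectSum (R := k) (M := V)) (TensorAlgebra.tprod k V n v) =
      DirectSum.lof k ℕ (fun n => TensorPower k n V) n (PiTensorProduct.tprod k v) :=
    TensorAlgebra.toDirectSum_tensorPower_tprod v
  rw [nary, word_ofFn, LinearMap.comp_apply, AlgEquiv.toLinearMap_apply, h, DirectSum.toModule_lof,
    PiTensorProduct.lift.tprod]
  rfl

theorem nary_zero (F : 𝕋 V →ₗ[k] V') : nary F 0 = 0 ↔ F 1 = 0 := by
  constructor
  · intro h
    have := congrFun h Fin.elim0
    simpa [nary, word_nil] using this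
  · intro h
    funext v
    simpa [nary, word_nil] using h

theorem nary_one (F : 𝕋 V →ₗ[k] V') (x : V) : nary F 1 (fun _ => x) = F (τ x) := by
  simp [nary, word_cons, word_nil]

theorem nary_two (F : 𝕋 V →ₗ[k] V') (x y : V) : nary F 2 ![x, y] = F (τ x * τ y) := by
  simp [nary, word_cons, word_nil]

theorem bconv_word {N₁ N₂ N₃ : Type} [AddCommGroup N₁] [Module k N₁] [AddCommGroup N₂] [Module k N₂]
    [AddCommGroup N₃] [Module k N₃] (μ : N₁ →ₗ[k] N₂ →ₗ[k] N₃) (c : 𝕋 V →ₗ[k] N₁)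
    (g : 𝕋 V →ₗ[k] N₂) (l : List V) : bconv μ c g (word k l) =
      ∑ j ∈ range (l.length + 1), μ (c (word k (l.take j))) (g (word k (l.drop j))) := by
  induction l generalizing c with
  | nil => simp [word_nil, bconv_one]
  | cons x l ih =>
    rw [word_cons, bconv_cons, ih, List.length_cons, sum_range_succ' _ (l.length + 1), add_comm]
    simp [word_cons, word_nil, lsh_apply]

theorem pconv_word {R : Type} [Ring R] [Algebra k R] (c g : 𝕋 V →ₗ[k] R) (l : List V) :
    pconv c g (word k l) =
      ∑ j ∈ range l.length, c (word k (l.take (j + 1))) * g (word k (l.drop (j + 1))) := by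
  cases l with
  | nil => simp [word_nil, pconv_one]
  | cons x l =>
    rw [word_cons, pconv_cons, bconv_word]
    simp [word_cons, lsh_apply]

theorem coder_word (a : 𝕋 V →ₗ[k] V) (σ : V →ₗ[k] V) (l : List V) :
    coder a LinearMap.id σ (word k l) = ∑ i ∈ range l.length, ∑ j ∈ range (l.length - i),
      tmap σ (word k (l.take i)) * (τ (a (word k ((l.drop i).take (j + 1)))) *
        word k (l.drop (i + (j + 1)))) := by
  induction l with
  | nil => simp [word_nil, coder_one]
  | cons x l ih =>
    rw [word_cons, coder_cons, ih, List.length_cons, sum_range_succ' _ l.length, add_comm,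
      ← word_cons, pconv_word]
    congr 1
    · rw [Finset.mul_sum]
      refine Finset.sum_congr rfl fun i _ => ?_
      rw [Nat.add_sub_add_right, Finset.mul_sum]
      refine sum_congr rfl fun j _ => ?_
      rw [show i + 1 + (j + 1) = i + (j + 1) + 1 by ring]
      simp only [List.take_succ_cons, word_cons, tmap_cons, List.drop_succ_cons, mul_assoc]
    · simp [word_nil, tmap_one]

variable {gr : ℤ → Submodule k V} {gr' : ℤ → Submodule k V'}

theorem hWord_ofFn {n : ℕ} {p : Fin n → ℤ} {v : Fin n → V} (hv : ∀ t, v t ∈ gr (p t)) :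
    HWord gr n (∑ t, p t) (word k (List.ofFn v)) := by
  induction n with
  | zero => exact HWord.one
  | succ n ih =>
    rw [List.ofFn_succ, word_cons, Fin.sum_univ_succ]
    exact HWord.cons (hv 0) (ih fun t => hv t.succ)

theorem HWord.exists_ofFn {n : ℕ} {q : ℤ} {t : 𝕋 V} (h : HWord gr n q t) :
    ∃ (p : Fin n → ℤ) (v : Fin n → V), (∀ t, v t ∈ gr (p t)) ∧ ∑ t, p t = q ∧
      word k (List.ofFn v) = t := by
  induction h with
  | one => exact ⟨Fin.elim0, Fin.elim0, fun t => t.elim0, rfl, rfl⟩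
  | @cons p x n q t hx _ ih =>
    obtain ⟨p', v, hv, hp, ht⟩ := ih
    refine ⟨Fin.cons p p', Fin.cons x v, fun t => ?_, ?_, ?_⟩
    · cases t using Fin.cases with
      | zero => exact hx
      | succ t => exact hv t
    · rw [Fin.sum_univ_succ, ← hp]; rfl
    · rw [List.ofFn_succ, word_cons, ← ht]; rfl

theorem deg_iff_nary {r : ℤ} {F : 𝕋 V →ₗ[k] V'} : Deg gr gr' r F ↔
    ∀ (n : ℕ) (p : Fin n → ℤ) (v : Fin n → V), (∀ t, v t ∈ gr (p t)) →
      nary F n v ∈ gr' (∑ t, p t + r) := by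
  constructor
  · intro h n p v hv
    exact h _ _ _ (hWord_ofFn hv)
  · intro h n q t ht
    obtain ⟨p, v, hv, rfl, rfl⟩ := ht.exists_ofFn
    exact h n p v hv

theorem tmap_hWord {σ : V →ₗ[k] V} (hσ : ∀ p, ∀ x ∈ gr p, σ x = ((-1 : k) ^ p) • x) {n : ℕ} {q : ℤ}
    {t : 𝕋 V} (ht : HWord gr n q t) : tmap σ t = ((-1 : k) ^ q) • t := by
  induction ht with
  | one => simp [tmap_one]
  | cons hx _ ih =>
    rw [tmap_cons, hσ _ _ hx, ih, map_smul, smul_mul_smul_comm, ← zpow_add₀ (by simp)]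

theorem ofFn_insArg {n i j : ℕ} (hi : i < n) (hj : 1 ≤ j) (v : Fin n → V) (x : V) :
    List.ofFn (insArg n i j v x) = (List.ofFn v).take i ++ x :: (List.ofFn v).drop (i + j) := by
  apply List.ext_getElem
  · simp; omega
  · intro t h1 h2
    simp only [List.length_ofFn] at h1
    rw [List.getElem_ofFn, List.getElem_append]
    simp only [insArg, List.length_take, List.length_ofFn, List.getElem_cons,
      Nat.min_eq_left hi.le]
    by_cases c1 : t < i
    · rw [dif_pos (show t < i ∧ t < n by omega), dif_pos c1]; simp
    · rw [dif_neg (show ¬ (t < i ∧ t < n) by omega), dif_neg c1]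
      by_cases c2 : t = i
      · rw [if_pos c2, dif_pos (show t - i = 0 by omega)]
      · rw [if_neg c2, dif_neg (show ¬ (t - i = 0) by omega), dif_pos (show t + j - 1 < n by omega)]
        simp only [List.getElem_drop, List.getElem_ofFn]
        congr 2
        omega

theorem ofFn_shiftArg {n i j : ℕ} (hij : i + j ≤ n) (v : Fin n → V) :
    List.ofFn (shiftArg n i j v) = ((List.ofFn v).drop i).take j := by
  apply List.ext_getElem
  · simp; omega
  · intro t h1 h2
    simp only [List.length_ofFn] at h1
    simp only [List.getElem_ofFn, List.getElem_take, List.getElem_drop, shiftArg]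
    rw [dif_pos (by omega)]

theorem take_hWord {n i : ℕ} (hi : i ≤ n) {p : Fin n → ℤ} {v : Fin n → V}
    (hv : ∀ t, v t ∈ gr (p t)) :
    HWord gr i (partialDeg n i p) (word k ((List.ofFn v).take i)) := by
  have h1 : (List.ofFn v).take i = List.ofFn fun t : Fin i => v (Fin.castLE hi t) := by
    apply List.ext_getElem
    · simp; omega
    · intro t h1 h2
      simp
  have h2 : partialDeg n i p = ∑ t : Fin i, p (Fin.castLE hi t) := by
    rw [partialDeg, ← Fin.sum_univ_eq_sum_range
      (fun t => if h : t < n then p ⟨t, h⟩ else 0) i]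
    refine Finset.sum_congr rfl fun t _ => ?_
    rw [dif_pos (by omega)]; rfl
  rw [h1, h2]
  exact hWord_ofFn fun t => hv _

theorem sum_nary_insArg {F : 𝕋 V →ₗ[k] V'} {b : 𝕋 V →ₗ[k] V} {σ : V →ₗ[k] V}
    (hσ : ∀ p, ∀ x ∈ gr p, σ x = ((-1 : k) ^ p) • x) {n : ℕ} {p : Fin n → ℤ} {v : Fin n → V}
    (hv : ∀ t, v t ∈ gr (p t)) :
    ∑ i ∈ Finset.range n, ∑ j ∈ Finset.Icc 1 (n - i), ((-1 : k) ^ partialDeg n i p) •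
      nary F (i + 1 + (n - i - j)) (insArg n i j v (nary b j (shiftArg n i j v))) =
      F (coder b LinearMap.id σ (word k (List.ofFn v))) := by
  rw [coder_word, map_sum, List.length_ofFn]
  refine sum_congr rfl fun i hi => ?_
  rw [mem_range] at hi
  rw [map_sum, ← Finset.Ico_succ_right_eq_Icc, sum_Ico_eq_sum_range]
  refine sum_congr (by congr 1) fun j hj => ?_
  rw [mem_range] at hj
  rw [tmap_hWord hσ (take_hWord hi.le hv), smul_mul_assoc, map_smul, nary, nary,
    ofFn_insArg hi (by omega), ofFn_shiftArg (by omega), word_append, word_cons,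
    add_comm 1 j]

end Arity

/-! ### Sums over compositions -/

section Compositions

/-- The lists of positive integers with sum `n`. -/
def comps (n : ℕ) : Finset (List ℕ) := univ.image (Composition.blocks (n := n))

theorem mem_comps {n : ℕ} {L : List ℕ} : L ∈ comps n ↔ (∀ i ∈ L, 0 < i) ∧ L.sum = n := by
  simp only [comps, mem_image, mem_univ, true_and]
  constructor
  · rintro ⟨c, rfl⟩
    exact ⟨fun i hi => c.blocks_pos hi, c.blocks_sum⟩
  · rintro ⟨h1, h2⟩
    exact ⟨⟨L, fun {i} hi => h1 i hi, h2⟩, rfl⟩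

theorem sum_comps {N : Type} [AddCommMonoid N] {n : ℕ} (hn : 0 < n) (g : List ℕ → N) :
    ∑ L ∈ comps n, g L = ∑ j ∈ range n, ∑ L ∈ comps (n - (j + 1)), g ((j + 1) :: L) := by
  have h : comps n = (range n).biUnion fun j =>
      (comps (n - (j + 1))).image (List.cons (j + 1)) := by
    ext L
    simp only [mem_biUnion, mem_image, mem_comps, mem_range]
    constructor
    · rintro ⟨h1, h2⟩
      cases L with
      | nil => simp at h2; omega
      | cons a L =>
        have ha : 0 < a := h1 a (by simp)
        rw [List.sum_cons] at h2
        refine ⟨a - 1, by omega, L, ⟨fun i hi => h1 i (by simp [hi]), by omega⟩, ?_⟩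
        congr 1; omega
    · rintro ⟨j, hj, L, ⟨h1, h2⟩, rfl⟩
      refine ⟨fun i hi => ?_, ?_⟩
      · rcases List.mem_cons.1 hi with rfl | hi
        · omega
        · exact h1 i hi
      · rw [List.sum_cons]; omega
  rw [h, sum_biUnion]
  · refine sum_congr rfl fun j _ => sum_image fun L _ L' _ hL => ?_
    exact (List.cons.inj hL).2
  · intro i _ j _ hij
    rw [Function.onFun, Finset.disjoint_left]
    intro L h1 h2
    simp only [mem_image] at h1 h2
    obtain ⟨L1, _, rfl⟩ := h1
    obtain ⟨L2, _, h2⟩ := h2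
    have := (List.cons.inj h2).1
    omega

variable {V V' V'' : Type} [AddCommGroup V] [Module k V] [AddCommGroup V'] [Module k V']
  [AddCommGroup V''] [Module k V'']

theorem cog_word (f : 𝕋 V →ₗ[k] V') (l : List V) : cog f (word k l) =
    ∑ L ∈ comps l.length, word k ((l.splitWrtCompositionAux L).map fun m => f (word k m)) := by
  induction hn : l.length using Nat.strong_induction_on generalizing l with
  | _ n ih =>
    cases l with
    | nil =>
      have : comps n = {[]} := by
        ext L
        simp only [mem_comps, mem_singleton]
        simp at hn
        subst hn
        constructor
        · rintro ⟨h1, h2⟩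
          cases L with
          | nil => rfl
          | cons a L =>
            have := h1 a (by simp)
            simp at h2; omega
        · rintro rfl; simp
      rw [this, sum_singleton, word_nil, cog_one]
      simp [List.splitWrtCompositionAux, word_nil]
    | cons x l =>
      have h0 : 0 < n := by simp at hn; omega
      rw [sum_comps h0, word_cons, cog_cons, ← word_cons, pconv_word, hn]
      refine sum_congr rfl fun j hj => ?_
      rw [mem_range] at hj
      rw [ih (n - (j + 1)) (by omega) _ (by rw [List.length_drop, hn]), Finset.mul_sum]
      refine sum_congr rfl fun L _ => ?_
      rw [List.splitWrtCompositionAux_cons, List.map_cons, word_cons]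
      rfl

theorem sum_composition (b : 𝕋 V' →ₗ[k] V'') (f : 𝕋 V →ₗ[k] V') {n : ℕ} (v : Fin n → V) :
    ∑ c : Composition n, nary b c.length
      (fun s => nary f (c.blocksFun s) fun t => v (c.embedding s t)) =
      b (cog f (word k (List.ofFn v))) := by
  rw [cog_word, map_sum, List.length_ofFn, comps, sum_image fun c _ c' _ h => Composition.ext h]
  refine sum_congr rfl fun c _ => ?_
  rw [nary]
  congr 2
  apply List.ext_getElem
  · rw [List.length_ofFn, List.length_map]
    exact (List.length_splitWrtComposition (List.ofFn v) c).symm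
  · intro i h1 h2
    rw [List.getElem_ofFn, List.getElem_map, nary]
    congr 2
    rw [List.length_ofFn] at h1
    have h3 : c.sizeUpTo (i + 1) = c.sizeUpTo i + c.blocksFun ⟨i, h1⟩ := c.sizeUpTo_succ h1
    have h4 := c.sizeUpTo_le (i + 1)
    have := List.getElem_splitWrtComposition' (List.ofFn v) c
      (i := i) (by rw [List.length_splitWrtComposition]; exact h1)
    refine Eq.trans ?_ this.symm
    apply List.ext_getElem
    · simp; omega
    · intro t h5 h6
      rw [List.length_ofFn] at h5
      simp
      congr 1

end Compositions

/-! ### Coalgebraic structures and A∞-structures -/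

section Dictionary

variable {V V' : Type} [AddCommGroup V] [Module k V] [AddCommGroup V'] [Module k V']
  {gr : ℤ → Submodule k V} {gr' : ℤ → Submodule k V'}

theorem AInfAlg.exists_coA (A : AInfAlg k) : ∃ C : CoA k A.M, A.b = nary C.b ∧
    C.sg = sgn A.internal ∧ Deg A.gr A.gr 1 C.b := by
  obtain ⟨h0, hm, hd, hr⟩ := A.isAInf
  obtain ⟨F, hF⟩ := exists_eq_nary hm
  have hdeg : Deg A.gr A.gr 1 F := by
    rw [deg_iff_nary]
    intro n p v hv
    rw [← hF, add_comm]
    exact hd n p v hv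
  have hσ : ∀ p, ∀ x ∈ A.gr p, sgn A.internal x = ((-1 : k) ^ p) • x := fun p x hx =>
    sgn_apply A.internal hx
  have htop := iSup_of_internal A.internal
  have h1 : F ∘ₗ tmap (sgn A.internal) = -(sgn A.internal ∘ₗ F) := by
    refine ext_HWord htop fun n q t ht => ?_
    simp only [LinearMap.comp_apply, LinearMap.neg_apply]
    rw [tmap_hWord hσ ht, map_smul, hσ _ _ (hdeg n q t ht), zpow_add₀ (by simp), zpow_one,
      mul_neg_one, neg_smul, neg_neg]
  have h2 : F ∘ₗ coder F LinearMap.id (sgn A.internal) = 0 := by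
    refine ext_HWord htop fun n q t ht => ?_
    obtain ⟨p, v, hv, -, rfl⟩ := ht.exists_ofFn
    rw [LinearMap.comp_apply, ← sum_nary_insArg hσ hv, LinearMap.zero_apply, ← hF]
    rcases Nat.eq_zero_or_pos n with rfl | hn
    · simp
    · exact hr n hn p v hv
  exact ⟨⟨sgn A.internal, F, sgn_sgn A.internal, (nary_zero F).1 (hF ▸ h0),
    LinearMap.congr_fun h1, LinearMap.congr_fun h2⟩, hF, rfl, hdeg⟩

/-- The A∞-algebra defined by a coalgebraic structure of degree one. -/
noncomputable def CoA.toAInfAlg (C : CoA k V) (hgr : DirectSum.IsInternal gr)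
    (hsg : C.sg = sgn hgr) (hb : Deg gr gr 1 C.b) : AInfAlg k where
  M := V
  gr := gr
  internal := hgr
  b := nary C.b
  isAInf := by
    refine ⟨(nary_zero C.b).2 C.b_one, isMultilinear_nary C.b, fun n p v hv => ?_,
      fun n _ p v hv => ?_⟩
    · rw [add_comm]
      exact deg_iff_nary.1 hb n p v hv
    · rw [sum_nary_insArg (σ := C.sg) (fun p x hx => by rw [hsg, sgn_apply hgr hx]) hv]
      exact C.b_coder _

theorem isAInfMorphism_nary {A : CoA k V} {B : CoA k V'} (hgr : DirectSum.IsInternal gr)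
    (hsg : A.sg = sgn hgr) {f : 𝕋 V →ₗ[k] V'} (hf1 : f 1 = 0) (hf : Deg gr gr' 0 f)
    (h : ∀ t, B.b (cog f t) = f (A.D t)) :
    IsAInfMorphism k V gr (nary A.b) V' gr' (nary B.b) (nary f) := by
  refine ⟨(nary_zero f).2 hf1, isMultilinear_nary f, fun n p v hv => ?_, fun n _ p v hv => ?_⟩
  · rw [← add_zero (∑ t, p t)]
    exact deg_iff_nary.1 hf n p v hv
  · rw [sum_nary_insArg (σ := A.sg) (fun p x hx => by rw [hsg, sgn_apply hgr hx]) hv,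
      sum_composition, h]
    rfl

theorem aug_word {l : List V} (hl : l ≠ []) : aug V (word k l) = 0 := by
  cases l with
  | nil => exact absurd rfl hl
  | cons x l => rw [word_cons, aug_cons]

theorem letter_word {l : List V} (hl : l.length ≠ 1) : letter k V (word k l) = 0 := by
  cases l with
  | nil => rw [word_nil, letter_one]
  | cons x l =>
    rw [word_cons, letter_cons, aug_word, zero_smul]
    rintro rfl
    exact hl rfl

theorem CoA.StrictUnit.isStrictUnit {C : CoA k V} {u : V} (h : C.StrictUnit u)
    (hgr : DirectSum.IsInternal gr) (hsg : C.sg = sgn hgr) (hu : u ∈ gr (-1)) :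
    IsStrictUnit V gr (nary C.b) u := by
  refine ⟨hu, fun x => ?_, fun p x hx => ?_, fun n hn v ⟨i, hi⟩ => ?_⟩
  · have := h.b 1 (τ x)
    rw [nary_two]
    simpa [letter_letter, aug_letter] using this
  · have := h.b (τ x) 1
    rw [nary_two]
    simp only [mul_one, aug_letter, zero_smul, map_one, one_smul, zero_sub, letter_letter] at this
    rw [this, hsg, sgn_apply hgr hx, smul_neg, smul_smul, ← neg_smul, zpow_add₀ (by simp), zpow_one,
      mul_neg_one, neg_mul, neg_neg, neg_one_zpow_mul_self, one_smul]
  · have hsplit : List.ofFn v = (List.ofFn v).take i ++ u :: (List.ofFn v).drop (i + 1) := by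
      conv_lhs => rw [← List.take_append_drop i (List.ofFn v)]
      rw [List.drop_eq_getElem_cons (by simp), List.getElem_ofFn, hi]
    rw [nary, hsplit, word_append, word_cons, h.b]
    have hi' := i.isLt
    have e1 : ((List.ofFn v).take i).length = i := by simp
    have e2 : ((List.ofFn v).drop (i + 1)).length = n - (i + 1) := by simp
    have c1 : aug V (word k ((List.ofFn v).take i)) •
        letter k V (word k ((List.ofFn v).drop (i + 1))) = 0 := by
      by_cases h0 : (List.ofFn v).take i = []
      · rw [h0, List.length_nil] at e1
        rw [letter_word (by omega), smul_zero]
      · rw [aug_word h0, zero_smul]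
    have c2 : aug V (word k ((List.ofFn v).drop (i + 1))) •
        C.sg (letter k V (word k ((List.ofFn v).take i))) = 0 := by
      by_cases h0 : (List.ofFn v).drop (i + 1) = []
      · rw [h0, List.length_nil] at e2
        rw [letter_word (by omega), map_zero, smul_zero]
      · rw [aug_word h0, zero_smul]
    rw [c1, c2, sub_zero]

end Dictionary

/-! ### The graded endomorphism algebra -/

section EndAlgebra

variable {V : Type} [AddCommGroup V] [Module k V] (gr : ℤ → Submodule k V)

/-- The reduced linear maps of degree `p`. -/
def redDeg (p : ℤ) : Submodule k (TensorAlgebra k V →ₗ[k] V) where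
  carrier := {φ | φ 1 = 0 ∧ Deg gr gr p φ}
  add_mem' h h' := ⟨by simp [h.1, h'.1], h.2.add h'.2⟩
  zero_mem' := ⟨rfl, fun _ _ _ _ => zero_mem _⟩
  smul_mem' a φ h := ⟨by simp [h.1], fun n q t ht => Submodule.smul_mem _ _ (h.2 n q t ht)⟩

variable {gr}

theorem iSupIndep_redDeg (hgr : DirectSum.IsInternal gr) : iSupIndep (redDeg gr) := by
  rw [iSupIndep_def]
  intro p
  rw [Submodule.disjoint_def]
  intro φ hφ hφ'
  refine ext_HWord (iSup_of_internal hgr) fun n q t ht => ?_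
  have h1 : φ t ∈ gr (q + p) := hφ.2 n q t ht
  have h2 : φ t ∈ ⨆ r, ⨆ (_ : r ≠ q + p), gr r := by
    have : (⨆ r, ⨆ (_ : r ≠ p), redDeg gr r) ≤
        (⨆ r, ⨆ (_ : r ≠ q + p), gr r).comap (LinearMap.applyₗ t) := by
      refine iSup₂_le fun r hr ψ hψ => ?_
      have h3 : gr (q + r) ≤ ⨆ r, ⨆ (_ : r ≠ q + p), gr r :=
        le_iSup₂_of_le (q + r) (by omega) le_rfl
      exact h3 (hψ.2 n q t ht)
    exact this hφ'
  exact (Submodule.disjoint_def.1 (hgr.submodule_iSupIndep (q + p))) _ h1 h2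

variable (gr) in
/-- The sums of homogeneous reduced linear maps. -/
def redMaps : Submodule k (TensorAlgebra k V →ₗ[k] V) := ⨆ p, redDeg gr p

theorem redDeg_le (p : ℤ) : redDeg gr p ≤ redMaps gr := le_iSup _ p

theorem redMaps_le {P : Submodule k (𝕋 V →ₗ[k] V)} (h : ∀ p, redDeg gr p ≤ P) : redMaps gr ≤ P :=
  iSup_le h

theorem redMaps_one {φ : 𝕋 V →ₗ[k] V} (hφ : φ ∈ redMaps gr) : φ 1 = 0 := by
  have : redMaps gr ≤ LinearMap.ker (LinearMap.applyₗ (1 : 𝕋 V) : (𝕋 V →ₗ[k] V) →ₗ[k] V) :=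
    redMaps_le fun p φ hφ => hφ.1
  exact this hφ

variable (gr) in
/-- The grading of the suspension of the endomorphism algebra. -/
def endGr (q : ℤ) : Submodule k (redMaps gr) := (redDeg gr (q + 1)).comap (redMaps gr).subtype

theorem internal_endGr (hgr : DirectSum.IsInternal gr) : DirectSum.IsInternal (endGr gr) := by
  refine internal_comap (gr := fun q => redDeg gr (q + 1))
    ((iSupIndep_redDeg hgr).comp (f := fun q : ℤ => q + 1) (add_left_injective 1)) ?_
  refine redMaps_le fun p => ?_
  refine le_iSup_of_le (p - 1) ?_
  rw [sub_add_cancel]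
  exact le_inf (redDeg_le p) le_rfl

namespace CoA

variable {A : CoA k V}

theorem op_S (hsg : ∀ p, ∀ x ∈ gr p, A.sg x ∈ gr p) : Op gr gr 0 A.S := op_tmap hsg

theorem endSg_mem (hsg : ∀ p, ∀ x ∈ gr p, A.sg x ∈ gr p) {p : ℤ} {φ : 𝕋 V →ₗ[k] V}
    (h : φ ∈ redDeg gr p) : A.endSg φ ∈ redDeg gr p := by
  refine ⟨by rw [endSg_apply, S_one, h.1, map_zero, neg_zero], ?_⟩
  have := Deg.map (f := A.sg) (s := 0) (gr' := gr) (by simpa using hsg)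
    (h.2.comp_op (op_S hsg) (zero_add p)) (add_zero p)
  exact this.neg

theorem endMul_mem (hsg : ∀ p, ∀ x ∈ gr p, A.sg x ∈ gr p) {p q c : ℤ} {φ ψ : 𝕋 V →ₗ[k] V}
    (hφ : φ ∈ redDeg gr p) (hψ : ψ ∈ redDeg gr q) (hc : p + q = c) :
    A.endMul φ ψ ∈ redDeg gr c := by
  refine ⟨by rw [endMul_apply, com_one, map_zero, map_zero, map_zero], ?_⟩
  exact Deg.map (f := A.sg) (s := 0) (gr' := gr) (by simpa using hsg)
    (hφ.2.comp_op ((op_S hsg).comp hψ.2.com (add_zero q)) (by omega)) (add_zero c)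

theorem endDiff_mem (hsg : ∀ p, ∀ x ∈ gr p, A.sg x ∈ gr p) (hb : Deg gr gr 1 A.b) {p c : ℤ}
    {φ : 𝕋 V →ₗ[k] V} (h : φ ∈ redDeg gr p) (hc : p + 1 = c) : A.endDiff φ ∈ redDeg gr c := by
  refine ⟨by rw [endDiff_apply, D_one, com_one]; simp, ?_⟩
  have h1 : Deg gr gr c (A.sg ∘ₗ φ ∘ₗ A.S ∘ₗ A.D) :=
    Deg.map (f := A.sg) (s := 0) (gr' := gr) (by simpa using hsg)
      (h.2.comp_op ((op_S hsg).comp (op_coder hb hsg) (add_zero 1)) (by omega)) (add_zero c)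
  have h2 : Deg gr gr c (A.b ∘ₗ com φ) := hb.comp_op h.2.com hc
  have h3 : A.endDiff φ = A.sg ∘ₗ φ ∘ₗ A.S ∘ₗ A.D - A.b ∘ₗ com φ := by
    ext t; exact endDiff_apply _ _ _
  rw [h3]
  exact h1.sub h2

/-- The endomorphism algebra, as an A∞-algebra in coalgebraic form. -/
noncomputable def endCoA (A : CoA k V) (hsg : ∀ p, ∀ x ∈ gr p, A.sg x ∈ gr p)
    (hb : Deg gr gr 1 A.b) : CoA k (redMaps gr) :=
  have h1 : ∀ φ ∈ redMaps gr, A.endSg φ ∈ redMaps gr := fun _ hφ =>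
    redMaps_le (P := (redMaps gr).comap A.endSg)
      (fun p _ h => redDeg_le p (endSg_mem hsg h)) hφ
  have h2 : ∀ φ ∈ redMaps gr, A.endDiff φ ∈ redMaps gr := fun _ hφ =>
    redMaps_le (P := (redMaps gr).comap A.endDiff)
      (fun p _ h => redDeg_le (p + 1) (endDiff_mem hsg hb h rfl)) hφ
  have h3 : ∀ φ ∈ redMaps gr, ∀ ψ ∈ redMaps gr, A.endMul φ ψ ∈ redMaps gr := fun _ hφ ψ hψ =>
    redMaps_le (P := (redMaps gr).comap (A.endMul.flip ψ))
      (fun p φ h => redMaps_le (P := (redMaps gr).comap (A.endMul φ))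
        (fun q _ h' => redDeg_le (p + q) (endMul_mem hsg h h' rfl)) hψ) hφ
  ofDG (A.endSg.restrict h1) (A.endDiff.restrict h2)
    (LinearMap.mk₂ k (fun φ ψ => ⟨A.endMul φ ψ, h3 _ φ.2 _ ψ.2⟩)
      (by intros; ext; simp) (by intros; ext; simp) (by intros; ext; simp)
      (by intros; ext; simp))
    (fun φ => Subtype.ext (A.endSg_endSg φ)) (fun φ => Subtype.ext (A.endDiff_endSg φ))
    (fun φ ψ => Subtype.ext (A.endMul_endSg φ ψ)) (fun φ => Subtype.ext (A.endDiff_endDiff φ))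
    (fun φ ψ => Subtype.ext (A.endDiff_endMul φ ψ))
    (fun φ ψ χ => Subtype.ext (A.endMul_assoc φ ψ χ))

end CoA

end EndAlgebra

section EndAlgebraProperties

theorem bconv_letter_letter_cons {W : Type} [AddCommGroup W] [Module k W]
    (m : W →ₗ[k] W →ₗ[k] W) (x : W) (t : 𝕋 W) :
    bconv m (letter k W) (letter k W) (τ x * t) = m x (letter k W t) := by
  have h : ∀ (c : 𝕋 W →ₗ[k] W) (t : 𝕋 W), bconv m (lsh c x) (letter k W) t = 0 →
      bconv m c (letter k W) (τ x * t) = m (c 1) (letter k W (τ x * t)) := by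
    intro c t h
    rw [bconv_cons, h, add_zero]
  have h0 : ∀ (y : W) (t : 𝕋 W), lsh (lsh (letter k W) x) y t = 0 := by
    intro y t
    simp [lsh_apply, letter_cons, aug_cons]
  induction t using tensor_induction with
  | one => rw [bconv_cons, bconv_one, letter_one]; simp
  | cons y t _ =>
    have h1 : lsh (lsh (letter k W) x) y = 0 := by ext t; exact h0 y t
    rw [bconv_cons, bconv_cons, h1]
    simp [letter_one, lsh_apply, letter_letter]
  | add s t hs ht => rw [mul_add, map_add, hs, ht, map_add, map_add]
  | smul a s hs => rw [mul_smul_comm, map_smul, hs, map_smul, map_smul]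

namespace CoA

section OfDG

variable {W : Type} [AddCommGroup W] [Module k W] {sg m₁ : W →ₗ[k] W}
  {m₂ : W →ₗ[k] W →ₗ[k] W} {h1 : ∀ x, sg (sg x) = x} {h2 : ∀ x, m₁ (sg x) = -sg (m₁ x)}
  {h3 : ∀ x y, m₂ (sg x) (sg y) = -sg (m₂ x y)} {h4 : ∀ x, m₁ (m₁ x) = 0}
  {h5 : ∀ x y, m₁ (m₂ x y) + m₂ (m₁ x) y + m₂ (sg x) (m₁ y) = 0}
  {h6 : ∀ x y z, m₂ (m₂ x y) z + m₂ (sg x) (m₂ y z) = 0}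

theorem ofDG_b_cons (x : W) (t : 𝕋 W) : (ofDG sg m₁ m₂ h1 h2 h3 h4 h5 h6).b (τ x * t) =
    m₁ (letter k W (τ x * t)) + m₂ x (letter k W t) := by
  rw [← bconv_letter_letter_cons]; rfl

theorem ofDG_b_letter (x : W) : (ofDG sg m₁ m₂ h1 h2 h3 h4 h5 h6).b (τ x) = m₁ x := by
  have := ofDG_b_cons (h1 := h1) (h2 := h2) (h3 := h3) (h4 := h4) (h5 := h5) (h6 := h6) x 1
  simpa [letter_one, letter_letter] using this

theorem ofDG_strictUnit {u : W} (hsu : sg u = -u) (hu : m₁ u = 0) (hl : ∀ x, m₂ u x = x)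
    (hr : ∀ x, m₂ x u = -sg x) : (ofDG sg m₁ m₂ h1 h2 h3 h4 h5 h6).StrictUnit u := by
  refine ⟨hsu, fun s t => ?_⟩
  change _ = aug W s • letter k W t - aug W t • sg (letter k W s)
  induction s using tensor_induction with
  | one => rw [one_mul, ofDG_b_cons, letter_cons, map_smul, hu, hl]; simp [letter_one]
  | cons x s _ =>
    rw [mul_assoc, ofDG_b_cons, letter_cons, map_mul, aug_cons, mul_zero, zero_smul, map_zero,
      Contraction.letter_mul, letter_cons, letter_cons, aug_cons, aug_cons, zero_smul, zero_smul]
    simp only [zero_add, zero_sub, map_smul, hr]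
    rw [smul_comm, smul_neg, smul_neg]
  | add s s' hs hs' =>
    rw [add_mul, map_add, hs, hs']; simp only [map_add, add_smul, smul_add]; abel
  | smul a s hs =>
    rw [smul_mul_assoc, map_smul, hs]
    simp only [map_smul, smul_sub, smul_assoc]
    rw [smul_comm a (aug W t)]

theorem ofDG_b_cog {V : Type} [AddCommGroup V] [Module k V] {y : 𝕋 V →ₗ[k] W} (hy : y 1 = 0) :
    (ofDG sg m₁ m₂ h1 h2 h3 h4 h5 h6).b ∘ₗ cog y = m₁ ∘ₗ y + bconv m₂ y y := by
  have h : letter k W ∘ₗ cog y = y := by ext t; exact letter_cog hy t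
  change (m₁ ∘ₗ letter k W + bconv m₂ (letter k W) (letter k W)) ∘ₗ cog y = _
  rw [LinearMap.add_comp, LinearMap.comp_assoc, h, (isCoalg_cog y).bconv, h]

theorem deg_ofDG {gr : ℤ → Submodule k W} (hm₁ : ∀ p, ∀ x ∈ gr p, m₁ x ∈ gr (p + 1))
    (hm₂ : ∀ p q, ∀ x ∈ gr p, ∀ y ∈ gr q, m₂ x y ∈ gr (p + q + 1)) :
    Deg gr gr 1 (ofDG sg m₁ m₂ h1 h2 h3 h4 h5 h6).b := by
  intro n q t ht
  cases ht with
  | one => rw [b_one]; exact zero_mem _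
  | cons hx ht =>
    rw [ofDG_b_cons]
    have e1 := deg_letter _ _ _ (HWord.cons hx ht)
    have e2 := deg_letter _ _ _ ht
    rw [add_zero] at e1 e2
    exact add_mem (hm₁ _ _ e1) (hm₂ _ _ _ hx _ e2)

end OfDG

variable {V : Type} [AddCommGroup V] [Module k V] {gr : ℤ → Submodule k V} {A : CoA k V}
  (hsg : ∀ p, ∀ x ∈ gr p, A.sg x ∈ gr p) (hb : Deg gr gr 1 A.b)

theorem deg_endCoA : Deg (endGr gr) (endGr gr) 1 (A.endCoA hsg hb).b := by
  unfold endCoA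
  apply deg_ofDG
  · exact fun p φ hφ => endDiff_mem hsg hb hφ rfl
  · exact fun p q φ hφ ψ hψ => endMul_mem hsg hφ hψ (by ring)

theorem endCoA_b_letter (φ : redMaps gr) :
    ((A.endCoA hsg hb).b (τ φ) : 𝕋 V →ₗ[k] V) = A.endDiff φ := by
  rw [endCoA, ofDG_b_letter]; rfl

theorem endCoA_sg (hgr : DirectSum.IsInternal gr) (hsgn : A.sg = sgn hgr) :
    (A.endCoA hsg hb).sg = sgn (internal_endGr hgr) := by
  refine ext_gr (iSup_of_internal (internal_endGr hgr)) fun p φ hφ => ?_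
  rw [sgn_apply _ hφ]
  refine Subtype.ext (ext_HWord (iSup_of_internal hgr) fun n q t ht => ?_)
  change -A.sg ((φ : 𝕋 V →ₗ[k] V) (A.S t)) = ((-1 : k) ^ p) • (φ : 𝕋 V →ₗ[k] V) t
  rw [S, hsgn, tmap_hWord (fun p x hx => sgn_apply hgr hx) ht, map_smul, map_smul,
    sgn_apply hgr (show (φ : 𝕋 V →ₗ[k] V) t ∈ gr _ from hφ.2 n q t ht), smul_smul, ← neg_smul, zpow_add₀ (by simp), ← mul_assoc,
    neg_one_zpow_mul_self, one_mul, zpow_add₀ (by simp), zpow_one, mul_neg_one, neg_neg]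

theorem letter_S (t : 𝕋 V) : letter k V (A.S t) = A.sg (letter k V t) := by
  have : letter k V ∘ₗ A.S = A.sg ∘ₗ letter k V := by
    apply tensor_ext
    · simp [S_one, letter_one]
    · intro x t _
      simp [S_mul, S_letter, letter_cons, aug_S]
  exact LinearMap.congr_fun this t

theorem letter_mem_redDeg : letter k V ∈ redDeg gr 0 := ⟨letter_one, deg_letter⟩

theorem endCoA_strictUnit :
    (A.endCoA hsg hb).StrictUnit ⟨letter k V, redDeg_le 0 letter_mem_redDeg⟩ := by
  unfold endCoA
  apply ofDG_strictUnit
  · refine Subtype.ext (LinearMap.ext fun t => ?_)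
    change -A.sg (letter k V (A.S t)) = -letter k V t
    rw [letter_S, A.sg_sg]
  · refine Subtype.ext (LinearMap.ext fun t => ?_)
    change A.endDiff (letter k V) t = 0
    rw [endDiff_apply, letter_S, letter_D, com_letter, A.sg_sg]
    rw [← LinearMap.comp_apply, comp_pplus A.b_one, sub_self]
  · exact fun φ => Subtype.ext (A.endMul_letter _ (redMaps_one φ.2))
  · exact fun φ => Subtype.ext (A.letter_endMul _ (redMaps_one φ.2))

theorem yon_mem {n : ℕ} {q c : ℤ} {w : 𝕋 V} (hb : Deg gr gr 1 A.b) (hw : HWord gr n q w)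
    (hc : q + 1 = c) : A.yon w ∈ redDeg gr c := by
  refine ⟨A.yon_apply_one w, fun m r t ht => ?_⟩
  rw [yon_apply]
  have h1 := op_pplus _ _ _ hw
  have h2 := op_pplus _ _ _ ht
  have := hb.mem (mul_mem_TF h1 h2 le_rfl rfl)
  convert this using 2
  omega

theorem yon_mem_redMaps (hgr : DirectSum.IsInternal gr) (hb : Deg gr gr 1 A.b) (w : 𝕋 V) :
    A.yon w ∈ redMaps gr := by
  have hw : w ∈ ⨆ i : ℕ × ℤ, TF gr i.1 i.2 := iSup_TF (iSup_of_internal hgr) ▸ Submodule.mem_top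
  have : (⨆ i : ℕ × ℤ, TF gr i.1 i.2) ≤ (redMaps gr).comap A.yon := by
    refine iSup_le fun i t ht => ?_
    exact map_mem_of_TF (F := A.yon) (fun m _ t ht => redDeg_le _ (yon_mem hb ht rfl)) ht
  exact this hw

/-- The Yoneda morphism, with values in the endomorphism algebra. -/
noncomputable def yonRed (A : CoA k V) (hgr : DirectSum.IsInternal gr) (hb : Deg gr gr 1 A.b) :
    𝕋 V →ₗ[k] redMaps gr := A.yon.codRestrict _ (yon_mem_redMaps hgr hb)

theorem deg_yonRed (hgr : DirectSum.IsInternal gr) : Deg gr (endGr gr) 0 (A.yonRed hgr hb) := by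
  intro n q t ht
  rw [add_zero]
  exact yon_mem hb ht rfl

theorem yonRed_one (hgr : DirectSum.IsInternal gr) : A.yonRed hgr hb 1 = 0 :=
  Subtype.ext A.yon_one

theorem endCoA_b_cog (hgr : DirectSum.IsInternal gr) (t : 𝕋 V) :
    (A.endCoA hsg hb).b (cog (A.yonRed hgr hb) t) = A.yonRed hgr hb (A.D t) := by
  apply Subtype.ext
  rw [endCoA, ← LinearMap.comp_apply, ofDG_b_cog (yonRed_one hb hgr)]
  have h := LinearMap.congr_fun A.yon_comp_D t
  refine Eq.trans ?_ h.symm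
  rw [LinearMap.add_apply, LinearMap.add_apply, Submodule.coe_add]
  congr 1
  exact LinearMap.congr_fun (comp_bconv_congr (θ := (redMaps gr).subtype) (θ' := LinearMap.id)
    (fun s t => rfl)) t

end CoA

end EndAlgebraProperties

/-! ### The Yoneda morphism of a homologically unital A∞-algebra -/

namespace CoA

section HomologicalUnit

variable {V : Type} [AddCommGroup V] [Module k V] {gr : ℤ → Submodule k V} {A : CoA k V}

theorem b_letter_mem (hb : Deg gr gr 1 A.b) (p : ℤ) (x : V) (hx : x ∈ gr p) :
    A.b (τ x) ∈ gr (p + 1) := hb _ _ _ (HWord.letter hx)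

theorem b_two_mem (hb : Deg gr gr 1 A.b) {p q c : ℤ} {x y : V} (hx : x ∈ gr p) (hy : y ∈ gr q)
    (hc : p + q + 1 = c) : A.b (τ x * τ y) ∈ gr c :=
  hc ▸ hb _ _ _ (HWord.cons hx (HWord.letter hy))

theorem b_b_letter (x : V) : A.b (τ (A.b (τ x))) = 0 := by rw [← D_letter, b_D]

theorem exists_left_homotopy (hgr : DirectSum.IsInternal gr) (hb : Deg gr gr 1 A.b) {e : V}
    (heg : e ∈ gr (-1)) (he : A.sg e = -e) (hde : A.b (τ e) = 0)
    (hl : ∀ p, ∀ x ∈ gr p, A.b (τ x) = 0 → ∃ z, A.b (τ e * τ x) - x = A.b (τ z)) :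
    ∃ s : V →ₗ[k] V, (∀ p, ∀ x ∈ gr p, s x ∈ gr (p + -1)) ∧
      ∀ x, A.b (τ e * τ x) = x + A.b (τ (s x)) + s (A.b (τ x)) := by
  have hcd : ∀ x, A.b (τ (A.b (τ e * τ x))) = A.b (τ e * τ (A.b (τ x))) := by
    intro x
    have h1 := A.b_D (τ e * τ x)
    rw [D_cons_yon, hde, he, com_singleton, yon_apply, pplus_letter, pplus_letter, D_letter] at h1
    simp only [map_zero, zero_mul, zero_add, map_add, map_neg, neg_mul] at h1
    exact add_neg_eq_zero.1 h1
  obtain ⟨s, hs, h⟩ := exists_null_homotopy hgr (d := A.b ∘ₗ τ) (b_letter_mem hb) b_b_letter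
    (c := A.b ∘ₗ LinearMap.mulLeft k (τ e) ∘ₗ τ - LinearMap.id)
    (fun p x hx => sub_mem (b_two_mem hb heg hx (by ring)) hx) (fun x => by simp [hcd]) hl
  refine ⟨s, hs, fun x => (sub_eq_iff_eq_add.1 (h x)).trans ?_⟩
  simp only [LinearMap.comp_apply, LinearMap.id_apply]
  abel

theorem exists_right_homotopy (hgr : DirectSum.IsInternal gr) (hsg : A.sg = sgn hgr)
    (hb : Deg gr gr 1 A.b) {e : V} (heg : e ∈ gr (-1)) (hde : A.b (τ e) = 0)
    (hr : ∀ p, ∀ x ∈ gr p, A.b (τ x) = 0 →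
      ∃ z, (-1 : k) ^ (p + 1) • A.b (τ x * τ e) - x = A.b (τ z)) :
    ∃ s : V →ₗ[k] V, (∀ p, ∀ x ∈ gr p, s x ∈ gr (p + -1)) ∧
      ∀ x, -A.b (τ (A.sg x) * τ e) = x + A.b (τ (s x)) + s (A.b (τ x)) := by
  have hcd : ∀ x, A.b (τ (A.b (τ (A.sg x) * τ e))) = A.b (τ (A.sg (A.b (τ x))) * τ e) := by
    intro x
    have h1 := A.b_D (τ (A.sg x) * τ e)
    rw [D_cons_yon, com_singleton, yon_apply, pplus_letter, pplus_letter, D_letter, hde,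
      b_letter_sg] at h1
    simp only [map_zero, mul_zero, add_zero, map_add, map_neg, neg_mul] at h1
    exact (neg_add_eq_zero.1 h1).symm
  obtain ⟨s, hs, h⟩ := exists_null_homotopy hgr (d := A.b ∘ₗ τ) (b_letter_mem hb) b_b_letter
    (c := -(A.b ∘ₗ LinearMap.mulRight k (τ e) ∘ₗ τ ∘ₗ A.sg) - LinearMap.id)
    (fun p x hx => sub_mem (neg_mem (b_two_mem hb (hsg ▸ sgn_mem hgr p x hx) heg (by ring))) hx)
    (fun x => by simp [hcd]) (fun p x hx hdx => by
      obtain ⟨z, hz⟩ := hr p x hx hdx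
      refine ⟨z, hz ▸ ?_⟩
      change -A.b (τ (A.sg x) * τ e) - x = _
      rw [hsg, sgn_apply hgr hx, zpow_add₀ (by simp)]
      simp)
  refine ⟨s, hs, fun x => (sub_eq_iff_eq_add.1 (h x)).trans ?_⟩
  simp only [LinearMap.comp_apply, LinearMap.id_apply]
  abel

theorem exists_yon_inverse (hgr : DirectSum.IsInternal gr)
    (hb : Deg gr gr 1 A.b) {e : V} (heg : e ∈ gr (-1)) {s : V →ₗ[k] V}
    (hs : ∀ p, ∀ x ∈ gr p, s x ∈ gr (p + -1))
    (h : ∀ x, A.b (τ e * τ x) = x + A.b (τ (s x)) + s (A.b (τ x))) :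
    ∃ R : 𝕋 V →ₗ[k] 𝕋 V,
      (LinearMap.id - com (letter k V + A.b ∘ₗ com (s ∘ₗ letter k V) + s ∘ₗ A.b
        - A.yon (τ e))) ∘ₗ R = LinearMap.id ∧
      R ∘ₗ (LinearMap.id - com (letter k V + A.b ∘ₗ com (s ∘ₗ letter k V) + s ∘ₗ A.b
        - A.yon (τ e))) = LinearMap.id ∧ Op gr gr 0 R := by
  refine exists_inverse (iSup_of_internal hgr) (com_one _) fun n q t ht => ?_
  have h1 : Deg gr gr 0 (letter k V + A.b ∘ₗ com (s ∘ₗ letter k V) + s ∘ₗ A.b - A.yon (τ e)) := by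
    refine Deg.sub (Deg.add (Deg.add deg_letter ?_) ?_) ?_
    · exact hb.comp_op (Deg.map hs deg_letter (zero_add _)).com (by ring)
    · exact Deg.map hs hb (by ring)
    · exact (yon_mem hb (HWord.letter heg) (by ring)).2
  have := h1.com_lower (fun x => ?_) ht
  · rwa [add_zero] at this
  · have h2 := h x
    simp only [LinearMap.sub_apply, LinearMap.add_apply, LinearMap.comp_apply, com_singleton,
      letter_letter, yon_apply, pplus_letter, h2, sub_self]

theorem exists_yon_sub_mem (hgr : DirectSum.IsInternal gr) (hsg : A.sg = sgn hgr)
    (hb : Deg gr gr 1 A.b) {e : V} (heg : e ∈ gr (-1)) (hde : A.b (τ e) = 0)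
    (hl : ∀ p, ∀ x ∈ gr p, A.b (τ x) = 0 → ∃ z, A.b (τ e * τ x) - x = A.b (τ z))
    (hr : ∀ p, ∀ x ∈ gr p, A.b (τ x) = 0 →
      ∃ z, (-1 : k) ^ (p + 1) • A.b (τ x * τ e) - x = A.b (τ z))
    {p : ℤ} {φ : 𝕋 V →ₗ[k] V} (hφ : φ ∈ redDeg gr (p + 1)) (hdφ : A.endDiff φ = 0) :
    ∃ x ∈ gr p, A.b (τ x) = 0 ∧ ∃ θ ∈ redDeg gr p, A.yon (τ x) - φ = A.endDiff θ := by
  have hsg' : ∀ p, ∀ x ∈ gr p, A.sg x ∈ gr p := by rw [hsg]; exact sgn_mem hgr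
  have he : A.sg e = -e := by rw [hsg, sgn_apply hgr heg]; simp
  obtain ⟨s, hs, h⟩ := exists_left_homotopy hgr hb heg he hde hl
  obtain ⟨s', hs', h'⟩ := exists_right_homotopy hgr hsg hb heg hde hr
  obtain ⟨R, hR1, hR2, hR⟩ := exists_yon_inverse hgr hb heg hs h
  have hz : φ (τ e) ∈ gr p := by
    have := hφ.2 _ _ _ (HWord.letter heg)
    convert this using 2
    ring
  have hx : -A.sg (φ (τ e)) ∈ gr p := neg_mem (hsg' _ _ hz)
  refine ⟨_, hx, ?_, _, ?_, exists_yon_sub_eq he hde (fun x => ?_) h' hR1 hR2 hφ.1 hdφ⟩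
  · have := LinearMap.congr_fun hdφ (τ e)
    rw [endDiff_apply, D_letter, hde, com_singleton] at this
    have h0 : A.b (τ (φ (τ e))) = 0 := by simpa using this
    rw [map_neg, map_neg, b_letter_sg, h0, map_zero, neg_zero, neg_zero]
  · have sgdeg : ∀ {r : ℤ} {χ : 𝕋 V →ₗ[k] V}, Deg gr gr r χ → Deg gr gr r (A.sg ∘ₗ χ) :=
      fun h => Deg.map (s := 0) (gr' := gr) (by simpa using hsg') h (add_zero _)
    have hins : ∀ {χ : 𝕋 V →ₗ[k] V}, Deg gr gr (p + 1) χ → Deg gr gr p (ins e χ) :=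
      fun h => (h.lsh heg (c := p) (by ring)).comp_op op_pplus (zero_add p)
    refine ⟨by rw [LinearMap.comp_apply, com_one, map_zero], Deg.comp_op ?_
      ((deg_letter.comp_op hR (zero_add 0)).com) (zero_add p)⟩
    refine Deg.sub (Deg.sub (Deg.add (hins ?_) ?_) (hins ?_)) ?_
    · exact sgdeg (hφ.2.comp_op (op_S hsg') (zero_add _))
    · exact (yon_mem hb (HWord.letter (hs' _ _ hx)) (by ring)).2
    · exact (yon_mem hb (HWord.letter hz) rfl).2
    · refine sgdeg (Deg.comp_op (hφ.2.sub (yon_mem hb (HWord.letter hx) rfl).2) (s := -1)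
        ((op_S hsg').comp (Deg.map hs deg_letter (zero_add _)).com (by ring)) (by ring))
  · rw [hsg, sgn_comm hgr hgr hs]
    simp

theorem exists_eq_b_letter (hgr : DirectSum.IsInternal gr) (hsg : A.sg = sgn hgr)
    (hb : Deg gr gr 1 A.b) {e : V} (heg : e ∈ gr (-1)) (hde : A.b (τ e) = 0)
    (hr : ∀ p, ∀ x ∈ gr p, A.b (τ x) = 0 →
      ∃ z, (-1 : k) ^ (p + 1) • A.b (τ x * τ e) - x = A.b (τ z))
    {p : ℤ} {x : V} (hx : x ∈ gr p) (hdx : A.b (τ x) = 0) {θ : 𝕋 V →ₗ[k] V}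
    (hθ : θ ∈ redDeg gr p) (h : A.yon (τ x) = A.endDiff θ) :
    ∃ z ∈ gr (p - 1), x = A.b (τ z) := by
  have he : A.sg e = -e := by rw [hsg, sgn_apply hgr heg]; simp
  obtain ⟨s', hs', h'⟩ := exists_right_homotopy hgr hsg hb heg hde hr
  refine ⟨_, ?_, eq_b_of_yon_eq he hde h' hdx h⟩
  have h1 := hθ.2 _ _ _ (HWord.letter heg)
  have h2 := sgn_mem hgr _ _ h1
  rw [← hsg, neg_add_eq_sub] at h2
  exact neg_mem (add_mem h2 (hs' _ _ hx))

end HomologicalUnit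

end CoA

namespace CoA

section StrictUnitalModels

variable {V : Type} [AddCommGroup V] [Module k V] {gr : ℤ → Submodule k V} {A : CoA k V}

/-- A strictly unital A∞-algebra whose unit is not a boundary contracts onto its homology,
compatibly with the unit. -/
theorem exists_minimal_strictUnit (hgr : DirectSum.IsInternal gr) (hsg : A.sg = sgn hgr)
    (hb : Deg gr gr 1 A.b) {u : V} (hug : u ∈ gr (-1)) (hu : A.StrictUnit u)
    (hu' : u ∉ LinearMap.range (A.b ∘ₗ τ)) :
    ∃ (B : AInfAlg k) (C : CoA k B.M) (f : 𝕋 V →ₗ[k] B.M) (v : B.M) (h : V →ₗ[k] V)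
      (i : B.M →ₗ[k] V), B.b = nary C.b ∧ IsStrictUnit B.M B.gr B.b v ∧
      Deg gr B.gr 0 f ∧ f 1 = 0 ∧ (∀ t, C.b (cog f t) = f (A.D t)) ∧
      (∀ p, ∀ x ∈ B.gr p, i x ∈ gr p) ∧
      (∀ x, A.b (τ (h x)) + h (A.b (τ x)) = x - i (f (τ x))) ∧ (∀ x, A.b (τ (i x)) = 0) ∧
      (∀ x, f (τ (i x)) = x) ∧ ∀ x, f (τ (A.b (τ x))) = 0 := by
  have hsg' : ∀ p, ∀ x ∈ gr p, A.sg x ∈ gr p := by rw [hsg]; exact sgn_mem hgr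
  obtain ⟨h, hh, hdhd, hhdh, hhh, hhu⟩ := exists_splitting hgr (d := A.b ∘ₗ τ) (b_letter_mem hb)
    b_b_letter hug hu.b_letter (Or.inr hu')
  simp only [LinearMap.comp_apply] at hdhd hhdh
  let Q : V →ₗ[k] V := LinearMap.id - A.b ∘ₗ τ ∘ₗ h - h ∘ₗ A.b ∘ₗ τ
  have hQ : ∀ x, Q x = x - A.b (τ (h x)) - h (A.b (τ x)) := fun x => rfl
  have hQ_mem : ∀ p, ∀ x ∈ gr p, Q x ∈ gr p := by
    intro p x hx
    have h1 := b_letter_mem hb _ _ (hh p x hx)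
    have h2 := hh _ _ (b_letter_mem hb p x hx)
    rw [neg_add_cancel_right] at h1
    rw [add_neg_cancel_right] at h2
    exact sub_mem (sub_mem hx h1) h2
  have hbQ : ∀ x, A.b (τ (Q x)) = 0 := by
    intro x; simp [hQ, hdhd, b_b_letter]
  have hhQ : ∀ x, h (Q x) = 0 := by
    intro x; simp [hQ, hhdh, hhh]
  have hQb : ∀ x, Q (A.b (τ x)) = 0 := by
    intro x; simp [hQ, hdhd, b_b_letter]
  have hQh : ∀ x, Q (h x) = 0 := by
    intro x; simp [hQ, hhdh, hhh]
  have hQQ : ∀ x, Q (Q x) = Q x := by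
    intro x; rw [hQ (Q x), hbQ, hhQ]; simp
  have hsgh : ∀ x, A.sg (h x) = -h (A.sg x) := by
    intro x; rw [hsg, sgn_comm hgr hgr hh]; simp
  let H := LinearMap.range Q
  have hHgr : DirectSum.IsInternal fun p => (gr p).comap H.subtype := by
    refine internal_comap hgr.submodule_iSupIndep ?_
    rintro _ ⟨x, rfl⟩
    have hx : x ∈ ⨆ p, gr p := iSup_of_internal hgr ▸ Submodule.mem_top
    have : (⨆ p, gr p) ≤ (⨆ p, H ⊓ gr p).comap Q := iSup_le fun p x hx =>
      Submodule.mem_iSup_of_mem p ⟨⟨x, rfl⟩, hQ_mem p x hx⟩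
    exact this hx
  have hQH : ∀ x : H, Q x = x := by
    rintro ⟨_, x, rfl⟩; exact hQQ x
  let K : Contraction A H :=
    { sg := sgn hHgr
      pr := Q.rangeRestrict
      inc := H.subtype
      h := h
      pr_inc := fun x => Subtype.ext (hQH x)
      htpy := fun x => by
        change _ = x - Q x
        rw [hQ]; abel
      b_inc := by rintro ⟨_, x, rfl⟩; exact hbQ x
      pr_b := fun x => Subtype.ext (hQb x)
      h_h := hhh
      h_inc := by rintro ⟨_, x, rfl⟩; exact hhQ x
      pr_h := fun x => Subtype.ext (hQh x)
      pr_sg := fun x => by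
        rw [hsg, sgn_comm hgr hHgr (r := 0) (by intro p x hx; rw [add_zero]; exact hQ_mem p x hx)]
        simp
      sg_inc := fun x => by
        rw [hsg, sgn_comm hHgr hgr (r := 0) (by intro p x hx; rw [add_zero]; exact hx)]
        simp
      sg_h := hsgh }
  have hiu : K.inc (K.pr u) = u := by
    change Q u = u
    rw [hQ, hu.b_letter, hhu]; simp
  obtain ⟨C, f, hCsg, hCb, hf, hf1, hfD, hCu, hfx⟩ := K.exists_transfer
    (grH := fun p => (gr p).comap H.subtype) (iSup_of_internal hgr) hb hsg' hh hQ_mem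
    (fun p x hx => hx) hu hhu hiu
  have hpr : ∀ x, f (τ x) = Q.rangeRestrict x := hfx
  have htpy : ∀ x, A.b (τ (h x)) + h (A.b (τ x)) = x - H.subtype (f (τ x)) := by
    intro x; rw [hpr]; exact K.htpy x
  have hfi : ∀ x : H, f (τ (H.subtype x)) = x := by
    intro x; rw [hpr]; exact K.pr_inc x
  have hfb : ∀ x, f (τ (A.b (τ x))) = 0 := by
    intro x; rw [hpr]; exact K.pr_b x
  exact ⟨C.toAInfAlg hHgr hCsg hCb, C, f, K.pr u, h, H.subtype, rfl,
    hCu.isStrictUnit hHgr hCsg (hQ_mem _ _ hug), hf, hf1, hfD, fun p x hx => hx, htpy, K.b_inc, hfi,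
    hfb⟩

theorem subsingleton_of_letter_eq_endDiff (hgr : DirectSum.IsInternal gr) (hsg : A.sg = sgn hgr)
    (hb : Deg gr gr 1 A.b) {e : V} (heg : e ∈ gr (-1)) (hd : ∀ x, A.b (τ x) = 0)
    (hr : ∀ p, ∀ x ∈ gr p, A.b (τ x) = 0 →
      ∃ z, (-1 : k) ^ (p + 1) • A.b (τ x * τ e) - x = A.b (τ z))
    {w : 𝕋 V →ₗ[k] V} (hw : letter k V = A.endDiff w) : Subsingleton V := by
  have he : A.sg e = -e := by rw [hsg, sgn_apply hgr heg]; simp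
  obtain ⟨s', -, h'⟩ := exists_right_homotopy hgr hsg hb heg (hd e) hr
  refine subsingleton_of_forall_eq 0 fun x => ?_
  have h1 : A.endDiff (A.yon (τ x)) = 0 := by rw [← yon_letter_b, hd, map_zero, map_zero]
  have h2 := A.endDiff_endMul w (A.yon (τ x))
  rw [← hw, A.endMul_letter _ (A.yon_apply_one _), h1, map_zero, add_zero] at h2
  rw [eq_b_of_yon_eq he (hd e) h' (hd x) (θ := -A.endMul w (A.yon (τ x)))
    (by rw [map_neg]; exact eq_neg_of_add_eq_zero_right h2), hd]

end StrictUnitalModels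

end CoA

namespace CoA

/-- A morphism of A∞-algebras induces a morphism of bar constructions. -/
theorem cog_D {V W : Type} [AddCommGroup V] [Module k V] [AddCommGroup W] [Module k W]
    {A : CoA k V} {U : CoA k W} {y : 𝕋 V →ₗ[k] W} (hy : y 1 = 0)
    (hS : ∀ t, y (A.S t) = U.sg (y t)) (h : ∀ t, U.b (cog y t) = y (A.D t)) (t : 𝕋 V) :
    cog y (A.D t) = U.D (cog y t) := by
  have hX : cog y ∘ₗ A.D = conv (τ ∘ₗ y ∘ₗ A.D) (cog y) + pconv (τ ∘ₗ y ∘ₗ A.S) (cog y ∘ₗ A.D) := by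
    conv_lhs => rw [cog_eq y]
    have h := pconv_coder (isCoalg_id) A.b A.sg (τ ∘ₗ y) (cog y)
    rw [LinearMap.add_comp, D, uaug_coder, zero_add, h, pplus_coder]
    rfl
  have hY : U.D ∘ₗ cog y = conv (τ ∘ₗ y ∘ₗ A.D) (cog y) + pconv (τ ∘ₗ y ∘ₗ A.S) (U.D ∘ₗ cog y) := by
    conv_lhs => rw [D, coder_eq, LinearMap.add_comp, com, (isCoalg_cog y).pconv,
      (isCoalg_cog y).pconv]
    have e1 : (τ ∘ₗ U.b) ∘ₗ cog y = τ ∘ₗ y ∘ₗ A.D := by ext1 t; simp [h]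
    have e2 : (τ ∘ₗ U.sg ∘ₗ letter k W) ∘ₗ cog y = τ ∘ₗ y ∘ₗ A.S := by
      ext1 t; simp [letter_cog hy, hS]
    rw [e1, e2, LinearMap.id_comp]
    congr 1
    rw [pconv, comp_pplus]
    simp [A.D_one]
  have h0 : cog y ∘ₗ A.D - U.D ∘ₗ cog y = 0 := by
    apply eq_zero_of_eq_pconv (φ := τ ∘ₗ y ∘ₗ A.S)
    conv_lhs => rw [hX, hY, add_sub_add_left_eq_sub]
    simp [pconv, conv]
  exact LinearMap.congr_fun (sub_eq_zero.1 h0) t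

/-- Homogeneous maps of degree zero commute with the sign operators. -/
theorem apply_S_of_deg {V W : Type} [AddCommGroup V] [Module k V] [AddCommGroup W] [Module k W]
    {A : CoA k V} {gr : ℤ → Submodule k V} {gr' : ℤ → Submodule k W} (hgr : DirectSum.IsInternal gr)
    (hgr' : DirectSum.IsInternal gr') (hsg : A.sg = sgn hgr) {y : 𝕋 V →ₗ[k] W}
    (hy : Deg gr gr' 0 y) (t : 𝕋 V) : y (A.S t) = sgn hgr' (y t) := by
  have : y ∘ₗ A.S = sgn hgr' ∘ₗ y := by
    refine ext_HWord (iSup_of_internal hgr) fun n q t ht => ?_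
    have h := hy _ _ _ ht
    rw [add_zero] at h
    rw [LinearMap.comp_apply, LinearMap.comp_apply, sgn_apply hgr' h, S, hsg,
      tmap_hWord (fun p x hx => sgn_apply hgr hx) ht, map_smul]
  exact LinearMap.congr_fun this t

end CoA

namespace CoA

section Main

variable {V : Type} [AddCommGroup V] [Module k V] {gr : ℤ → Submodule k V} {A : CoA k V}

theorem b_yonRed_letter (hgr : DirectSum.IsInternal gr) (hsg : ∀ p, ∀ x ∈ gr p, A.sg x ∈ gr p)
    (hb : Deg gr gr 1 A.b) (x : V) :
    (A.endCoA hsg hb).b (τ (A.yonRed hgr hb (τ x))) = A.yonRed hgr hb (τ (A.b (τ x))) := by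
  refine Subtype.ext ?_
  rw [endCoA_b_letter]
  exact (A.yon_letter_b x).symm

/-- The Yoneda morphism is surjective on homology. -/
theorem exists_yonRed_sub_eq (hgr : DirectSum.IsInternal gr) (hsg : A.sg = sgn hgr)
    (hsg' : ∀ p, ∀ x ∈ gr p, A.sg x ∈ gr p)
    (hb : Deg gr gr 1 A.b) {e : V} (heg : e ∈ gr (-1)) (hde : A.b (τ e) = 0)
    (hl : ∀ p, ∀ x ∈ gr p, A.b (τ x) = 0 → ∃ z, A.b (τ e * τ x) - x = A.b (τ z))
    (hr : ∀ p, ∀ x ∈ gr p, A.b (τ x) = 0 →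
      ∃ z, (-1 : k) ^ (p + 1) • A.b (τ x * τ e) - x = A.b (τ z))
    {p : ℤ} {φ : redMaps gr} (hφ : φ ∈ endGr gr p) (hdφ : (A.endCoA hsg' hb).b (τ φ) = 0) :
    ∃ x ∈ gr p, A.b (τ x) = 0 ∧ ∃ z ∈ endGr gr (p - 1),
      A.yonRed hgr hb (τ x) - φ = (A.endCoA hsg' hb).b (τ z) := by
  have h0 := congrArg Subtype.val hdφ
  rw [endCoA_b_letter] at h0
  obtain ⟨x, hx, hdx, θ, hθ, h⟩ := exists_yon_sub_mem hgr hsg hb heg hde hl hr hφ h0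
  refine ⟨x, hx, hdx, ⟨θ, redDeg_le _ hθ⟩, ?_, Subtype.ext ?_⟩
  · change θ ∈ redDeg gr (p - 1 + 1)
    rwa [sub_add_cancel]
  · rw [endCoA_b_letter]; exact h

/-- The Yoneda morphism is injective on homology. -/
theorem exists_eq_b_letter_of_yonRed_eq (hgr : DirectSum.IsInternal gr) (hsg : A.sg = sgn hgr)
    (hsg' : ∀ p, ∀ x ∈ gr p, A.sg x ∈ gr p)
    (hb : Deg gr gr 1 A.b) {e : V} (heg : e ∈ gr (-1)) (hde : A.b (τ e) = 0)
    (hr : ∀ p, ∀ x ∈ gr p, A.b (τ x) = 0 →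
      ∃ z, (-1 : k) ^ (p + 1) • A.b (τ x * τ e) - x = A.b (τ z))
    {p : ℤ} {x : V} (hx : x ∈ gr p) (hdx : A.b (τ x) = 0) {w : redMaps gr}
    (hw : w ∈ endGr gr (p - 1)) (h : A.yonRed hgr hb (τ x) = (A.endCoA hsg' hb).b (τ w)) :
    ∃ z ∈ gr (p - 1), x = A.b (τ z) := by
  have h' := congrArg Subtype.val h
  rw [endCoA_b_letter] at h'
  have hw' : (w : 𝕋 V →ₗ[k] V) ∈ redDeg gr (p - 1 + 1) := hw
  rw [sub_add_cancel] at hw'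
  exact exists_eq_b_letter hgr hsg hb heg hde hr hx hdx hw' h'

/-- A minimal homologically unital A∞-algebra is isomorphic to a strictly unital one. -/
theorem exists_strictUnit_bijective (hgr : DirectSum.IsInternal gr) (hsg : A.sg = sgn hgr)
    (hb : Deg gr gr 1 A.b) {e : V} (heg : e ∈ gr (-1)) (hd : ∀ x, A.b (τ x) = 0)
    (hl : ∀ p, ∀ x ∈ gr p, A.b (τ x) = 0 → ∃ z, A.b (τ e * τ x) - x = A.b (τ z))
    (hr : ∀ p, ∀ x ∈ gr p, A.b (τ x) = 0 →
      ∃ z, (-1 : k) ^ (p + 1) • A.b (τ x * τ e) - x = A.b (τ z)) (hV : Nontrivial V) :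
    ∃ (B : AInfAlg k) (v : B.M) (f : 𝕋 V →ₗ[k] B.M), IsStrictUnit B.M B.gr B.b v ∧
      IsAInfMorphism k V gr (nary A.b) B.M B.gr B.b (nary f) ∧ Bijective fun x => f (τ x) := by
  have hsg' : ∀ p, ∀ x ∈ gr p, A.sg x ∈ gr p := by rw [hsg]; exact sgn_mem hgr
  have he : A.sg e = -e := by rw [hsg, sgn_apply hgr heg]; simp
  have hu : (⟨letter k V, redDeg_le 0 letter_mem_redDeg⟩ : redMaps gr) ∉
      LinearMap.range ((A.endCoA hsg' hb).b ∘ₗ τ) := by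
    rintro ⟨w, hw⟩
    have h := congrArg Subtype.val hw
    rw [LinearMap.comp_apply, endCoA_b_letter] at h
    exact not_subsingleton V (subsingleton_of_letter_eq_endDiff hgr hsg hb heg hd hr h.symm)
  obtain ⟨B, C, f, v, h, i, hBC, hv, hf, hf1, hfD, hi, htpy, hbi, hfi, hfb⟩ :=
    exists_minimal_strictUnit (internal_endGr hgr) (endCoA_sg hsg' hb hgr hsg) (deg_endCoA hsg' hb)
      (show _ ∈ redDeg gr (-1 + 1) from letter_mem_redDeg) (endCoA_strictUnit hsg' hb) hu
  have hy : Deg gr (endGr gr) 0 (A.yonRed hgr hb) := deg_yonRed hb hgr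
  have hy1 : A.yonRed hgr hb 1 = 0 := yonRed_one hb hgr
  have hyS : ∀ t, A.yonRed hgr hb (A.S t) = (A.endCoA hsg' hb).sg (A.yonRed hgr hb t) := by
    rw [endCoA_sg hsg' hb hgr hsg]
    exact apply_S_of_deg hgr (internal_endGr hgr) hsg hy
  have hyD := cog_D hy1 hyS (endCoA_b_cog hsg' hb hgr)
  have hcog : ∀ x, cog (A.yonRed hgr hb) (τ x) = τ (A.yonRed hgr hb (τ x)) := by
    intro x
    have h := cog_cons' (A.yonRed hgr hb) x 1
    rw [mul_one, bconv_one, cog_one] at h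
    rw [h]
    simp [lsh_apply]
  refine ⟨B, v, f ∘ₗ cog (A.yonRed hgr hb), hv, ?_, ?_, ?_⟩
  · rw [hBC]
    refine isAInfMorphism_nary hgr hsg (by simp [cog_one, hf1])
      (hf.comp_op (op_cog hy) (add_zero 0)) fun t => ?_
    rw [← cog_comp, LinearMap.comp_apply, hfD, LinearMap.comp_apply, hyD]
  · have hinj : LinearMap.ker (f ∘ₗ cog (A.yonRed hgr hb) ∘ₗ τ) = ⊥ := by
      refine LinearMap.ker_eq_bot'.2 fun x hx => ?_
      rw [LinearMap.comp_apply, LinearMap.comp_apply, hcog] at hx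
      have h1 := htpy (A.yonRed hgr hb (τ x))
      rw [b_yonRed_letter, hd, map_zero, map_zero, map_zero, add_zero, hx, map_zero,
        sub_zero] at h1
      have h2 := congrArg Subtype.val h1
      rw [endCoA_b_letter] at h2
      obtain ⟨s', -, h'⟩ := exists_right_homotopy hgr hsg hb heg (hd e) hr
      rw [eq_b_of_yon_eq he (hd e) h' (hd x) h2.symm, hd]
    exact LinearMap.ker_eq_bot.1 hinj
  · have hsurj : LinearMap.range (f ∘ₗ cog (A.yonRed hgr hb) ∘ₗ τ) = ⊤ := by
      rw [eq_top_iff, ← iSup_of_internal B.internal]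
      refine iSup_le fun p y hyp => ?_
      obtain ⟨x, -, -, z, -, hz⟩ := exists_yonRed_sub_eq hgr hsg hsg' hb heg (hd e) hl hr
        (hi p y hyp) (hbi y)
      refine ⟨x, ?_⟩
      rw [LinearMap.comp_apply, LinearMap.comp_apply, hcog, sub_eq_iff_eq_add.1 hz, map_add,
        map_add, hfb, hfi, zero_add]
    exact LinearMap.range_eq_top.1 hsurj

end Main

end CoA

/-- **Statement 14 (Lefèvre 3.2.1).**  A homologically unital A∞-algebra is
A∞-quasi-isomorphic to a strictly unital one; if it is moreover minimal (`b₁ = 0`),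
it is even A∞-isomorphic (first component bijective) to a strictly unital one. -/
theorem homologically_unital_is_quasi_isomorphic_to_strictly_unital
    (A : AInfAlg k) (hu : IsHomologicallyUnital A) :
    (∃ B : AInfAlg k, (∃ e : B.M, IsStrictUnit B.M B.gr B.b e) ∧
      ∃ f : ∀ n : ℕ, (Fin n → A.M) → B.M,
        IsAInfMorphism k A.M A.gr A.b B.M B.gr B.b f ∧
        -- `f` is an A∞-quasi-isomorphism: `f₁` is surjective on homology …
        (∀ (p : ℤ) (y : B.M), y ∈ B.gr p → B.b 1 (fun _ => y) = 0 →
          ∃ x ∈ A.gr p, A.b 1 (fun _ => x) = 0 ∧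
            ∃ z ∈ B.gr (p - 1), f 1 (fun _ => x) - y = B.b 1 fun _ => z) ∧
        -- … and injective on homology:
        (∀ (p : ℤ) (x : A.M), x ∈ A.gr p → A.b 1 (fun _ => x) = 0 →
          (∃ w ∈ B.gr (p - 1), f 1 (fun _ => x) = B.b 1 fun _ => w) →
          ∃ z ∈ A.gr (p - 1), x = A.b 1 fun _ => z)) ∧
    (A.b 1 = 0 →
      ∃ B : AInfAlg k, (∃ e : B.M, IsStrictUnit B.M B.gr B.b e) ∧
        ∃ f : ∀ n : ℕ, (Fin n → A.M) → B.M,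
          IsAInfMorphism k A.M A.gr A.b B.M B.gr B.b f ∧
          Function.Bijective (fun x => f 1 fun _ => x)) := by
  obtain ⟨C, hC, hsg, hb⟩ := A.exists_coA
  have hsg' : ∀ p, ∀ x ∈ A.gr p, C.sg x ∈ A.gr p := by rw [hsg]; exact sgn_mem A.internal
  obtain ⟨e, heg, hde, hunit⟩ := hu
  simp only [hC, nary_one, nary_two] at hde hunit
  have hl : ∀ p, ∀ x ∈ A.gr p, C.b (τ x) = 0 → ∃ z, C.b (τ e * τ x) - x = C.b (τ z) := by
    intro p x hx hdx
    obtain ⟨⟨z, -, hz⟩, -⟩ := hunit p x hx hdx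
    exact ⟨z, hz⟩
  have hr : ∀ p, ∀ x ∈ A.gr p, C.b (τ x) = 0 →
      ∃ z, (-1 : k) ^ (p + 1) • C.b (τ x * τ e) - x = C.b (τ z) := by
    intro p x hx hdx
    obtain ⟨-, z, -, hz⟩ := hunit p x hx hdx
    exact ⟨z, hz⟩
  constructor
  · refine ⟨(C.endCoA hsg' hb).toAInfAlg (internal_endGr A.internal)
      (CoA.endCoA_sg hsg' hb A.internal hsg) (CoA.deg_endCoA hsg' hb), ⟨_,
        (CoA.endCoA_strictUnit hsg' hb).isStrictUnit (internal_endGr A.internal)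
          (CoA.endCoA_sg hsg' hb A.internal hsg)
          (show _ ∈ redDeg A.gr (-1 + 1) from CoA.letter_mem_redDeg)⟩,
      nary (C.yonRed A.internal hb), ?_, fun p y hy hdy => ?_, fun p x hx hdx hw => ?_⟩
    · rw [hC]
      exact isAInfMorphism_nary A.internal hsg (CoA.yonRed_one hb A.internal)
        (CoA.deg_yonRed hb A.internal) (CoA.endCoA_b_cog hsg' hb A.internal)
    · replace hdy := (nary_one _ _).symm.trans hdy
      obtain ⟨x, hx, hdx, z, hz, h⟩ := CoA.exists_yonRed_sub_eq A.internal hsg hsg' hb heg hde hl hr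
        hy hdy
      refine ⟨x, hx, by rw [hC, nary_one, hdx], z, hz, ?_⟩
      exact (congrArg (fun t : redMaps A.gr => Sub.sub t y) (nary_one _ x)).trans
        (h.trans (nary_one _ _).symm)
    · rw [hC, nary_one] at hdx
      obtain ⟨w, hw, h⟩ := hw
      obtain ⟨z, hz, hxz⟩ := CoA.exists_eq_b_letter_of_yonRed_eq A.internal hsg hsg' hb heg hde hr
        hx hdx hw ((nary_one _ x).symm.trans (h.trans (nary_one _ _)))
      exact ⟨z, hz, by rw [hC, nary_one, hxz]⟩
  · intro hmin
    have hd : ∀ x, C.b (τ x) = 0 := by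
      intro x
      rw [← nary_one, ← hC, hmin]; rfl
    rcases subsingleton_or_nontrivial A.M with hA | hA
    · refine ⟨A, ⟨0, zero_mem _, fun x => Subsingleton.elim _ _, fun p x _ => Subsingleton.elim _ _,
        fun n _ v _ => Subsingleton.elim _ _⟩, 0, ⟨rfl, fun n => ⟨fun v i x y => Subsingleton.elim _ _,
          fun v i a x => Subsingleton.elim _ _⟩, fun n p v _ => zero_mem _,
          fun n _ p v _ => Subsingleton.elim _ _⟩, fun x y _ => Subsingleton.elim _ _,
        fun y => ⟨0, Subsingleton.elim _ _⟩⟩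
    · obtain ⟨B, v, f, hv, hf, hbij⟩ := CoA.exists_strictUnit_bijective A.internal hsg hb heg hd hl hr
        hA
      refine ⟨B, ⟨v, hv⟩, nary f, hC ▸ hf, ?_⟩
      simpa only [nary_one] using hbij

end Stmt14
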